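/- arXiv:1205.1252 — 4 statements merged into one kernel-verified Lean document; each statement's English description precedes it below -/
import Mathlib

section
/- Let p(n) be the number of partitions of n and for a partition λ of n let l(λ) denote its number of parts. Then for every real x, (1/p(n)) · |{λ ∈ 𝒫(n) : (l(λ) − (√(6n)/π)·log(√(6n)/π)) / (√(6n)/π) ≤ x}| converges as n → ∞ to exp(−e^{−x}). -/
open Filter Real

/-- The number of partitions of `n`. -/
noncomputable def partitionCount (n : ℕ) : ℕ := Nat.card (Nat.Partition n)

/-- The number of parts of a partition. -/
def Nat.Partition.numParts {n : ℕ} (P : n.Partition) : ℕ := Multiset.card P.parts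

/-! ### Conjugation of partitions -/

lemma YoungDiagram.sum_rowLens (μ : YoungDiagram) : μ.rowLens.sum = μ.card := by
  have h : ∀ c ∈ μ.cells, c.1 ∈ Finset.range (μ.colLen 0) := by
    intro c hc
    rw [Finset.mem_range, ← YoungDiagram.mem_iff_lt_colLen]
    exact μ.up_left_mem le_rfl (Nat.zero_le _) ((YoungDiagram.mem_cells c).1 hc)
  rw [YoungDiagram.card, Finset.card_eq_sum_card_fiberwise h]
  change ∑ i ∈ Finset.range (μ.colLen 0), μ.rowLen i = _
  exact Finset.sum_congr rfl fun i _ => μ.rowLen_eq_card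

/-- The partition whose parts are the row lengths of a Young diagram. -/
def YoungDiagram.toPartition {n : ℕ} (μ : {μ : YoungDiagram // μ.card = n}) : n.Partition where
  parts := μ.1.rowLens
  parts_pos := fun {i} hi => μ.1.pos_of_mem_rowLens i (by simpa using hi)
  parts_sum := by rw [Multiset.sum_coe, μ.1.sum_rowLens, μ.2]

lemma YoungDiagram.toPartition_bijective (n : ℕ) :
    Function.Bijective (YoungDiagram.toPartition (n := n)) := by
  constructor
  · intro μ ν h
    have h1 : (μ.1.rowLens : Multiset ℕ) = ν.1.rowLens := congrArg Nat.Partition.parts h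
    have h2 : μ.1.rowLens = ν.1.rowLens :=
      (Multiset.coe_eq_coe.1 h1).eq_of_sortedGE μ.1.rowLens_sorted ν.1.rowLens_sorted
    apply Subtype.ext
    apply YoungDiagram.equivListRowLens.injective
    exact Subtype.ext h2
  · intro P
    have hs : (P.parts.sort (· ≥ ·)).SortedGE := (P.parts.pairwise_sort (· ≥ ·)).sortedGE
    have hpos : ∀ x ∈ P.parts.sort (· ≥ ·), 0 < x := fun x hx =>
      P.parts_pos ((Multiset.mem_sort (· ≥ ·)).1 hx)
    have hrow : (YoungDiagram.ofRowLens _ hs).rowLens = P.parts.sort (· ≥ ·) :=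
      YoungDiagram.rowLens_ofRowLens_eq_self hpos
    refine ⟨⟨YoungDiagram.ofRowLens _ hs, ?_⟩, ?_⟩
    · rw [← YoungDiagram.sum_rowLens, hrow, ← Multiset.sum_coe, Multiset.sort_eq, P.parts_sum]
    · apply Nat.Partition.ext
      change ((YoungDiagram.ofRowLens _ hs).rowLens : Multiset ℕ) = P.parts
      rw [hrow, Multiset.sort_eq]

lemma YoungDiagram.forall_mem_rowLens_le_iff (μ : YoungDiagram) (k : ℕ) :
    (∀ i ∈ μ.rowLens, i ≤ k) ↔ μ.rowLen 0 ≤ k := by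
  simp only [YoungDiagram.rowLens, List.mem_map, List.mem_range, forall_exists_index, and_imp,
    forall_apply_eq_imp_iff₂]
  constructor
  · intro h
    rcases Nat.eq_zero_or_pos (μ.rowLen 0) with h0 | h0
    · omega
    · exact h 0 (YoungDiagram.mem_iff_lt_colLen.1 (YoungDiagram.mem_iff_lt_rowLen.2 h0))
  · intro h i _
    exact (μ.rowLen_anti 0 i (Nat.zero_le i)).trans h

/-- Conjugation: partitions with at most `k` parts are equinumerous with partitions whose parts
are all at most `k`. -/
lemma Nat.Partition.card_numParts_le (n k : ℕ) :
    Nat.card {P : n.Partition // P.numParts ≤ k} = (Nat.Partition.restricted n (· ≤ k)).card := by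
  let e : {μ : YoungDiagram // μ.card = n} ≃ n.Partition :=
    Equiv.ofBijective _ (YoungDiagram.toPartition_bijective n)
  have hT : ∀ μ : YoungDiagram, μ.transpose.card = μ.card := fun μ => by
    simp [YoungDiagram.card, YoungDiagram.transpose]
  let t : {μ : YoungDiagram // μ.card = n} ≃ {μ : YoungDiagram // μ.card = n} :=
    YoungDiagram.transposeOrderIso.toEquiv.subtypeEquiv (fun μ => by
      change μ.card = n ↔ μ.transpose.card = n
      rw [hT])
  have h : ∀ P : n.Partition, P.numParts ≤ k ↔ ∀ i ∈ (e (t (e.symm P))).parts, i ≤ k := by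
    intro P
    obtain ⟨μ, rfl⟩ := e.surjective P
    rw [Equiv.symm_apply_apply]
    change Multiset.card (μ.1.rowLens : Multiset ℕ) ≤ k ↔ ∀ i ∈ μ.1.transpose.rowLens, i ≤ k
    rw [YoungDiagram.forall_mem_rowLens_le_iff, Multiset.coe_card, YoungDiagram.length_rowLens,
      YoungDiagram.rowLen_transpose]
  rw [Nat.card_congr ((e.symm.trans (t.trans e)).subtypeEquiv
    (q := fun Q : n.Partition => ∀ i ∈ Q.parts, i ≤ k) h), Nat.card_eq_fintype_card,
    Fintype.card_subtype, Nat.Partition.restricted]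

lemma Nat.Partition.card_restricted_le_self (n : ℕ) :
    (Nat.Partition.restricted n (· ≤ n)).card = partitionCount n := by
  rw [partitionCount, Nat.card_eq_fintype_card, ← Finset.card_univ]
  congr 1
  exact Finset.filter_true_of_mem fun P _ i hi => P.le_of_mem_parts hi

/-! ### Generating function -/

lemma PowerSeries.coeff_prod_restricted (K n : ℕ) :
    PowerSeries.coeff n (∏ j ∈ Finset.range K,
      (PowerSeries.mk fun i => if (j + 1) ∣ i then (1 : ℂ) else 0)) =
      ((Nat.Partition.restricted n (· ≤ K)).card : ℂ) := by
  classical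
  open scoped PowerSeries.WithPiTopology in
  have h := Nat.Partition.hasProd_powerSeriesMk_card_restricted ℂ (· ≤ K)
  open scoped PowerSeries.WithPiTopology in
  have h2 := hasProd_prod_of_ne_finset_one (s := Finset.range K)
    (f := fun i : ℕ => if i + 1 ≤ K then ∑' j : ℕ, (PowerSeries.X : PowerSeries ℂ) ^ ((i + 1) * j)
      else 1) (L := SummationFilter.unconditional ℕ) (fun b hb => by
        rw [if_neg]; simpa using hb)
  open scoped PowerSeries.WithPiTopology in
  have h3 := h.unique h2
  have h4 := congrArg (PowerSeries.coeff n) h3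
  rw [PowerSeries.coeff_mk] at h4
  rw [h4]
  congr 1
  refine Finset.prod_congr rfl fun j hj => ?_
  rw [if_pos (by simpa using hj)]
  symm
  open scoped PowerSeries.WithPiTopology in
  refine HasSum.tsum_eq ?_
  rw [PowerSeries.WithPiTopology.hasSum_iff_hasSum_coeff]
  intro d
  simp only [PowerSeries.coeff_X_pow, PowerSeries.coeff_mk]
  split_ifs with hd
  · obtain ⟨c, rfl⟩ := hd
    convert! hasSum_ite_eq c (1 : ℂ) using 2 with i
    simp [eq_comm]
  · convert! hasSum_zero using 2 with i
    rw [if_neg]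
    rintro rfl
    exact hd (Dvd.intro _ rfl)

lemma hasSum_mul_coeff {f g : PowerSeries ℂ} {a b z : ℂ}
    (hf : HasSum (fun n => PowerSeries.coeff n f * z ^ n) a)
    (hg : HasSum (fun n => PowerSeries.coeff n g * z ^ n) b)
    (hf' : Summable fun n => ‖PowerSeries.coeff n f * z ^ n‖)
    (hg' : Summable fun n => ‖PowerSeries.coeff n g * z ^ n‖) :
    HasSum (fun n => PowerSeries.coeff n (f * g) * z ^ n) (a * b) ∧
      Summable fun n => ‖PowerSeries.coeff n (f * g) * z ^ n‖ := by
  have key : (fun n => PowerSeries.coeff n (f * g) * z ^ n) = fun n =>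
      ∑ kl ∈ Finset.HasAntidiagonal.antidiagonal n,
        (PowerSeries.coeff kl.1 f * z ^ kl.1) * (PowerSeries.coeff kl.2 g * z ^ kl.2) := by
    funext n
    rw [PowerSeries.coeff_mul, Finset.sum_mul]
    refine Finset.sum_congr rfl fun kl hkl => ?_
    rw [← Finset.HasAntidiagonal.mem_antidiagonal.1 hkl, pow_add]
    ring
  have hs := summable_norm_sum_mul_antidiagonal_of_summable_norm hf' hg'
  refine ⟨?_, hs.congr fun n => congrArg norm (congrFun key n).symm⟩
  rw [key]
  rw [← hf.tsum_eq, ← hg.tsum_eq,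
    tsum_mul_tsum_eq_tsum_sum_antidiagonal_of_summable_norm hf' hg']
  exact hs.of_norm.hasSum

lemma hasSum_ite_dvd_mul_pow {z : ℂ} (hz : ‖z‖ < 1) (m : ℕ) :
    HasSum (fun n => (if (m + 1) ∣ n then (1 : ℂ) else 0) * z ^ n) (1 - z ^ (m + 1))⁻¹ := by
  have hz' : ‖z ^ (m + 1)‖ < 1 := by
    rw [norm_pow]; exact pow_lt_one₀ (norm_nonneg _) hz (by omega)
  have h := hasSum_geometric_of_norm_lt_one hz'
  have hinj : Function.Injective fun i : ℕ => (m + 1) * i :=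
    fun a b hab => Nat.eq_of_mul_eq_mul_left (by omega) hab
  rw [← hinj.hasSum_iff]
  · have hfun : ((fun n => (if (m + 1) ∣ n then (1 : ℂ) else 0) * z ^ n) ∘ fun i => (m + 1) * i) =
        fun i => (z ^ (m + 1)) ^ i := by
      funext i
      simp [pow_mul]
    rw [hfun]
    exact h
  · intro x hx
    rw [if_neg, zero_mul]
    rintro ⟨c, rfl⟩
    exact hx ⟨c, rfl⟩

/-- The generating function of partitions with parts at most `K`. -/
lemma hasSum_card_restricted_mul_pow {z : ℂ} (hz : ‖z‖ < 1) (K : ℕ) :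
    HasSum (fun n => ((Nat.Partition.restricted n (· ≤ K)).card : ℂ) * z ^ n)
      (∏ j ∈ Finset.range K, (1 - z ^ (j + 1))⁻¹) ∧
    Summable fun n => ‖((Nat.Partition.restricted n (· ≤ K)).card : ℂ) * z ^ n‖ := by
  simp only [← PowerSeries.coeff_prod_restricted]
  induction K with
  | zero =>
    have h0 : (fun n => PowerSeries.coeff n (∏ j ∈ Finset.range 0,
      (PowerSeries.mk fun i => if (j + 1) ∣ i then (1 : ℂ) else 0)) * z ^ n) =
        fun n => if n = 0 then 1 else 0 := by
      funext n
      rw [Finset.prod_range_zero, PowerSeries.coeff_one]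
      split_ifs with h <;> simp [h]
    have h1 : (fun n => ‖PowerSeries.coeff n (∏ j ∈ Finset.range 0,
      (PowerSeries.mk fun i => if (j + 1) ∣ i then (1 : ℂ) else 0)) * z ^ n‖) =
        fun n => ‖if n = 0 then (1 : ℂ) else 0‖ := funext fun n => congrArg norm (congrFun h0 n)
    rw [h0, h1]
    refine ⟨by simpa using hasSum_ite_eq 0 (1 : ℂ), ?_⟩
    refine summable_of_ne_finset_zero (s := {0}) fun n hn => ?_
    rw [if_neg (by simpa using hn), norm_zero]
  | succ K ih =>
    simp only [Finset.prod_range_succ]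
    refine hasSum_mul_coeff ih.1 ?_ ih.2 ?_
    · simpa only [PowerSeries.coeff_mk] using hasSum_ite_dvd_mul_pow hz K
    · simp only [PowerSeries.coeff_mk]
      refine (summable_geometric_of_lt_one (norm_nonneg z) hz).of_nonneg_of_le
        (fun n => norm_nonneg _) fun n => ?_
      split_ifs <;> simp

/-! ### Fourier inversion -/

lemma integral_exp_I_mul_intCast_mul (k : ℤ) :
    ∫ t in (-π)..π, Complex.exp (Complex.I * k * t) = if k = 0 then (2 * π : ℂ) else 0 := by
  split_ifs with hk
  · subst hk
    simp
    ring
  · have hc : Complex.I * (k : ℂ) ≠ 0 := mul_ne_zero Complex.I_ne_zero (by exact_mod_cast hk)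
    rw [integral_exp_mul_complex hc, div_eq_zero_iff]
    left
    rw [sub_eq_zero, Complex.exp_eq_exp_iff_exists_int]
    exact ⟨k, by push_cast; ring⟩

/-- Coefficients of a power series recovered by integrating over a circle. -/
lemma integral_hasSum_mul_exp {a : ℕ → ℂ} {q : ℝ} {F : ℝ → ℂ}
    (hsum : Summable fun m => ‖a m * (q : ℂ) ^ m‖)
    (hF : ∀ t : ℝ, HasSum (fun m => a m * ((q : ℂ) * Complex.exp (Complex.I * t)) ^ m) (F t))
    (n : ℕ) :
    ∫ t in (-π)..π, F t * Complex.exp (-(Complex.I * n * t)) = 2 * π * (a n * (q : ℂ) ^ n) := by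
  let f : ℕ → C(ℝ, ℂ) := fun m =>
    ⟨fun t => a m * (q : ℂ) ^ m * Complex.exp (Complex.I * ((m : ℤ) - (n : ℤ) : ℤ) * t),
      by fun_prop⟩
  have hnorm : ∀ (m : ℕ) (t : ℝ), ‖f m t‖ = ‖a m * (q : ℂ) ^ m‖ := by
    intro m t
    change ‖a m * (q : ℂ) ^ m * Complex.exp (Complex.I * ((m : ℤ) - (n : ℤ) : ℤ) * t)‖ = _
    rw [norm_mul, show Complex.I * (((m : ℤ) - (n : ℤ) : ℤ) : ℂ) * (t : ℂ) =
      Complex.I * ((((m : ℤ) - (n : ℤ) : ℤ) : ℝ) * t : ℝ) by push_cast; ring,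
      Complex.norm_exp_I_mul_ofReal, mul_one]
  have hs : Summable fun m => ‖(f m).restrict
      (⟨Set.uIcc (-π) π, isCompact_uIcc⟩ : TopologicalSpace.Compacts ℝ)‖ := by
    refine hsum.of_nonneg_of_le (fun m => norm_nonneg _) fun m => ?_
    rw [ContinuousMap.norm_le _ (norm_nonneg _)]
    intro t
    exact (hnorm m t).le
  have h1 := intervalIntegral.hasSum_intervalIntegral_of_summable_norm hs
  have h2 : ∀ t : ℝ, ∑' m, f m t = F t * Complex.exp (-(Complex.I * n * t)) := by
    intro t
    refine HasSum.tsum_eq ?_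
    convert! (hF t).mul_right (Complex.exp (-(Complex.I * n * t))) using 2 with m
    change a m * (q : ℂ) ^ m * Complex.exp (Complex.I * ((m : ℤ) - (n : ℤ) : ℤ) * t) = _
    rw [mul_pow, ← Complex.exp_nat_mul, mul_assoc (a m), mul_assoc (a m),
      mul_assoc ((q : ℂ) ^ m), ← Complex.exp_add]
    congr 3
    push_cast
    ring
  simp only [h2] at h1
  refine h1.unique ?_
  have h3 : (fun m => ∫ t in (-π)..π, f m t) =
      fun m => if m = n then 2 * π * (a n * (q : ℂ) ^ n) else 0 := by
    funext m
    change ∫ t in (-π)..π,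
      a m * (q : ℂ) ^ m * Complex.exp (Complex.I * ((m : ℤ) - (n : ℤ) : ℤ) * t) = _
    rw [intervalIntegral.integral_const_mul, integral_exp_I_mul_intCast_mul]
    by_cases hmn : m = n
    · subst hmn
      simp
      ring
    · rw [if_neg hmn, if_neg (by omega), mul_zero]
  rw [h3]
  exact hasSum_ite_eq n _

/-- The mean `1 / (e ^ (s j) - 1)` of the multiplicity of the part `j` in the Boltzmann model. -/
noncomputable def boltzmannMean (s : ℝ) (j : ℕ) : ℝ := (exp (s * j) - 1)⁻¹

/-- The characteristic function of the size of a Boltzmann random partition with parts at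
most `K`. -/
noncomputable def boltzmannChar (s : ℝ) (K : ℕ) (t : ℝ) : ℂ :=
  ∏ j ∈ Finset.range K,
    (1 - (boltzmannMean s (j + 1) : ℂ) * (Complex.exp (Complex.I * ((j + 1 : ℕ) * t : ℝ)) - 1))⁻¹

lemma one_sub_pow_inv_eq {s : ℝ} (hs : 0 < s) (t : ℝ) (j : ℕ) :
    (1 - (((exp (-s) : ℝ) : ℂ) * Complex.exp (Complex.I * t)) ^ (j + 1))⁻¹ *
      ((1 - exp (-s * (j + 1)) : ℝ) : ℂ) =
    (1 - (boltzmannMean s (j + 1) : ℂ) *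
      (Complex.exp (Complex.I * ((j + 1 : ℕ) * t : ℝ)) - 1))⁻¹ := by
  have hy : 0 < s * ((j + 1 : ℕ) : ℝ) := by positivity
  have hE : 1 < exp (s * ((j + 1 : ℕ) : ℝ)) := Real.one_lt_exp_iff.2 hy
  have hne : ((exp (s * ((j + 1 : ℕ) : ℝ)) - 1 : ℝ) : ℂ) ≠ 0 := by
    exact_mod_cast (by linarith : exp (s * ((j + 1 : ℕ) : ℝ)) - 1 ≠ 0)
  have hne2 : ((exp (s * ((j + 1 : ℕ) : ℝ)) : ℝ) : ℂ) ≠ 0 := by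
    exact_mod_cast (exp_pos _).ne'
  have h1 : (((exp (-s) : ℝ) : ℂ) * Complex.exp (Complex.I * t)) ^ (j + 1) =
      ((exp (s * ((j + 1 : ℕ) : ℝ)) : ℝ) : ℂ)⁻¹ *
        Complex.exp (Complex.I * ((j + 1 : ℕ) * t : ℝ)) := by
    rw [mul_pow, ← Complex.exp_nat_mul, ← Complex.ofReal_pow, ← Real.exp_nat_mul,
      ← Complex.ofReal_inv, ← Real.exp_neg]
    congr 2
    · push_cast; ring_nf
    · push_cast; ring
  have h2 : exp (-s * (j + 1)) = (exp (s * ((j + 1 : ℕ) : ℝ)))⁻¹ := by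
    rw [← Real.exp_neg]; congr 1; push_cast; ring
  rw [h1, h2, boltzmannMean]
  generalize Complex.exp (Complex.I * ((j + 1 : ℕ) * t : ℝ)) = w
  have h0 : ((1 - (exp (s * ((j + 1 : ℕ) : ℝ)))⁻¹ : ℝ) : ℂ) ≠ 0 := by
    have : (exp (s * ((j + 1 : ℕ) : ℝ)))⁻¹ < 1 := inv_lt_one_of_one_lt₀ hE
    exact_mod_cast (by linarith : 1 - (exp (s * ((j + 1 : ℕ) : ℝ)))⁻¹ ≠ 0)
  rw [← inv_inv ((1 - (exp (s * ((j + 1 : ℕ) : ℝ)))⁻¹ : ℝ) : ℂ), ← mul_inv]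
  congr 1
  rw [← div_eq_mul_inv, div_eq_iff h0]
  push_cast at hne hne2 ⊢
  field_simp
  ring

lemma card_restricted_eq_integral {s : ℝ} (hs : 0 < s) (K n : ℕ) :
    ∫ t in (-π)..π, boltzmannChar s K t * Complex.exp (-(Complex.I * n * t)) =
      ((2 * π * ((Nat.Partition.restricted n (· ≤ K)).card * exp (-s * n) *
        ∏ j ∈ Finset.range K, (1 - exp (-s * (j + 1)))) : ℝ) : ℂ) := by
  have hq : exp (-s) < 1 := Real.exp_lt_one_iff.2 (by linarith)
  have hz : ∀ t : ℝ, ‖((exp (-s) : ℝ) : ℂ) * Complex.exp (Complex.I * t)‖ < 1 := by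
    intro t
    rw [norm_mul, Complex.norm_exp_I_mul_ofReal, mul_one, Complex.norm_real, Real.norm_eq_abs,
      abs_of_pos (exp_pos _)]
    exact hq
  have hz0 : ‖((exp (-s) : ℝ) : ℂ)‖ < 1 := by simpa using hz 0
  have h := integral_hasSum_mul_exp
    (hasSum_card_restricted_mul_pow hz0 K).2
    (fun t => (hasSum_card_restricted_mul_pow (hz t) K).1) n
  have h2 : ∀ t : ℝ, boltzmannChar s K t * Complex.exp (-(Complex.I * n * t)) =
      ((∏ j ∈ Finset.range K, (1 - exp (-s * (j + 1))) : ℝ) : ℂ) *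
      ((∏ j ∈ Finset.range K,
        (1 - (((exp (-s) : ℝ) : ℂ) * Complex.exp (Complex.I * t)) ^ (j + 1))⁻¹) *
        Complex.exp (-(Complex.I * n * t))) := by
    intro t
    rw [boltzmannChar, ← Finset.prod_congr rfl fun j _ => one_sub_pow_inv_eq hs t j,
      Finset.prod_mul_distrib, Complex.ofReal_prod]
    ring
  simp only [h2]
  rw [intervalIntegral.integral_const_mul, h, ← Complex.ofReal_pow, ← Real.exp_nat_mul,
    show (n : ℝ) * -s = -s * n by ring]
  push_cast
  ring

/-! ### Bounds for the characteristic function -/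

lemma cube_div_three_le_sum_sq (J : ℕ) :
    (J : ℝ) ^ 3 / 3 ≤ ∑ j ∈ Finset.range J, ((j : ℝ) + 1) ^ 2 := by
  induction J with
  | zero => simp
  | succ J ih =>
    rw [Finset.sum_range_succ]
    push_cast
    have : (0 : ℝ) ≤ J := Nat.cast_nonneg J
    nlinarith

lemma two_mul_sin_half_mul_sum_cos (t : ℝ) (J : ℕ) :
    2 * sin (t / 2) * ∑ j ∈ Finset.range J, cos ((j + 1) * t) =
      sin ((J + 1 / 2) * t) - sin (t / 2) := by
  induction J with
  | zero => simp; ring_nf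
  | succ J ih =>
    rw [Finset.sum_range_succ, mul_add, ih]
    push_cast
    have h1 : sin ((J + 1 + 1 / 2) * t) = sin ((J + 1) * t + t / 2) := by ring_nf
    have h2 : sin ((J + 1 / 2) * t) = sin ((J + 1) * t - t / 2) := by ring_nf
    rw [h1, h2, sin_add, sin_sub]
    ring

lemma min_le_sum_sin_sq {t : ℝ} (ht : |t| ≤ π) (J : ℕ) :
    min ((J : ℝ) / 4) (t ^ 2 * J ^ 3 / (3 * π ^ 2)) ≤
      ∑ j ∈ Finset.range J, sin ((j + 1) * t / 2) ^ 2 := by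
  wlog h0 : 0 ≤ t generalizing t
  · have := this (t := -t) (by rwa [abs_neg]) (by linarith)
    rw [neg_sq] at this
    refine this.trans_eq (Finset.sum_congr rfl fun j _ => ?_)
    rw [show ((j : ℝ) + 1) * -t / 2 = -((j + 1) * t / 2) by ring, sin_neg, neg_sq]
  rw [abs_of_nonneg h0] at ht
  have hpi := Real.pi_pos
  rcases le_or_gt (t * J) π with h | h
  · refine (min_le_right _ _).trans ?_
    have h1 : ∀ j ∈ Finset.range J,
        t ^ 2 / π ^ 2 * ((j : ℝ) + 1) ^ 2 ≤ sin ((j + 1) * t / 2) ^ 2 := by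
      intro j hj
      have hj' : (j : ℝ) + 1 ≤ J := by exact_mod_cast Finset.mem_range.1 hj
      have hle : ((j : ℝ) + 1) * t / 2 ≤ π / 2 := by nlinarith
      have h2 := Real.mul_le_sin (x := ((j : ℝ) + 1) * t / 2) (by positivity) hle
      have h3 : t ^ 2 / π ^ 2 * ((j : ℝ) + 1) ^ 2 = (2 / π * (((j : ℝ) + 1) * t / 2)) ^ 2 := by
        field_simp
      rw [h3]
      exact pow_le_pow_left₀ (by positivity) h2 2
    refine le_trans ?_ (Finset.sum_le_sum h1)
    rw [← Finset.mul_sum]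
    calc t ^ 2 * (J : ℝ) ^ 3 / (3 * π ^ 2) = t ^ 2 / π ^ 2 * ((J : ℝ) ^ 3 / 3) := by
          field_simp
      _ ≤ _ := by gcongr; exact cube_div_three_le_sum_sq J
  · refine (min_le_left _ _).trans ?_
    have htpos : 0 < t := by
      rcases h0.eq_or_lt with h' | h'
      · rw [← h'] at h; simp at h; linarith
      · exact h'
    have hsin := Real.mul_le_sin (x := t / 2) (by positivity) (by linarith)
    have hsp : 0 < sin (t / 2) := lt_of_lt_of_le (by positivity) hsin
    have hsum := two_mul_sin_half_mul_sum_cos t J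
    have h1 : ∀ j ∈ Finset.range J,
        sin (((j : ℝ) + 1) * t / 2) ^ 2 = 1 / 2 - 1 / 2 * cos ((j + 1) * t) := by
      intro j _
      rw [Real.sin_sq_eq_half_sub]
      ring_nf
    rw [Finset.sum_congr rfl h1, Finset.sum_sub_distrib, ← Finset.mul_sum]
    simp only [Finset.sum_const, Finset.card_range, nsmul_eq_mul]
    set C := ∑ j ∈ Finset.range J, cos (((j : ℝ) + 1) * t)
    have h2 : 2 * sin (t / 2) * C ≤ 1 := by linarith [Real.sin_le_one ((J + 1 / 2) * t)]
    suffices C ≤ J / 2 by linarith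
    by_contra! hC
    have h3 : t / π * J < 1 := by
      have : 2 / π * (t / 2) = t / π := by field_simp
      rw [this] at hsin
      have hJ : (0 : ℝ) ≤ J := Nat.cast_nonneg J
      nlinarith
    rw [div_mul_eq_mul_div, div_lt_one hpi] at h3
    linarith

lemma boltzmannMean_nonneg {s : ℝ} (hs : 0 < s) (j : ℕ) : 0 ≤ boltzmannMean s j := by
  rw [boltzmannMean, inv_nonneg, sub_nonneg, Real.one_le_exp_iff]
  positivity

lemma normSq_one_sub_mul_exp_sub_one (r τ : ℝ) :
    ‖1 - (r : ℂ) * (Complex.exp (Complex.I * τ) - 1)‖ ^ 2 =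
      1 + 4 * (r + r ^ 2) * sin (τ / 2) ^ 2 := by
  rw [← Complex.normSq_eq_norm_sq, mul_comm Complex.I, Complex.exp_mul_I, Complex.normSq_apply]
  simp only [← Complex.ofReal_cos, ← Complex.ofReal_sin, Complex.sub_re, Complex.one_re,
    Complex.mul_re, Complex.ofReal_re, Complex.add_re, Complex.I_re, Complex.ofReal_im,
    Complex.I_im, Complex.sub_im, Complex.add_im, Complex.mul_im, Complex.one_im]
  have h := Real.sin_sq_eq_half_sub (τ / 2)
  rw [show 2 * (τ / 2) = τ by ring] at h
  rw [h]
  have h2 := Real.sin_sq_add_cos_sq τ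
  linear_combination r ^ 2 * h2

lemma exp_half_le_one_add {x : ℝ} (h0 : 0 ≤ x) (h1 : x ≤ 1) : exp (x / 2) ≤ 1 + x := by
  have h := Real.add_one_le_exp (-(x / 2))
  have h2 : exp (x / 2) * exp (-(x / 2)) = 1 := by rw [← Real.exp_add]; simp
  have h3 := exp_pos (x / 2)
  nlinarith

lemma half_le_boltzmannMean {s : ℝ} (hs : 0 < s) {j : ℕ} (hj : 0 < j) (h : s * j ≤ 1) :
    1 / 2 ≤ boltzmannMean s j := by
  have hj' : (0 : ℝ) < j := by exact_mod_cast hj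
  have h1 : 1 < exp (s * j) := Real.one_lt_exp_iff.2 (by positivity)
  have h2 : exp (s * j) ≤ exp 1 := Real.exp_le_exp.2 h
  have h3 := Real.exp_one_lt_d9
  rw [boltzmannMean, one_div]
  exact inv_anti₀ (by linarith) (by linarith)

lemma norm_boltzmannChar_le {s : ℝ} (hs : 0 < s) {J K : ℕ} (hJK : J ≤ K) (hJ : s * J ≤ 1)
    (t : ℝ) :
    ‖boltzmannChar s K t‖ ≤
      exp (-(∑ j ∈ Finset.range J, sin ((j + 1) * t / 2) ^ 2) / 4) := by
  let g : ℕ → ℝ := fun j => if j < J then sin (((j : ℝ) + 1) * t / 2) ^ 2 else 0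
  have hg : ∀ j ∈ Finset.range K, ‖(1 - (boltzmannMean s (j + 1) : ℂ) *
      (Complex.exp (Complex.I * ((j + 1 : ℕ) * t : ℝ)) - 1))⁻¹‖ ≤ exp (-(g j / 4)) := by
    intro j _
    rw [norm_inv, Real.exp_neg]
    refine inv_anti₀ (exp_pos _) ?_
    refine le_of_sq_le_sq ?_ (norm_nonneg _)
    rw [normSq_one_sub_mul_exp_sub_one, ← Real.exp_nat_mul]
    have hr := boltzmannMean_nonneg hs (j + 1)
    have hsq := sq_nonneg (sin (((j + 1 : ℕ) : ℝ) * t / 2))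
    simp only [g]
    split_ifs with hjJ
    · have hj1 : ((j + 1 : ℕ) : ℝ) ≤ J := by exact_mod_cast hjJ
      have hr2 := half_le_boltzmannMean hs (Nat.succ_pos j)
        ((mul_le_mul_of_nonneg_left hj1 hs.le).trans hJ)
      have hle := exp_half_le_one_add hsq (Real.sin_sq_le_one _)
      rw [show ((2 : ℕ) : ℝ) * (sin (((j : ℝ) + 1) * t / 2) ^ 2 / 4) =
        sin (((j + 1 : ℕ) : ℝ) * t / 2) ^ 2 / 2 by push_cast; ring]
      refine hle.trans ?_
      have : 1 ≤ 4 * (boltzmannMean s (j + 1) + boltzmannMean s (j + 1) ^ 2) := by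
        change 1 / 2 ≤ boltzmannMean s (j + 1) at hr2
        nlinarith
      nlinarith
    · simp
      positivity
  rw [boltzmannChar, norm_prod]
  refine (Finset.prod_le_prod (fun _ _ => norm_nonneg _) hg).trans ?_
  rw [← Real.exp_sum, Real.exp_le_exp, Finset.sum_neg_distrib, ← Finset.sum_div, neg_div]
  refine neg_le_neg (div_le_div_of_nonneg_right ?_ (by norm_num))
  have h1 : ∑ j ∈ Finset.range J, sin (((j : ℝ) + 1) * t / 2) ^ 2 = ∑ j ∈ Finset.range J, g j :=
    Finset.sum_congr rfl fun j hj => (if_pos (Finset.mem_range.1 hj)).symm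
  rw [h1]
  refine Finset.sum_le_sum_of_subset_of_nonneg (Finset.range_mono hJK) fun j _ _ => ?_
  simp only [g]
  split_ifs
  · positivity
  · exact le_rfl

/-! ### Second order expansion of the characteristic function -/

lemma norm_exp_I_mul_sub_linear_le (τ : ℝ) :
    ‖Complex.exp (Complex.I * τ) - 1 - Complex.I * τ‖ ≤ 2 * |τ| ^ 2 := by
  have hn : ‖Complex.I * (τ : ℂ)‖ = |τ| := by simp
  rcases le_or_gt |τ| 1 with h | h
  · have h1 := Complex.exp_bound (x := Complex.I * τ) (by rw [hn]; exact h) (n := 2) (by norm_num)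
    rw [hn] at h1
    simp [Finset.sum_range_succ] at h1
    rw [show Complex.exp (Complex.I * τ) - 1 - Complex.I * τ =
      Complex.exp (Complex.I * τ) - (1 + Complex.I * τ) by ring]
    refine h1.trans ?_
    rw [sq_abs]
    nlinarith [sq_nonneg τ]
  · have h1 := Real.norm_exp_I_mul_ofReal_sub_one_le (x := τ)
    have h2 := norm_sub_le (Complex.exp (Complex.I * τ) - 1) (Complex.I * τ)
    rw [hn] at h2
    rw [Real.norm_eq_abs] at h1
    nlinarith

lemma norm_exp_I_mul_sub_quadratic_le (τ : ℝ) :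
    ‖Complex.exp (Complex.I * τ) - 1 - Complex.I * τ + (τ : ℂ) ^ 2 / 2‖ ≤ 3 * |τ| ^ 3 := by
  have hn : ‖Complex.I * (τ : ℂ)‖ = |τ| := by simp
  rcases le_or_gt |τ| 1 with h | h
  · have h1 := Complex.exp_bound (x := Complex.I * τ) (by rw [hn]; exact h) (n := 3) (by norm_num)
    rw [hn] at h1
    simp [Finset.sum_range_succ, mul_pow] at h1
    rw [show Complex.exp (Complex.I * τ) - 1 - Complex.I * τ + (τ : ℂ) ^ 2 / 2 =
      Complex.exp (Complex.I * τ) - (1 + Complex.I * τ + -(τ : ℂ) ^ 2 / 2) by ring]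
    refine h1.trans ?_
    have : 0 ≤ |τ| ^ 3 := by positivity
    norm_num [Nat.factorial]
    nlinarith
  · have h1 := norm_exp_I_mul_sub_linear_le τ
    have h2 := norm_add_le (Complex.exp (Complex.I * τ) - 1 - Complex.I * τ) ((τ : ℂ) ^ 2 / 2)
    have h3 : ‖(τ : ℂ) ^ 2 / 2‖ = |τ| ^ 2 / 2 := by simp
    rw [h3] at h2
    nlinarith [sq_nonneg |τ|, mul_pos (sub_pos.2 h) (sq_pos_of_pos (one_pos.trans h))]

lemma norm_log_inv_sub_le {r τ : ℝ} (hr : 0 ≤ r) (h : r * |τ| ≤ 1 / 2) :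
    ‖Complex.log (1 - (r : ℂ) * (Complex.exp (Complex.I * τ) - 1))⁻¹ -
      (Complex.I * (r * τ : ℝ) - ((r + r ^ 2) * τ ^ 2 / 2 : ℝ))‖ ≤
      3 * ((r + r ^ 2 + r ^ 3) * |τ| ^ 3) := by
  set d : ℂ := Complex.exp (Complex.I * τ) - 1 with hd
  have hd1 : ‖d‖ ≤ |τ| := by
    have := Real.norm_exp_I_mul_ofReal_sub_one_le (x := τ)
    rwa [Real.norm_eq_abs] at this
  have hd2 : ‖d - Complex.I * τ‖ ≤ 2 * |τ| ^ 2 := norm_exp_I_mul_sub_linear_le τ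
  have hd3 : ‖d - Complex.I * τ + (τ : ℂ) ^ 2 / 2‖ ≤ 3 * |τ| ^ 3 :=
    norm_exp_I_mul_sub_quadratic_le τ
  have hnr : ‖(r : ℂ)‖ = r := by rw [Complex.norm_real, Real.norm_eq_abs, abs_of_nonneg hr]
  have hz : ‖(r : ℂ) * d‖ ≤ r * |τ| := by rw [norm_mul, hnr]; gcongr
  have hz1 : ‖(r : ℂ) * d‖ < 1 := by linarith
  have h1 := Complex.norm_log_one_sub_inv_add_logTaylor_neg_le 2 hz1
  have hT : Complex.logTaylor (2 + 1) (-((r : ℂ) * d)) =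
      -((r : ℂ) * d) - ((r : ℂ) * d) ^ 2 / 2 := by
    simp [Complex.logTaylor_succ, Complex.logTaylor_zero]
    ring
  rw [hT] at h1
  have hinv : (1 - ‖(r : ℂ) * d‖)⁻¹ ≤ 2 := by
    rw [inv_le_comm₀ (by linarith) (by norm_num)]; linarith
  have hE1 : ‖Complex.log (1 - (r : ℂ) * d)⁻¹ + (-((r : ℂ) * d) - ((r : ℂ) * d) ^ 2 / 2)‖ ≤
      r ^ 3 * |τ| ^ 3 := by
    refine h1.trans ?_
    have h3 : ‖(r : ℂ) * d‖ ^ (2 + 1) ≤ (r * |τ|) ^ 3 := pow_le_pow_left₀ (norm_nonneg _) hz 3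
    have h4 : ‖(r : ℂ) * d‖ ^ (2 + 1) * (1 - ‖(r : ℂ) * d‖)⁻¹ ≤ (r * |τ|) ^ 3 * 2 := by
      gcongr
    rw [mul_pow] at h4
    have h5 : 0 ≤ r ^ 3 * |τ| ^ 3 := by positivity
    push_cast
    linarith
  have hE2 : ‖(r : ℂ) * (d - Complex.I * τ + (τ : ℂ) ^ 2 / 2)‖ ≤ 3 * (r * |τ| ^ 3) := by
    rw [norm_mul, hnr]
    nlinarith
  have hE3 : ‖(r : ℂ) ^ 2 / 2 * ((d - Complex.I * τ) * (d + Complex.I * τ))‖ ≤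
      2 * (r ^ 2 * |τ| ^ 3) := by
    have h6 : ‖d + Complex.I * τ‖ ≤ 2 * |τ| := by
      have h7 : ‖Complex.I * (τ : ℂ)‖ = |τ| := by simp
      linarith [norm_add_le d (Complex.I * τ)]
    rw [norm_mul, norm_mul, norm_div, norm_pow, hnr, Complex.norm_ofNat]
    calc r ^ 2 / 2 * (‖d - Complex.I * τ‖ * ‖d + Complex.I * τ‖)
        ≤ r ^ 2 / 2 * (2 * |τ| ^ 2 * (2 * |τ|)) := by gcongr
      _ = _ := by ring
  have hid : Complex.log (1 - (r : ℂ) * d)⁻¹ -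
      (Complex.I * (r * τ : ℝ) - ((r + r ^ 2) * τ ^ 2 / 2 : ℝ)) =
      (Complex.log (1 - (r : ℂ) * d)⁻¹ + (-((r : ℂ) * d) - ((r : ℂ) * d) ^ 2 / 2)) +
      (r : ℂ) * (d - Complex.I * τ + (τ : ℂ) ^ 2 / 2) +
      (r : ℂ) ^ 2 / 2 * ((d - Complex.I * τ) * (d + Complex.I * τ)) := by
    push_cast
    linear_combination ((r : ℂ) ^ 2 / 2 * (τ : ℂ) ^ 2) * Complex.I_sq
  rw [hid]
  refine norm_add₃_le.trans ?_
  have h8 : 0 ≤ r ^ 3 * |τ| ^ 3 := by positivity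
  have h9 : 0 ≤ r ^ 2 * |τ| ^ 3 := by positivity
  linarith

lemma boltzmannMean_mul_le_one {s : ℝ} (hs : 0 < s) (j : ℕ) :
    boltzmannMean s (j + 1) * (s * (j + 1)) ≤ 1 := by
  have hy : 0 < s * ((j : ℝ) + 1) := by positivity
  have h := Real.add_one_le_exp (s * ((j : ℝ) + 1))
  rw [boltzmannMean]
  push_cast
  rw [inv_mul_le_one₀ (by linarith)]
  linarith

/-- The mean size of a Boltzmann random partition with parts at most `K`. -/
noncomputable def boltzmannSize (s : ℝ) (K : ℕ) : ℝ :=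
  ∑ j ∈ Finset.range K, ((j : ℝ) + 1) * boltzmannMean s (j + 1)

/-- The contribution of the part `j + 1` to the variance of the size. -/
noncomputable def boltzmannVarTerm (s : ℝ) (j : ℕ) : ℝ :=
  ((j : ℝ) + 1) ^ 2 * (boltzmannMean s (j + 1) + boltzmannMean s (j + 1) ^ 2)

/-- A bound for the third cumulant of the contribution of the part `j + 1`. -/
noncomputable def boltzmannCubeTerm (s : ℝ) (j : ℕ) : ℝ :=
  ((j : ℝ) + 1) ^ 3 *
    (boltzmannMean s (j + 1) + boltzmannMean s (j + 1) ^ 2 + boltzmannMean s (j + 1) ^ 3)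

lemma exists_boltzmannChar_eq_exp {s : ℝ} (hs : 0 < s) (K : ℕ) {t : ℝ} (ht : |t| ≤ s / 2) :
    ∃ E : ℂ, boltzmannChar s K t = Complex.exp (Complex.I * (boltzmannSize s K * t : ℝ) -
        ((∑ j ∈ Finset.range K, boltzmannVarTerm s j) * t ^ 2 / 2 : ℝ) + E) ∧
      ‖E‖ ≤ 3 * (∑ j ∈ Finset.range K, boltzmannCubeTerm s j) * |t| ^ 3 := by
  let L : ℕ → ℂ := fun j => Complex.log (1 - (boltzmannMean s (j + 1) : ℂ) *
    (Complex.exp (Complex.I * ((j + 1 : ℕ) * t : ℝ)) - 1))⁻¹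
  let A : ℕ → ℂ := fun j => Complex.I * (boltzmannMean s (j + 1) * ((j + 1 : ℕ) * t) : ℝ) -
    ((boltzmannMean s (j + 1) + boltzmannMean s (j + 1) ^ 2) * ((j + 1 : ℕ) * t) ^ 2 / 2 : ℝ)
  refine ⟨∑ j ∈ Finset.range K, (L j - A j), ?_, ?_⟩
  · have hA : Complex.I * (boltzmannSize s K * t : ℝ) -
        ((∑ j ∈ Finset.range K, boltzmannVarTerm s j) * t ^ 2 / 2 : ℝ) =
        ∑ j ∈ Finset.range K, A j := by
      simp only [A, boltzmannSize, boltzmannVarTerm]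
      rw [Finset.sum_sub_distrib, ← Finset.mul_sum, ← Complex.ofReal_sum, ← Complex.ofReal_sum,
        Finset.sum_mul, Finset.sum_mul, Finset.sum_div]
      congr 1
      · congr 2
        refine Finset.sum_congr rfl fun j _ => ?_
        push_cast; ring
      · congr 1
        refine Finset.sum_congr rfl fun j _ => ?_
        push_cast; ring
    rw [hA, ← Finset.sum_add_distrib]
    simp only [add_sub_cancel]
    rw [Complex.exp_sum, boltzmannChar]
    refine Finset.prod_congr rfl fun j _ => ?_
    rw [Complex.exp_log]
    refine inv_ne_zero fun h0 => ?_
    have h1 := normSq_one_sub_mul_exp_sub_one (boltzmannMean s (j + 1)) ((j + 1 : ℕ) * t)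
    rw [h0] at h1
    have := boltzmannMean_nonneg hs (j + 1)
    have h2 : 0 ≤ 4 * (boltzmannMean s (j + 1) + boltzmannMean s (j + 1) ^ 2) *
      sin ((j + 1 : ℕ) * t / 2) ^ 2 := by positivity
    simp at h1 h2
    linarith
  · refine (norm_sum_le _ _).trans ?_
    rw [Finset.mul_sum, Finset.sum_mul]
    refine Finset.sum_le_sum fun j _ => ?_
    have hr := boltzmannMean_nonneg hs (j + 1)
    have habs : |((j + 1 : ℕ) : ℝ) * t| = ((j : ℝ) + 1) * |t| := by
      rw [abs_mul, abs_of_nonneg (Nat.cast_nonneg _)]; push_cast; rfl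
    have hb := boltzmannMean_mul_le_one hs j
    have h1 : boltzmannMean s (j + 1) * |((j + 1 : ℕ) : ℝ) * t| ≤ 1 / 2 := by
      rw [habs]
      have h2 : boltzmannMean s (j + 1) * (((j : ℝ) + 1) * |t|) ≤
        boltzmannMean s (j + 1) * (((j : ℝ) + 1) * (s / 2)) := by gcongr
      linarith
    refine (norm_log_inv_sub_le hr h1).trans_eq ?_
    rw [habs, boltzmannCubeTerm]
    ring

/-! ### Estimates for the moments of the Boltzmann model -/

lemma mul_inv_exp_sub_one_le {y : ℝ} (hy : 0 < y) :
    y * (exp y - 1)⁻¹ ≤ (1 + y) * exp (-y) := by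
  have h1 : 0 < exp y - 1 := by linarith [Real.one_lt_exp_iff.2 hy]
  have h2 : exp (-y) * exp y = 1 := by rw [← Real.exp_add]; simp
  have h3 := Real.add_one_le_exp y
  have h4 := exp_pos (-y)
  rw [← div_eq_mul_inv, div_le_iff₀ h1]
  nlinarith

lemma one_add_cube_mul_exp_neg_le {y : ℝ} (hy : 0 ≤ y) :
    (1 + y) ^ 3 * exp (-y) ≤ 1728 * exp (-(3 / 4 * y)) := by
  have h1 := Real.add_one_le_exp (y / 12)
  have h2 : (1 + y) ^ 3 ≤ (12 * exp (y / 12)) ^ 3 :=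
    pow_le_pow_left₀ (by linarith) (by linarith) 3
  have h3 : (12 * exp (y / 12)) ^ 3 * exp (-y) = 1728 * exp (-(3 / 4 * y)) := by
    rw [mul_pow, ← Real.exp_nat_mul, mul_assoc, ← Real.exp_add]
    norm_num
    ring
  rw [← h3]
  gcongr

lemma moments_boltzmannMean_le {s : ℝ} (hs : 0 < s) (j : ℕ) :
    s * (((j : ℝ) + 1) * boltzmannMean s (j + 1)) ≤ 1728 * exp (-(3 / 4 * (s * (j + 1)))) ∧
    s ^ 2 * boltzmannVarTerm s j ≤ 1728 * exp (-(3 / 4 * (s * (j + 1)))) ∧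
    s ^ 3 * boltzmannCubeTerm s j ≤ 1728 * exp (-(3 / 4 * (s * (j + 1)))) := by
  have hy : 0 < s * ((j : ℝ) + 1) := by positivity
  have hr := boltzmannMean_nonneg hs (j + 1)
  have h1 : s * ((j : ℝ) + 1) * boltzmannMean s (j + 1) ≤
      (1 + s * ((j : ℝ) + 1)) * exp (-(s * ((j : ℝ) + 1))) := by
    have := mul_inv_exp_sub_one_le hy
    rw [boltzmannMean]
    push_cast
    exact this
  have hb := boltzmannMean_mul_le_one hs j
  have h3 := one_add_cube_mul_exp_neg_le hy.le
  unfold boltzmannVarTerm boltzmannCubeTerm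
  generalize boltzmannMean s (j + 1) = r at *
  have e1 : s * (((j : ℝ) + 1) * r) = s * ((j : ℝ) + 1) * r := by ring
  have e2 : s ^ 2 * (((j : ℝ) + 1) ^ 2 * (r + r ^ 2)) =
      s * ((j : ℝ) + 1) * r * (s * ((j : ℝ) + 1) + s * ((j : ℝ) + 1) * r) := by ring
  have e3 : s ^ 3 * (((j : ℝ) + 1) ^ 3 * (r + r ^ 2 + r ^ 3)) ≤
      s * ((j : ℝ) + 1) * r * (s * ((j : ℝ) + 1) + s * ((j : ℝ) + 1) * r) ^ 2 := by
    have : s * ((j : ℝ) + 1) * r * (s * ((j : ℝ) + 1) + s * ((j : ℝ) + 1) * r) ^ 2 -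
        s ^ 3 * (((j : ℝ) + 1) ^ 3 * (r + r ^ 2 + r ^ 3)) =
        (s * ((j : ℝ) + 1)) ^ 3 * r ^ 2 := by ring
    have h4 : 0 ≤ (s * ((j : ℝ) + 1)) ^ 3 * r ^ 2 := by positivity
    linarith
  rw [e1, e2]
  have hb' : s * ((j : ℝ) + 1) * r ≤ 1 := by linarith
  generalize s * ((j : ℝ) + 1) = y at *
  have h5 : 0 ≤ y * r := by positivity
  have h6 : 1 ≤ 1 + y := by linarith
  have h7 : y + y * r ≤ 1 + y := by linarith
  have hE := exp_pos (-y)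
  refine ⟨?_, ?_, e3.trans ?_⟩
  · refine h1.trans (le_trans ?_ h3)
    gcongr
    exact le_self_pow₀ h6 (by norm_num)
  · refine le_trans ?_ h3
    calc y * r * (y + y * r) ≤ (1 + y) * exp (-y) * (1 + y) :=
          mul_le_mul h1 h7 (by positivity) (by positivity)
      _ = (1 + y) ^ 2 * exp (-y) := by ring
      _ ≤ (1 + y) ^ 3 * exp (-y) :=
          mul_le_mul_of_nonneg_right (pow_le_pow_right₀ h6 (by norm_num)) hE.le
  · refine le_trans ?_ h3
    calc y * r * (y + y * r) ^ 2 ≤ (1 + y) * exp (-y) * (1 + y) ^ 2 :=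
          mul_le_mul h1 (pow_le_pow_left₀ (by positivity) h7 2) (by positivity) (by positivity)
      _ = (1 + y) ^ 3 * exp (-y) := by ring

lemma half_le_one_sub_exp_neg {a : ℝ} (h0 : 0 ≤ a) (h1 : a ≤ 1) : a / 2 ≤ 1 - exp (-a) := by
  have h2 := Real.add_one_le_exp a
  have h3 : exp (-a) * exp a = 1 := by rw [← Real.exp_add]; simp
  have h4 := exp_pos (-a)
  nlinarith

lemma summable_and_tsum_exp_le {s : ℝ} (hs : 0 < s) (hs1 : s ≤ 1) (K : ℕ) :
    (Summable fun j : ℕ => exp (-(3 / 4 * (s * (((j + K : ℕ) : ℝ) + 1))))) ∧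
    ∑' j : ℕ, exp (-(3 / 4 * (s * (((j + K : ℕ) : ℝ) + 1)))) ≤
      3 * exp (-(3 / 4 * (s * (K + 1)))) / s := by
  have hx0 := exp_pos (-(3 / 4 * s))
  have hx1 : exp (-(3 / 4 * s)) < 1 := Real.exp_lt_one_iff.2 (by linarith)
  have hfun : (fun j : ℕ => exp (-(3 / 4 * (s * (((j + K : ℕ) : ℝ) + 1))))) =
      fun j : ℕ => exp (-(3 / 4 * (s * (K + 1)))) * exp (-(3 / 4 * s)) ^ j := by
    funext j
    rw [← Real.exp_nat_mul, ← Real.exp_add]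
    congr 1
    push_cast
    ring
  rw [hfun]
  refine ⟨(summable_geometric_of_lt_one hx0.le hx1).mul_left _, ?_⟩
  rw [tsum_mul_left, tsum_geometric_of_lt_one hx0.le hx1, mul_comm 3, mul_div_assoc]
  have h := half_le_one_sub_exp_neg (a := 3 / 4 * s) (by positivity) (by linarith)
  gcongr
  rw [inv_le_comm₀ (by linarith) (by positivity), inv_div]
  linarith

lemma summable_tail_le {s : ℝ} (hs : 0 < s) (hs1 : s ≤ 1) {f : ℕ → ℝ} {c : ℝ} (hc : 0 < c)
    (hf0 : ∀ j, 0 ≤ f j) (hf : ∀ j : ℕ, c * f j ≤ 1728 * exp (-(3 / 4 * (s * (j + 1))))) (K : ℕ) :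
    Summable f ∧ ∑' j, f j - ∑ j ∈ Finset.range K, f j ≤
      5184 / (c * s) * exp (-(3 / 4 * (s * (K + 1)))) := by
  have hle : ∀ j : ℕ, f j ≤ 1728 / c * exp (-(3 / 4 * (s * (j + 1)))) := by
    intro j
    rw [div_mul_eq_mul_div, le_div_iff₀ hc, mul_comm]
    exact hf j
  have h0 := (summable_and_tsum_exp_le hs hs1 0).1
  simp only [add_zero] at h0
  have hsum : Summable f := (h0.mul_left (1728 / c)).of_nonneg_of_le hf0 hle
  refine ⟨hsum, ?_⟩
  obtain ⟨h1, h2⟩ := summable_and_tsum_exp_le hs hs1 K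
  rw [← hsum.sum_add_tsum_nat_add K, add_sub_cancel_left]
  calc ∑' j, f (j + K) ≤ ∑' j : ℕ, 1728 / c * exp (-(3 / 4 * (s * (((j + K : ℕ) : ℝ) + 1)))) :=
        ((summable_nat_add_iff K).2 hsum).tsum_le_tsum (fun j => hle (j + K)) (h1.mul_left _)
    _ ≤ 1728 / c * (3 * exp (-(3 / 4 * (s * (K + 1)))) / s) := by
        rw [tsum_mul_left]
        gcongr
    _ = _ := by field_simp; norm_num

/-- The variance of the size of a Boltzmann random partition. -/
noncomputable def boltzmannVar (s : ℝ) : ℝ := ∑' j, boltzmannVarTerm s j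

lemma boltzmannVarTerm_nonneg {s : ℝ} (hs : 0 < s) (j : ℕ) : 0 ≤ boltzmannVarTerm s j := by
  have := boltzmannMean_nonneg hs (j + 1)
  unfold boltzmannVarTerm
  positivity

lemma boltzmannCubeTerm_nonneg {s : ℝ} (hs : 0 < s) (j : ℕ) : 0 ≤ boltzmannCubeTerm s j := by
  have := boltzmannMean_nonneg hs (j + 1)
  unfold boltzmannCubeTerm
  positivity

lemma boltzmannVar_sub_sum_le {s : ℝ} (hs : 0 < s) (hs1 : s ≤ 1) (K : ℕ) :
    boltzmannVar s - ∑ j ∈ Finset.range K, boltzmannVarTerm s j ≤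
      5184 / s ^ 3 * exp (-(3 / 4 * (s * (K + 1)))) := by
  have := (summable_tail_le hs hs1 (pow_pos hs 2) (boltzmannVarTerm_nonneg hs)
    (fun j => (moments_boltzmannMean_le hs j).2.1) K).2
  rwa [← pow_succ] at this

lemma summable_boltzmannVarTerm {s : ℝ} (hs : 0 < s) (hs1 : s ≤ 1) :
    Summable (boltzmannVarTerm s) :=
  (summable_tail_le hs hs1 (pow_pos hs 2) (boltzmannVarTerm_nonneg hs)
    (fun j => (moments_boltzmannMean_le hs j).2.1) 0).1

lemma sum_boltzmannVarTerm_le {s : ℝ} (hs : 0 < s) (hs1 : s ≤ 1) (K : ℕ) :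
    ∑ j ∈ Finset.range K, boltzmannVarTerm s j ≤ boltzmannVar s :=
  (summable_boltzmannVarTerm hs hs1).sum_le_tsum _ fun j _ => boltzmannVarTerm_nonneg hs j

lemma boltzmannVar_le {s : ℝ} (hs : 0 < s) (hs1 : s ≤ 1) : boltzmannVar s ≤ 5184 / s ^ 3 := by
  have h := boltzmannVar_sub_sum_le hs hs1 0
  simp only [Finset.range_zero, Finset.sum_empty, sub_zero] at h
  refine h.trans (mul_le_of_le_one_right (by positivity) (Real.exp_le_one_iff.2 ?_))
  have : 0 ≤ s * ((0 : ℕ) + 1) := by positivity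
  linarith

lemma sum_boltzmannCubeTerm_le {s : ℝ} (hs : 0 < s) (hs1 : s ≤ 1) (K : ℕ) :
    ∑ j ∈ Finset.range K, boltzmannCubeTerm s j ≤ 5184 / s ^ 4 := by
  obtain ⟨h1, h2⟩ := summable_tail_le hs hs1 (pow_pos hs 3) (boltzmannCubeTerm_nonneg hs)
    (fun j => (moments_boltzmannMean_le hs j).2.2) 0
  refine (h1.sum_le_tsum _ fun j _ => boltzmannCubeTerm_nonneg hs j).trans ?_
  simp only [Finset.range_zero, Finset.sum_empty, sub_zero, ← pow_succ] at h2
  refine h2.trans (mul_le_of_le_one_right (by positivity) (Real.exp_le_one_iff.2 ?_))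
  have : 0 ≤ s * ((0 : ℕ) + 1) := by positivity
  linarith

lemma half_le_mul_floor_inv {s : ℝ} (hs : 0 < s) (hs1 : s ≤ 1) :
    1 / 2 ≤ s * ⌊s⁻¹⌋₊ ∧ s * ⌊s⁻¹⌋₊ ≤ 1 := by
  have h1 : 1 ≤ s⁻¹ := (one_le_inv₀ hs).2 hs1
  have h2 : (1 : ℝ) ≤ ⌊s⁻¹⌋₊ := by exact_mod_cast (Nat.one_le_floor_iff s⁻¹).2 h1
  have h3 := Nat.lt_floor_add_one s⁻¹
  have h4 := Nat.floor_le (inv_pos.2 hs).le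
  have h5 : s * s⁻¹ = 1 := mul_inv_cancel₀ hs.ne'
  constructor <;> nlinarith

lemma le_boltzmannVar {s : ℝ} (hs : 0 < s) (hs1 : s ≤ 1) : 1 / (32 * s ^ 3) ≤ boltzmannVar s := by
  obtain ⟨h1, h2⟩ := half_le_mul_floor_inv hs hs1
  refine le_trans ?_ (sum_boltzmannVarTerm_le hs hs1 ⌊s⁻¹⌋₊)
  generalize ⌊s⁻¹⌋₊ = J at *
  have h3 : ∀ j ∈ Finset.range J, 3 / 4 * ((j : ℝ) + 1) ^ 2 ≤ boltzmannVarTerm s j := by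
    intro j hj
    have hj1 : ((j + 1 : ℕ) : ℝ) ≤ J := by exact_mod_cast Finset.mem_range.1 hj
    have hr := half_le_boltzmannMean hs (Nat.succ_pos j)
      ((mul_le_mul_of_nonneg_left hj1 hs.le).trans h2)
    change 1 / 2 ≤ boltzmannMean s (j + 1) at hr
    rw [boltzmannVarTerm, mul_comm]
    gcongr
    nlinarith
  refine le_trans ?_ (Finset.sum_le_sum h3)
  rw [← Finset.mul_sum]
  have h4 := cube_div_three_le_sum_sq J
  have h5 : (1 / 2 : ℝ) ^ 3 ≤ (s * J) ^ 3 := pow_le_pow_left₀ (by norm_num) h1 3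
  have h6 : 1 / (32 * s ^ 3) ≤ (J : ℝ) ^ 3 / 4 := by
    rw [div_le_div_iff₀ (by positivity) (by norm_num)]
    rw [mul_pow] at h5
    linarith
  linarith

/-! ### The mean size -/

lemma exp_neg_div_sq_bounds {u : ℝ} (hu : 0 < u) :
    1 / u ^ 2 - u ^ (-(5 / 4) : ℝ) ≤ exp (-u) / (1 - exp (-u)) ^ 2 ∧
      exp (-u) / (1 - exp (-u)) ^ 2 ≤ 1 / u ^ 2 := by
  have h1 : 0 < 1 - exp (-u) := by linarith [Real.exp_lt_one_iff.2 (neg_lt_zero.2 hu)]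
  have h2 : 1 - exp (-u) ≤ u := by linarith [Real.add_one_le_exp (-u)]
  have hE := exp_pos (-u)
  constructor
  · have h3 : 1 - exp (-u) ≤ u ^ (3 / 4 : ℝ) := by
      rcases le_or_gt u 1 with h | h
      · refine h2.trans ?_
        conv_lhs => rw [← Real.rpow_one u]
        exact Real.rpow_le_rpow_of_exponent_ge hu h (by norm_num)
      · have := Real.one_le_rpow h.le (by norm_num : (0 : ℝ) ≤ 3 / 4)
        linarith
    have h4 : u ^ (-(5 / 4) : ℝ) = u ^ (3 / 4 : ℝ) / u ^ 2 := by
      rw [← Real.rpow_natCast u 2, ← Real.rpow_sub hu]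
      norm_num
    have h5 : exp (-u) / u ^ 2 ≤ exp (-u) / (1 - exp (-u)) ^ 2 := by gcongr
    refine le_trans ?_ h5
    rw [h4, ← sub_div]
    gcongr
    linarith
  · have h3 : (1 - exp (-u)) ^ 2 = exp (-u) * (2 * sinh (u / 2)) ^ 2 := by
      have e1 : exp (-u) = exp (-(u / 2)) ^ 2 := by rw [← Real.exp_nat_mul]; ring_nf
      have e2 : exp (-(u / 2)) * exp (u / 2) = 1 := by rw [← Real.exp_add]; simp
      rw [Real.sinh_eq, e1]
      have e3 : 1 - exp (-(u / 2)) ^ 2 = exp (-(u / 2)) * (exp (u / 2) - exp (-(u / 2))) := by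
        rw [mul_sub, e2]; ring
      rw [e3]
      ring
    have h4 : u / 2 ≤ sinh (u / 2) := Real.self_le_sinh_iff.2 (by positivity)
    have h5 : 0 < sinh (u / 2) := lt_of_lt_of_le (by positivity) h4
    rw [h3, div_mul_eq_div_div, div_self hE.ne']
    gcongr
    linarith

lemma hasSum_boltzmannMean {s : ℝ} (hs : 0 < s) (hs1 : s ≤ 1) :
    HasSum (fun m : ℕ => exp (-(s * (m + 1))) / (1 - exp (-(s * (m + 1)))) ^ 2)
      (∑' j : ℕ, ((j : ℝ) + 1) * boltzmannMean s (j + 1)) := by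
  let f : ℕ × ℕ → ℝ := fun p => ((p.1 : ℝ) + 1) * exp (-(s * (p.1 + 1))) ^ (p.2 + 1)
  have hf0 : 0 ≤ f := fun p => by
    have := exp_pos (-(s * ((p.1 : ℝ) + 1)))
    simp only [f, Pi.zero_apply]
    positivity
  have hrow : ∀ j : ℕ, HasSum (fun m => f (j, m)) (((j : ℝ) + 1) * boltzmannMean s (j + 1)) := by
    intro j
    have hy : 0 < s * ((j : ℝ) + 1) := by positivity
    have hx1 : exp (-(s * ((j : ℝ) + 1))) < 1 := Real.exp_lt_one_iff.2 (by linarith)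
    have h := (hasSum_geometric_of_lt_one (exp_pos (-(s * ((j : ℝ) + 1)))).le hx1).mul_left
      (((j : ℝ) + 1) * exp (-(s * ((j : ℝ) + 1))))
    convert! h using 1
    · funext m
      simp only [f]
      ring
    · rw [boltzmannMean, mul_assoc]
      congr 1
      push_cast
      have h1 : 0 < exp (s * ((j : ℝ) + 1)) - 1 := by linarith [Real.one_lt_exp_iff.2 hy]
      rw [Real.exp_neg]
      have h2 := exp_pos (s * ((j : ℝ) + 1))
      have h3 : 1 - (exp (s * ((j : ℝ) + 1)))⁻¹ = (exp (s * ((j : ℝ) + 1)) - 1) /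
        exp (s * ((j : ℝ) + 1)) := by field_simp
      rw [h3, inv_div]
      field_simp
  have hcol : ∀ m : ℕ, HasSum (fun j => f (j, m))
      (exp (-(s * (m + 1))) / (1 - exp (-(s * (m + 1)))) ^ 2) := by
    intro m
    have hy : 0 < s * ((m : ℝ) + 1) := by positivity
    have hx1 : exp (-(s * ((m : ℝ) + 1))) < 1 := Real.exp_lt_one_iff.2 (by linarith)
    have h := hasSum_coe_mul_geometric_of_norm_lt_one (r := exp (-(s * ((m : ℝ) + 1))))
      (by rwa [Real.norm_eq_abs, abs_of_pos (exp_pos _)])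
    rw [← hasSum_nat_add_iff' 1] at h
    simp only [Finset.range_one, Finset.sum_singleton, Nat.cast_zero, zero_mul, sub_zero] at h
    convert! h using 2 with j
    simp only [f]
    rw [← Real.exp_nat_mul, ← Real.exp_nat_mul]
    push_cast
    congr 2
    ring
  have hsum : Summable f := by
    rw [summable_prod_of_nonneg hf0]
    refine ⟨fun j => (hrow j).summable, ?_⟩
    simp only [fun j => (hrow j).tsum_eq]
    exact (summable_tail_le hs hs1 hs
      (fun j => mul_nonneg (by positivity) (boltzmannMean_nonneg hs _))
      (fun j => (moments_boltzmannMean_le hs j).1) 0).1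
  have h1 := hsum.hasSum.prod_fiberwise hrow
  have h2 := ((Equiv.prodComm ℕ ℕ).hasSum_iff.2 hsum.hasSum).prod_fiberwise (g := fun m : ℕ =>
    exp (-(s * (m + 1))) / (1 - exp (-(s * (m + 1)))) ^ 2) hcol
  rw [h1.tsum_eq]
  exact h2

lemma exists_abs_tsum_boltzmannMean_sub_le :
    ∃ Z : ℝ, 0 ≤ Z ∧ ∀ s : ℝ, 0 < s → s ≤ 1 →
      |∑' j : ℕ, ((j : ℝ) + 1) * boltzmannMean s (j + 1) - π ^ 2 / 6 / s ^ 2| ≤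
        Z * s ^ (-(5 / 4) : ℝ) := by
  have hZ : Summable fun m : ℕ => ((m : ℝ) + 1) ^ (-(5 / 4) : ℝ) := by
    have := (summable_nat_add_iff 1).2
      (Real.summable_nat_rpow.2 (by norm_num : (-(5 / 4) : ℝ) < -1))
    simpa using this
  refine ⟨∑' m : ℕ, ((m : ℝ) + 1) ^ (-(5 / 4) : ℝ), tsum_nonneg fun m => by positivity,
    fun s hs hs1 => ?_⟩
  have h1 := hasSum_boltzmannMean hs hs1
  have h2 : HasSum (fun m : ℕ => 1 / (s * ((m : ℝ) + 1)) ^ 2) (π ^ 2 / 6 / s ^ 2) := by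
    have h := hasSum_zeta_two
    rw [← hasSum_nat_add_iff' 1] at h
    have h' := h.div_const (s ^ 2)
    simp only [Finset.range_one, Finset.sum_singleton, Nat.cast_zero] at h'
    convert! h' using 1
    · funext m
      push_cast
      field_simp
    · simp
  have h3 := hZ.hasSum.mul_right (s ^ (-(5 / 4) : ℝ))
  have h4 : ∀ m : ℕ, ((m : ℝ) + 1) ^ (-(5 / 4) : ℝ) * s ^ (-(5 / 4) : ℝ) =
      (s * ((m : ℝ) + 1)) ^ (-(5 / 4) : ℝ) := fun m => by
    rw [Real.mul_rpow hs.le (by positivity), mul_comm]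
  simp only [h4] at h3
  have hb : ∀ m : ℕ, _ := fun m =>
    exp_neg_div_sq_bounds (u := s * ((m : ℝ) + 1)) (by positivity)
  rw [abs_le]
  constructor
  · have := hasSum_le (fun m => (hb m).1) (h2.sub h3) h1
    linarith
  · have := hasSum_le (fun m => (hb m).2) h1 h2
    have h5 : 0 ≤ (∑' m : ℕ, ((m : ℝ) + 1) ^ (-(5 / 4) : ℝ)) * s ^ (-(5 / 4) : ℝ) :=
      mul_nonneg (tsum_nonneg fun m => by positivity) (by positivity)
    linarith

lemma exists_abs_boltzmannSize_sub_le :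
    ∃ Z : ℝ, 0 ≤ Z ∧ ∀ s : ℝ, 0 < s → s ≤ 1 → ∀ K : ℕ,
      |boltzmannSize s K - π ^ 2 / 6 / s ^ 2| ≤
        Z * s ^ (-(5 / 4) : ℝ) + 5184 / s ^ 2 * exp (-(3 / 4 * (s * (K + 1)))) := by
  obtain ⟨Z, hZ0, hZ⟩ := exists_abs_tsum_boltzmannMean_sub_le
  refine ⟨Z, hZ0, fun s hs hs1 K => ?_⟩
  have hnn : ∀ j : ℕ, 0 ≤ ((j : ℝ) + 1) * boltzmannMean s (j + 1) :=
    fun j => mul_nonneg (by positivity) (boltzmannMean_nonneg hs _)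
  obtain ⟨h1, h2⟩ := summable_tail_le hs hs1 hs hnn
    (fun j => (moments_boltzmannMean_le hs j).1) K
  have h3 := h1.sum_le_tsum (Finset.range K) fun j _ => hnn j
  have h4 := abs_le.1 (hZ s hs hs1)
  rw [← pow_two] at h2
  rw [boltzmannSize, abs_le]
  constructor <;> linarith

/-! ### The local limit theorem -/

lemma exists_norm_boltzmannChar_le :
    ∃ C : ℝ, ∀ s : ℝ, 0 < s → s ≤ 1 → ∀ K : ℕ, 1 < s * (K + 1) → ∀ u : ℝ,
      |u| ≤ π * √(boltzmannVar s) →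
        ‖boltzmannChar s K (u / √(boltzmannVar s))‖ ≤ C * (1 + u ^ 2)⁻¹ := by
  refine ⟨196608 * 51841, fun s hs hs1 K hK u hu => ?_⟩
  obtain ⟨hJ1, hJ2⟩ := half_le_mul_floor_inv hs hs1
  have hJK : ⌊s⁻¹⌋₊ ≤ K := by
    rw [← Nat.lt_succ_iff, Nat.floor_lt (inv_pos.2 hs).le, inv_lt_iff_one_lt_mul₀' hs]
    push_cast
    exact hK
  have hV0 : 0 < boltzmannVar s := lt_of_lt_of_le (by positivity) (le_boltzmannVar hs hs1)
  have hV1 := boltzmannVar_le hs hs1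
  have hσ : 0 < √(boltzmannVar s) := Real.sqrt_pos.2 hV0
  have hσ2 := Real.sq_sqrt hV0.le
  have hπ : π ^ 2 ≤ 10 := by nlinarith [Real.pi_lt_d2, Real.pi_pos]
  have ht : |u / √(boltzmannVar s)| ≤ π := by
    rwa [abs_div, abs_of_pos hσ, div_le_iff₀ hσ]
  have h1 := norm_boltzmannChar_le hs hJK hJ2 (u / √(boltzmannVar s))
  have h2 := min_le_sum_sin_sq ht ⌊s⁻¹⌋₊
  rw [div_pow, hσ2] at h2
  generalize ⌊s⁻¹⌋₊ = J at *
  have hJ3 : (1 / 2 : ℝ) ^ 3 ≤ (s * J) ^ 3 := pow_le_pow_left₀ (by norm_num) hJ1 3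
  have hpos : (0 : ℝ) < 1 + u ^ 2 := by positivity
  refine h1.trans ?_
  rw [le_mul_inv_iff₀ hpos]
  rcases min_le_iff.1 h2 with h | h
  · have h3 : 1 / (32 * s) ≤ (∑ j ∈ Finset.range J,
        sin (((j : ℝ) + 1) * (u / √(boltzmannVar s)) / 2) ^ 2) / 4 := by
      have : 1 / (32 * s) ≤ (J : ℝ) / 16 := by
        rw [div_le_div_iff₀ (by positivity) (by norm_num)]
        linarith
      linarith
    have h4 : exp (-(1 / (32 * s))) ≤ 196608 * s ^ 3 := by
      have := Real.pow_div_factorial_le_exp (1 / (32 * s)) (by positivity) 3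
      rw [Real.exp_neg, inv_le_comm₀ (exp_pos _) (by positivity)]
      refine le_trans (le_of_eq ?_) this
      simp [Nat.factorial]
      field_simp
      norm_num
    have h5 : 1 + u ^ 2 ≤ 51841 / s ^ 3 := by
      have e1 : u ^ 2 ≤ (π * √(boltzmannVar s)) ^ 2 := sq_le_sq' (abs_le.1 hu).1 (abs_le.1 hu).2
      rw [mul_pow, hσ2] at e1
      have e2 : π ^ 2 * boltzmannVar s ≤ 10 * (5184 / s ^ 3) := by gcongr
      have e3 : 1 ≤ 1 / s ^ 3 := (one_le_div₀ (by positivity)).2 (pow_le_one₀ hs.le hs1)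
      have e4 : 51841 / s ^ 3 = 10 * (5184 / s ^ 3) + 1 / s ^ 3 := by ring
      linarith
    calc _ ≤ exp (-(1 / (32 * s))) * (1 + u ^ 2) := by
          gcongr
          linarith
      _ ≤ 196608 * s ^ 3 * (51841 / s ^ 3) := by gcongr
      _ = _ := by field_simp
  · have h3 : u ^ 2 / 4976640 ≤ (∑ j ∈ Finset.range J,
        sin (((j : ℝ) + 1) * (u / √(boltzmannVar s)) / 2) ^ 2) / 4 := by
      have e1 : u ^ 2 / 1244160 ≤ u ^ 2 / boltzmannVar s * J ^ 3 / (3 * π ^ 2) := by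
        have e2 : 1 / 41472 ≤ J ^ 3 / boltzmannVar s := by
          rw [div_le_div_iff₀ (by norm_num) hV0]
          have e3 : 5184 / s ^ 3 ≤ 41472 * J ^ 3 := by
            rw [div_le_iff₀ (by positivity)]
            rw [mul_pow] at hJ3
            linarith
          linarith
        calc u ^ 2 / 1244160 = u ^ 2 * (1 / 41472) / (3 * 10) := by ring
          _ ≤ u ^ 2 * (J ^ 3 / boltzmannVar s) / (3 * π ^ 2) := by gcongr
          _ = _ := by ring
      linarith
    calc _ ≤ exp (-(u ^ 2 / 4976640)) * (1 + u ^ 2) := by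
          gcongr
          linarith
      _ ≤ exp (-(u ^ 2 / 4976640)) * (4976640 * exp (u ^ 2 / 4976640)) := by
          gcongr
          have := Real.add_one_le_exp (u ^ 2 / 4976640)
          linarith
      _ = 4976640 := by
          rw [mul_left_comm, ← Real.exp_add]
          simp
      _ ≤ _ := by norm_num

lemma exp_neg_le_of_log_inv_add_le {s x y : ℝ} (hs : 0 < s) (h : log s⁻¹ + x ≤ y) :
    exp (-(3 / 4 * y)) ≤ exp (-(3 / 4 * x)) * s ^ (3 / 4 : ℝ) := by
  rw [Real.rpow_def_of_pos hs, ← Real.exp_add]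
  rw [Real.log_inv] at h
  gcongr
  linarith

lemma inv_sqrt_boltzmannVar_le {s : ℝ} (hs : 0 < s) (hs1 : s ≤ 1) :
    (√(boltzmannVar s))⁻¹ ≤ 6 * s ^ (3 / 2 : ℝ) := by
  have h1 : 0 < 6 * s ^ (3 / 2 : ℝ) := by positivity
  have h2 : (s ^ (3 / 2 : ℝ)) ^ 2 = s ^ 3 := by
    rw [← Real.rpow_natCast, ← Real.rpow_mul hs.le, ← Real.rpow_natCast s 3]
    norm_num
  have h3 : (6 * s ^ (3 / 2 : ℝ))⁻¹ ≤ √(boltzmannVar s) := by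
    apply Real.le_sqrt_of_sq_le
    refine le_trans ?_ (le_boltzmannVar hs hs1)
    rw [inv_pow, mul_pow, h2, ← one_div]
    gcongr
    norm_num
  rwa [inv_le_comm₀ (lt_of_lt_of_le (by positivity) h3) h1]

lemma tendsto_const_mul_rpow {s : ℕ → ℝ} (hs : Tendsto s atTop (nhdsWithin 0 (Set.Ioi 0)))
    (c : ℝ) {a : ℝ} (ha : 0 < a) : Tendsto (fun n => c * s n ^ a) atTop (nhds 0) := by
  have h := (Real.continuousAt_rpow_const 0 a (Or.inr ha.le)).tendsto.comp
    (hs.mono_right nhdsWithin_le_nhds)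
  rw [Real.zero_rpow ha.ne'] at h
  simpa using h.const_mul c

lemma eventually_pos_and_le_one {s : ℕ → ℝ}
    (hs : Tendsto s atTop (nhdsWithin 0 (Set.Ioi 0))) : ∀ᶠ n in atTop, 0 < s n ∧ s n ≤ 1 :=
  (hs.eventually (eventually_mem_nhdsWithin)).and
    ((hs.mono_right nhdsWithin_le_nhds).eventually_le_const one_pos)

lemma tendsto_boltzmannChar {s : ℕ → ℝ} {K : ℕ → ℕ} {x : ℝ}
    (hs : Tendsto s atTop (nhdsWithin 0 (Set.Ioi 0)))
    (hn : ∀ᶠ n : ℕ in atTop, (n : ℝ) = π ^ 2 / 6 / s n ^ 2)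
    (hK : ∀ᶠ n in atTop, log (s n)⁻¹ + x ≤ s n * (K n + 1)) (u : ℝ) :
    Tendsto (fun n : ℕ => boltzmannChar (s n) (K n) (u / √(boltzmannVar (s n))) *
      Complex.exp (-(Complex.I * n * (u / √(boltzmannVar (s n)) : ℝ)))) atTop
      (nhds (Complex.exp (-(u ^ 2 / 2 : ℝ)))) := by
  have hpos := eventually_pos_and_le_one hs
  have htle : ∀ᶠ n in atTop, |u / √(boltzmannVar (s n))| ≤ 6 * |u| * s n ^ (3 / 2 : ℝ) := by
    filter_upwards [hpos] with n ⟨h0, h1⟩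
    rw [div_eq_mul_inv, abs_mul,
      abs_of_nonneg (inv_nonneg.2 (Real.sqrt_nonneg (boltzmannVar (s n))))]
    have := mul_le_mul_of_nonneg_left (inv_sqrt_boltzmannVar_le h0 h1) (abs_nonneg u)
    linarith
  have hts : ∀ᶠ n in atTop, |u / √(boltzmannVar (s n))| ≤ s n / 2 := by
    have h := (tendsto_const_mul_rpow hs (6 * |u|)
      (by norm_num : (0 : ℝ) < 1 / 2)).eventually_le_const (by norm_num : (0 : ℝ) < 1 / 2)
    filter_upwards [hpos, htle, h] with n ⟨h0, h1⟩ h2 h3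
    refine h2.trans ?_
    have h4 : s n ^ (3 / 2 : ℝ) = s n ^ (1 / 2 : ℝ) * s n := by
      rw [← Real.rpow_add_one h0.ne']
      norm_num
    rw [h4, ← mul_assoc]
    nlinarith
  obtain ⟨E, hE⟩ := Filter.Eventually.choice
    ((hpos.and hts).mono fun n hn => exists_boltzmannChar_eq_exp hn.1.1 (K n) hn.2)
  have hE0 : Tendsto E atTop (nhds 0) := by
    refine squeeze_zero_norm' ?_ (tendsto_const_mul_rpow hs (3 * 5184 * (6 * |u|) ^ 3)
      (by norm_num : (0 : ℝ) < 1 / 2))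
    filter_upwards [hpos, htle, hE] with n ⟨h0, h1⟩ h2 h3
    have h4 := sum_boltzmannCubeTerm_le h0 h1 (K n)
    have h5 : (s n ^ (3 / 2 : ℝ)) ^ 3 = s n ^ (1 / 2 : ℝ) * s n ^ 4 := by
      rw [← Real.rpow_natCast, ← Real.rpow_mul h0.le, ← Real.rpow_natCast (s n) 4,
        ← Real.rpow_add h0]
      norm_num
    calc ‖E n‖ ≤ _ := h3.2
      _ ≤ 3 * (5184 / s n ^ 4) * (6 * |u| * s n ^ (3 / 2 : ℝ)) ^ 3 := by gcongr
      _ = _ := by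
        rw [mul_pow _ (s n ^ (3 / 2 : ℝ)), h5]
        field_simp
  have hM : Tendsto (fun n : ℕ => (boltzmannSize (s n) (K n) - n) * (u / √(boltzmannVar (s n))))
      atTop (nhds 0) := by
    obtain ⟨Z, hZ0, hZ⟩ := exists_abs_boltzmannSize_sub_le
    refine squeeze_zero_norm' ?_ (tendsto_const_mul_rpow hs
      ((Z + 5184 * exp (-(3 / 4 * x))) * (6 * |u|)) (by norm_num : (0 : ℝ) < 1 / 4))
    filter_upwards [hpos, htle, hn, hK] with n ⟨h0, h1⟩ h2 h3 h4
    rw [Real.norm_eq_abs, abs_mul]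
    have h5 := hZ (s n) h0 h1 (K n)
    rw [← h3] at h5
    have h6 := exp_neg_le_of_log_inv_add_le h0 h4
    have h7 : s n ^ (3 / 4 : ℝ) = s n ^ (-(5 / 4) : ℝ) * s n ^ 2 := by
      rw [← Real.rpow_natCast, ← Real.rpow_add h0]
      norm_num
    have h8 : s n ^ (1 / 4 : ℝ) = s n ^ (-(5 / 4) : ℝ) * s n ^ (3 / 2 : ℝ) := by
      rw [← Real.rpow_add h0]
      norm_num
    have h9 : |boltzmannSize (s n) (K n) - n| ≤
        (Z + 5184 * exp (-(3 / 4 * x))) * s n ^ (-(5 / 4) : ℝ) := by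
      calc _ ≤ _ := h5
        _ ≤ Z * s n ^ (-(5 / 4) : ℝ) +
            5184 / s n ^ 2 * (exp (-(3 / 4 * x)) * s n ^ (3 / 4 : ℝ)) := by
          gcongr
        _ = _ := by
          rw [h7]
          field_simp
    calc _ ≤ (Z + 5184 * exp (-(3 / 4 * x))) * s n ^ (-(5 / 4) : ℝ) *
          (6 * |u| * s n ^ (3 / 2 : ℝ)) := by gcongr
      _ = _ := by rw [h8]; ring
  have hV : Tendsto (fun n => (∑ j ∈ Finset.range (K n), boltzmannVarTerm (s n) j) *
      (u / √(boltzmannVar (s n))) ^ 2 / 2) atTop (nhds (u ^ 2 / 2)) := by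
    rw [tendsto_iff_norm_sub_tendsto_zero]
    refine squeeze_zero' (Eventually.of_forall fun n => norm_nonneg _) ?_ (tendsto_const_mul_rpow hs
      (5184 * exp (-(3 / 4 * x)) * 32 * (u ^ 2 / 2)) (by norm_num : (0 : ℝ) < 3 / 4))
    filter_upwards [hpos, hK] with n ⟨h0, h1⟩ h2
    have h3 := boltzmannVar_sub_sum_le h0 h1 (K n)
    have h4 := sum_boltzmannVarTerm_le h0 h1 (K n)
    have h5 := le_boltzmannVar h0 h1
    have h6 := exp_neg_le_of_log_inv_add_le h0 h2
    have hV0 : 0 < boltzmannVar (s n) := lt_of_lt_of_le (by positivity) h5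
    have h7 : (boltzmannVar (s n))⁻¹ ≤ 32 * s n ^ 3 := by
      rw [inv_le_comm₀ hV0 (by positivity), ← one_div]
      exact h5
    rw [div_pow, Real.sq_sqrt hV0.le]
    generalize ∑ j ∈ Finset.range (K n), boltzmannVarTerm (s n) j = W at *
    have h8 : W * (u ^ 2 / boltzmannVar (s n)) / 2 - u ^ 2 / 2 =
        -((boltzmannVar (s n) - W) * (boltzmannVar (s n))⁻¹ * (u ^ 2 / 2)) := by
      field_simp
      ring
    rw [h8, norm_neg, Real.norm_eq_abs, abs_of_nonneg (by
      have : 0 ≤ boltzmannVar (s n) - W := by linarith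
      positivity)]
    calc _ ≤ 5184 / s n ^ 3 * (exp (-(3 / 4 * x)) * s n ^ (3 / 4 : ℝ)) * (32 * s n ^ 3) *
          (u ^ 2 / 2) := by
          gcongr
          refine h3.trans ?_
          gcongr
      _ = _ := by field_simp
  have hlim : Tendsto (fun n : ℕ => Complex.exp (Complex.I *
      ((boltzmannSize (s n) (K n) - n) * (u / √(boltzmannVar (s n))) : ℝ) -
      ((∑ j ∈ Finset.range (K n), boltzmannVarTerm (s n) j) *
        (u / √(boltzmannVar (s n))) ^ 2 / 2 : ℝ) + E n)) atTop
      (nhds (Complex.exp (-(u ^ 2 / 2 : ℝ)))) := by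
    apply (Complex.continuous_exp.tendsto _).comp
    have h1 := ((Complex.continuous_ofReal.tendsto _).comp hM).const_mul Complex.I
    have h2 := (h1.sub ((Complex.continuous_ofReal.tendsto _).comp hV)).add hE0
    simpa [Function.comp_def] using h2
  refine hlim.congr' ?_
  filter_upwards [hE] with n h
  rw [h.1, ← Complex.exp_add]
  congr 1
  push_cast
  ring

lemma tendsto_sqrt_boltzmannVar {s : ℕ → ℝ}
    (hs : Tendsto s atTop (nhdsWithin 0 (Set.Ioi 0))) :
    Tendsto (fun n => √(boltzmannVar (s n))) atTop atTop := by
  have hpos := eventually_pos_and_le_one hs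
  have h1 : Tendsto (fun n => 6 * s n ^ (3 / 2 : ℝ)) atTop (nhdsWithin 0 (Set.Ioi 0)) :=
    tendsto_nhdsWithin_iff.2 ⟨tendsto_const_mul_rpow hs 6 (by norm_num),
      hpos.mono fun n h => by have := h.1; simp only [Set.mem_Ioi]; positivity⟩
  refine tendsto_atTop_mono' _ ?_ h1.inv_tendsto_nhdsGT_zero
  filter_upwards [hpos] with n ⟨h0, h1⟩
  have hV0 : 0 < boltzmannVar (s n) := lt_of_lt_of_le (by positivity) (le_boltzmannVar h0 h1)
  exact inv_le_of_inv_le₀ (Real.sqrt_pos.2 hV0) (inv_sqrt_boltzmannVar_le h0 h1)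

lemma continuous_boltzmannChar {s : ℝ} (hs : 0 < s) (K : ℕ) : Continuous (boltzmannChar s K) := by
  unfold boltzmannChar
  refine continuous_finsetProd _ fun j _ => Continuous.inv₀ (by fun_prop) fun t h => ?_
  have h1 := normSq_one_sub_mul_exp_sub_one (boltzmannMean s (j + 1)) ((j + 1 : ℕ) * t)
  have h2 := boltzmannMean_nonneg hs (j + 1)
  rw [h, norm_zero] at h1
  have : 0 ≤ 4 * (boltzmannMean s (j + 1) + boltzmannMean s (j + 1) ^ 2) *
    sin ((j + 1 : ℕ) * t / 2) ^ 2 := by positivity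
  linarith

lemma tendsto_integral_boltzmannChar {s : ℕ → ℝ} {K : ℕ → ℕ} {x : ℝ}
    (hs : Tendsto s atTop (nhdsWithin 0 (Set.Ioi 0)))
    (hn : ∀ᶠ n : ℕ in atTop, (n : ℝ) = π ^ 2 / 6 / s n ^ 2)
    (hK : ∀ᶠ n in atTop, log (s n)⁻¹ + x ≤ s n * (K n + 1)) :
    Tendsto (fun n : ℕ => (√(boltzmannVar (s n)) : ℂ) *
      ∫ t in (-π)..π, boltzmannChar (s n) (K n) t * Complex.exp (-(Complex.I * n * t))) atTop
      (nhds (√(2 * π) : ℝ)) := by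
  have hpos := eventually_pos_and_le_one hs
  have hσ := tendsto_sqrt_boltzmannVar hs
  obtain ⟨C, hC⟩ := exists_norm_boltzmannChar_le
  let F : ℕ → ℝ → ℂ := fun n =>
    (Set.Ioc (-π * √(boltzmannVar (s n))) (π * √(boltzmannVar (s n)))).indicator fun u =>
      boltzmannChar (s n) (K n) (u / √(boltzmannVar (s n))) *
        Complex.exp (-(Complex.I * n * (u / √(boltzmannVar (s n)) : ℝ)))
  have hlarge : ∀ᶠ n in atTop, 1 < s n * (K n + 1) := by
    have h1 : Tendsto (fun n => log (s n)⁻¹ + x) atTop atTop :=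
      tendsto_atTop_add_const_right _ _ (Real.tendsto_log_atTop.comp hs.inv_tendsto_nhdsGT_zero)
    filter_upwards [hK, h1.eventually_gt_atTop 1] with n h2 h3
    linarith
  have hgauss : ∫ u : ℝ, Complex.exp (-(u ^ 2 / 2 : ℝ)) = (√(2 * π) : ℝ) := by
    have h := integral_gaussian (1 / 2)
    rw [show π / (1 / 2) = 2 * π by ring] at h
    rw [← h, ← integral_complex_ofReal]
    congr 1
    funext u
    push_cast
    congr 1
    ring
  have hmain : Tendsto (fun n => ∫ u, F n u) atTop
      (nhds (∫ u : ℝ, Complex.exp (-(u ^ 2 / 2 : ℝ)))) := by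
    refine MeasureTheory.tendsto_integral_filter_of_dominated_convergence
      (fun u => C * (1 + u ^ 2)⁻¹) ?_ ?_ (integrable_inv_one_add_sq.const_mul C) ?_
    · filter_upwards [hpos] with n ⟨h0, h1⟩
      refine MeasureTheory.AEStronglyMeasurable.indicator ?_ measurableSet_Ioc
      have := continuous_boltzmannChar h0 (K n)
      exact Continuous.aestronglyMeasurable (by fun_prop)
    · filter_upwards [hpos, hlarge] with n ⟨h0, h1⟩ h2
      refine Eventually.of_forall fun u => ?_
      simp only [F, Set.indicator_apply]
      have hnn : 0 ≤ C * (1 + u ^ 2)⁻¹ := by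
        have h3 := (norm_nonneg _).trans (hC (s n) h0 h1 (K n) h2 0 (by simp; positivity))
        simp at h3
        positivity
      split_ifs with h
      · rw [norm_mul]
        have h4 : ‖Complex.exp (-(Complex.I * n * (u / √(boltzmannVar (s n)) : ℝ)))‖ = 1 := by
          rw [Complex.norm_exp]
          simp
        rw [h4, mul_one]
        refine hC (s n) h0 h1 (K n) h2 u (abs_le.2 ⟨?_, h.2⟩)
        linarith [h.1]
      · simpa using hnn
    · refine Eventually.of_forall fun u => (tendsto_boltzmannChar hs hn hK u).congr' ?_
      have h1 := (hσ.const_mul_atTop Real.pi_pos).eventually_gt_atTop |u|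
      filter_upwards [h1] with n h
      have h2 := abs_lt.1 h
      simp only [F]
      rw [Set.indicator_of_mem]
      exact ⟨by linarith [h2.1], h2.2.le⟩
  rw [hgauss] at hmain
  refine hmain.congr' ?_
  filter_upwards [hσ.eventually_gt_atTop 0] with n h
  have h1 := intervalIntegral.integral_comp_div (a := -π * √(boltzmannVar (s n)))
    (b := π * √(boltzmannVar (s n)))
    (fun t : ℝ => boltzmannChar (s n) (K n) t * Complex.exp (-(Complex.I * n * t))) h.ne'
  rw [mul_div_cancel_right₀ _ h.ne', mul_div_cancel_right₀ _ h.ne', Complex.real_smul] at h1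
  rw [← h1, intervalIntegral.integral_of_le (by nlinarith [Real.pi_pos]),
    ← MeasureTheory.integral_indicator measurableSet_Ioc]

/-! ### The product and the limit law -/

lemma abs_log_one_sub_add_le {y : ℝ} (h0 : 0 ≤ y) (h1 : y ≤ 1 / 2) :
    |log (1 - y) + y| ≤ 2 * y ^ 2 := by
  have h := Real.abs_log_sub_add_sum_range_le (x := y) (by rw [abs_of_nonneg h0]; linarith) 1
  simp only [Finset.sum_range_one, Nat.cast_zero, zero_add, pow_one, div_one, abs_of_nonneg h0] at h
  rw [add_comm]
  refine h.trans ?_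
  rw [div_le_iff₀ (by linarith)]
  norm_num
  nlinarith [sq_nonneg y]

lemma tendsto_div_one_sub_exp_neg {s : ℕ → ℝ}
    (hs : Tendsto s atTop (nhdsWithin 0 (Set.Ioi 0))) :
    Tendsto (fun n => s n / (1 - exp (-s n))) atTop (nhds 1) := by
  have h1 : HasDerivAt (fun t : ℝ => 1 - exp (-t)) 1 0 := by
    have := ((Real.hasDerivAt_exp (-0)).comp (0 : ℝ) (hasDerivAt_neg (0 : ℝ))).const_sub 1
    simpa [Function.comp_def] using this
  have h2 := (hasDerivAt_iff_tendsto_slope_zero.1 h1).comp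
    (hs.mono_right (nhdsWithin_mono _ fun t ht => ne_of_gt ht))
  have h3 := h2.inv₀ one_ne_zero
  rw [inv_one] at h3
  refine h3.congr fun n => ?_
  simp [div_eq_mul_inv, mul_comm]

lemma sum_exp_neg_Ico {s : ℝ} (hs : 0 < s) {k n : ℕ} (hkn : k ≤ n) :
    ∑ j ∈ Finset.Ico k n, exp (-s * (j + 1)) =
      (exp (-(s * (k + 1))) / s - exp (-(s * (n + 1))) / s) * (s / (1 - exp (-s))) := by
  have h1 : exp (-s) < 1 := Real.exp_lt_one_iff.2 (by linarith)
  have h2 : ∀ j : ℕ, exp (-s * (j + 1)) = exp (-s) * exp (-s) ^ j := by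
    intro j
    rw [← Real.exp_nat_mul, ← Real.exp_add]
    congr 1
    ring
  have h3 : ∀ j : ℕ, exp (-(s * (j + 1))) = exp (-s) * exp (-s) ^ j := by
    intro j
    rw [← h2]
    congr 1
    ring
  simp only [h2, h3, ← Finset.mul_sum]
  have h4 := geom_sum_Ico_mul_neg (exp (-s)) hkn
  have h5 : 1 - exp (-s) ≠ 0 := by linarith
  field_simp
  rw [← h4]

lemma one_le_pi_sq_div_six : 1 ≤ π ^ 2 / 6 := by nlinarith [Real.pi_gt_three]

lemma eventually_le_self_of_tendsto {s : ℕ → ℝ} {k : ℕ → ℕ} {x : ℝ}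
    (hs : Tendsto s atTop (nhdsWithin 0 (Set.Ioi 0)))
    (hn : ∀ᶠ n : ℕ in atTop, (n : ℝ) = π ^ 2 / 6 / s n ^ 2)
    (hk : Tendsto (fun n => s n * (k n + 1) - log (s n)⁻¹) atTop (nhds x)) :
    ∀ᶠ n in atTop, k n ≤ n := by
  have h1 : Tendsto (fun n => (s n)⁻¹) atTop atTop := hs.inv_tendsto_nhdsGT_zero
  have h2 : ∀ᶠ n in atTop, |log (s n)⁻¹| ≤ 1 / 2 * |(s n)⁻¹| :=
    (Real.isLittleO_log_id_atTop.comp_tendsto h1).bound (by norm_num)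
  filter_upwards [hk.eventually_lt_const (lt_add_one x), h2, hn,
    h1.eventually_ge_atTop (2 * (x + 1)), eventually_pos_and_le_one hs] with n h3 h4 h5 h6 ⟨h7, _⟩
  have h8 : 0 < (s n)⁻¹ := inv_pos.2 h7
  rw [abs_of_pos h8] at h4
  have h9 := le_abs_self (log (s n)⁻¹)
  have h10 : s n * n = π ^ 2 / 6 * (s n)⁻¹ := by
    rw [h5]
    field_simp
  have h11 : 1 ≤ π ^ 2 / 6 := one_le_pi_sq_div_six
  have h12 : s n * (k n + 1) ≤ s n * n := by
    rw [h10]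
    nlinarith
  have h13 := le_of_mul_le_mul_left h12 h7
  exact_mod_cast (by linarith : (k n : ℝ) ≤ n)

lemma tendsto_prod_Ico {s : ℕ → ℝ} {k : ℕ → ℕ} {x : ℝ}
    (hs : Tendsto s atTop (nhdsWithin 0 (Set.Ioi 0)))
    (hn : ∀ᶠ n : ℕ in atTop, (n : ℝ) = π ^ 2 / 6 / s n ^ 2)
    (hk : Tendsto (fun n => s n * (k n + 1) - log (s n)⁻¹) atTop (nhds x)) :
    Tendsto (fun n => ∏ j ∈ Finset.Ico (k n) n, (1 - exp (-s n * (j + 1)))) atTop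
      (nhds (exp (-exp (-x)))) := by
  have hpos := eventually_pos_and_le_one hs
  have hinv : Tendsto (fun n => (s n)⁻¹) atTop atTop := hs.inv_tendsto_nhdsGT_zero
  have hkn := eventually_le_self_of_tendsto hs hn hk
  have h1 : Tendsto (fun n => exp (-(s n * (k n + 1))) / s n) atTop (nhds (exp (-x))) := by
    refine ((Real.continuous_exp.tendsto _).comp hk.neg).congr' ?_
    filter_upwards [hpos] with n ⟨h0, _⟩
    rw [Function.comp_apply, neg_sub, Real.exp_sub, Real.exp_log (inv_pos.2 h0), Real.exp_neg]
    field_simp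
  have h2 : Tendsto (fun n : ℕ => exp (-(s n * (n + 1))) / s n) atTop (nhds 0) := by
    have h := (Real.tendsto_pow_mul_exp_neg_atTop_nhds_zero 1).comp hinv
    refine squeeze_zero' ?_ ?_ h
    · filter_upwards [hpos] with n ⟨h0, _⟩
      positivity
    · filter_upwards [hpos, hn] with n ⟨h0, _⟩ h3
      rw [Function.comp_apply, pow_one, div_eq_mul_inv, mul_comm]
      have h10 : s n * n = π ^ 2 / 6 * (s n)⁻¹ := by
        rw [h3]
        field_simp
      have h11 : 1 ≤ π ^ 2 / 6 := one_le_pi_sq_div_six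
      have h12 : 0 < (s n)⁻¹ := inv_pos.2 h0
      gcongr
      nlinarith
  have hS : Tendsto (fun n => ∑ j ∈ Finset.Ico (k n) n, exp (-s n * (j + 1))) atTop
      (nhds (exp (-x))) := by
    have h := (h1.sub h2).mul (tendsto_div_one_sub_exp_neg hs)
    rw [sub_zero, mul_one] at h
    refine h.congr' ?_
    filter_upwards [hpos, hkn] with n ⟨h0, _⟩ h3
    exact (sum_exp_neg_Ico h0 h3).symm
  have hy : Tendsto (fun n => exp (-(s n * (k n + 1)))) atTop (nhds 0) := by
    have h := h1.mul (hs.mono_right nhdsWithin_le_nhds)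
    rw [mul_zero] at h
    refine h.congr' ?_
    filter_upwards [hpos] with n ⟨h0, _⟩
    exact div_mul_cancel₀ _ h0.ne'
  have hyle : ∀ᶠ n in atTop, ∀ j ∈ Finset.Ico (k n) n,
      exp (-s n * (j + 1)) ≤ exp (-(s n * (k n + 1))) := by
    filter_upwards [hpos] with n ⟨h0, _⟩ j hj
    have h3 : (k n : ℝ) ≤ j := by exact_mod_cast (Finset.mem_Ico.1 hj).1
    rw [Real.exp_le_exp]
    nlinarith
  have hhalf := hy.eventually_le_const (by norm_num : (0 : ℝ) < 1 / 2)
  have hL : Tendsto (fun n => ∑ j ∈ Finset.Ico (k n) n, log (1 - exp (-s n * (j + 1)))) atTop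
      (nhds (-exp (-x))) := by
    have hd : Tendsto (fun n => ∑ j ∈ Finset.Ico (k n) n,
        (log (1 - exp (-s n * (j + 1))) + exp (-s n * (j + 1)))) atTop (nhds 0) := by
      have h := (hy.mul hS).const_mul 2
      rw [zero_mul, mul_zero] at h
      refine squeeze_zero_norm' ?_ h
      filter_upwards [hyle, hhalf] with n h3 h4
      rw [Finset.mul_sum, Finset.mul_sum]
      refine norm_sum_le_of_le _ fun j hj => ?_
      refine (abs_log_one_sub_add_le (exp_pos _).le ((h3 j hj).trans h4)).trans ?_
      rw [pow_two]
      have := h3 j hj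
      gcongr
    have h := hd.sub hS
    rw [zero_sub] at h
    refine h.congr fun n => ?_
    rw [Finset.sum_add_distrib, add_sub_cancel_right]
  refine ((Real.continuous_exp.tendsto _).comp hL).congr' ?_
  filter_upwards [hyle, hhalf] with n h3 h4
  rw [Function.comp_apply, Real.exp_sum]
  refine Finset.prod_congr rfl fun j hj => Real.exp_log ?_
  have := h3 j hj
  linarith

lemma tendsto_card_restricted {s : ℕ → ℝ} {K : ℕ → ℕ} {x : ℝ}
    (hs : Tendsto s atTop (nhdsWithin 0 (Set.Ioi 0)))
    (hn : ∀ᶠ n : ℕ in atTop, (n : ℝ) = π ^ 2 / 6 / s n ^ 2)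
    (hK : ∀ᶠ n in atTop, log (s n)⁻¹ + x ≤ s n * (K n + 1)) :
    Tendsto (fun n : ℕ => √(boltzmannVar (s n)) * (2 * π *
      ((Nat.Partition.restricted n (· ≤ K n)).card * exp (-s n * n) *
        ∏ j ∈ Finset.range (K n), (1 - exp (-s n * (j + 1)))))) atTop (nhds √(2 * π)) := by
  rw [← Filter.tendsto_ofReal_iff]
  refine (tendsto_integral_boltzmannChar hs hn hK).congr' ?_
  filter_upwards [eventually_pos_and_le_one hs] with n ⟨h0, _⟩
  rw [card_restricted_eq_integral h0, ← Complex.ofReal_mul]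

lemma tendsto_card_restricted_div {s : ℕ → ℝ} {k : ℕ → ℕ} {x : ℝ}
    (hs : Tendsto s atTop (nhdsWithin 0 (Set.Ioi 0)))
    (hn : ∀ᶠ n : ℕ in atTop, (n : ℝ) = π ^ 2 / 6 / s n ^ 2)
    (hk : Tendsto (fun n => s n * (k n + 1) - log (s n)⁻¹) atTop (nhds x)) :
    Tendsto (fun n : ℕ => ((Nat.Partition.restricted n (· ≤ k n)).card : ℝ) / partitionCount n)
      atTop (nhds (exp (-exp (-x)))) := by
  have hpos := eventually_pos_and_le_one hs
  have h1 := tendsto_card_restricted (K := k) (x := x - 1) hs hn (by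
    filter_upwards [hk.eventually_const_lt (sub_one_lt x)] with n h
    linarith)
  have h2 := tendsto_card_restricted (K := fun n => n) (x := 0) hs hn (by
    filter_upwards [hpos, hn] with n ⟨h0, _⟩ h
    have h3 := Real.log_le_sub_one_of_pos (inv_pos.2 h0)
    have h4 : s n * n = π ^ 2 / 6 * (s n)⁻¹ := by
      rw [h]
      field_simp
    have h5 : 1 ≤ π ^ 2 / 6 := one_le_pi_sq_div_six
    have h6 := le_mul_of_one_le_left (inv_pos.2 h0).le h5
    rw [add_zero, mul_add, h4, mul_one]
    exact h3.trans ((sub_le_self _ zero_le_one).trans (h6.trans (le_add_of_nonneg_right h0.le))))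
  have hc : √(2 * π) ≠ 0 := (Real.sqrt_pos.2 (by positivity)).ne'
  have h3 := (h1.div h2 hc).mul (tendsto_prod_Ico hs hn hk)
  rw [div_self hc, one_mul] at h3
  refine h3.congr' ?_
  filter_upwards [hpos, eventually_le_self_of_tendsto hs hn hk,
    (tendsto_sqrt_boltzmannVar hs).eventually_gt_atTop 0] with n ⟨h0, _⟩ h4 h5
  have hP : ∀ m : ℕ, ∏ j ∈ Finset.range m, (1 - exp (-s n * ((j : ℝ) + 1))) ≠ 0 := by
    refine fun m => Finset.prod_ne_zero_iff.2 fun j _ => ?_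
    have : exp (-s n * ((j : ℝ) + 1)) < 1 := Real.exp_lt_one_iff.2 (by
      have : 0 < s n * ((j : ℝ) + 1) := by positivity
      linarith)
    linarith
  rw [Pi.div_apply, Nat.Partition.card_restricted_le_self,
    ← Finset.prod_range_mul_prod_Ico (fun j : ℕ => 1 - exp (-s n * ((j : ℝ) + 1))) h4]
  have hP1 := hP (k n)
  have hP2 := hP n
  rw [← Finset.prod_range_mul_prod_Ico (fun j : ℕ => 1 - exp (-s n * ((j : ℝ) + 1))) h4] at hP2
  have hP3 := right_ne_zero_of_mul hP2
  have hE := (exp_pos (-s n * n)).ne'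
  have hπ := Real.pi_pos.ne'
  generalize ∏ j ∈ Finset.range (k n), (1 - exp (-s n * ((j : ℝ) + 1))) = P at *
  generalize ∏ j ∈ Finset.Ico (k n) n, (1 - exp (-s n * ((j : ℝ) + 1))) = Q at *
  generalize exp (-s n * n) = w at *
  generalize √(boltzmannVar (s n)) = σ at *
  have hσ := h5.ne'
  rcases eq_or_ne (partitionCount n : ℝ) 0 with h | h
  · simp [h]
  · field_simp

theorem erdos_lehner_number_of_parts (x : ℝ) :
    Tendsto
      (fun n : ℕ =>
        (Nat.card {P : n.Partition //
            ((P.numParts : ℝ) - (Real.sqrt (6 * n) / π) * Real.log (Real.sqrt (6 * n) / π))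
              / (Real.sqrt (6 * n) / π) ≤ x} : ℝ)
          / (partitionCount n : ℝ))
      atTop (nhds (Real.exp (-Real.exp (-x)))) := by
  have hy : Tendsto (fun n : ℕ => √(6 * n) / π) atTop atTop :=
    (Real.tendsto_sqrt_atTop.comp
      (tendsto_natCast_atTop_atTop.const_mul_atTop (by norm_num))).atTop_div_const Real.pi_pos
  let y : ℕ → ℝ := fun n => √(6 * n) / π
  change Tendsto y atTop atTop at hy
  let s : ℕ → ℝ := fun n => (y n)⁻¹
  let k : ℕ → ℕ := fun n => ⌊y n * (log (y n) + x)⌋₊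
  have hs : Tendsto s atTop (nhdsWithin 0 (Set.Ioi 0)) := tendsto_inv_atTop_nhdsGT_zero.comp hy
  have hy0 := hy.eventually_gt_atTop 0
  have hn : ∀ᶠ n : ℕ in atTop, (n : ℝ) = π ^ 2 / 6 / s n ^ 2 := by
    filter_upwards with n
    simp only [s, y]
    rw [inv_pow, div_pow, Real.sq_sqrt (by positivity)]
    field_simp
  have hnn : ∀ᶠ n in atTop, 0 ≤ log (y n) + x :=
    (tendsto_atTop_add_const_right _ x (Real.tendsto_log_atTop.comp hy)).eventually_ge_atTop 0
  have hk : Tendsto (fun n => s n * (k n + 1) - log (s n)⁻¹) atTop (nhds x) := by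
    have h1 : Tendsto (fun n => x + s n) atTop (nhds x) := by
      simpa using (hs.mono_right nhdsWithin_le_nhds).const_add x
    refine tendsto_of_tendsto_of_tendsto_of_le_of_le' tendsto_const_nhds h1 ?_ ?_
    · filter_upwards [hy0] with n h0
      have h2 := (Nat.lt_floor_add_one (y n * (log (y n) + x))).le
      have h3 : log (y n) + x ≤ s n * (k n + 1) := by
        rw [inv_mul_eq_div, le_div_iff₀ h0, mul_comm]
        exact h2
      rw [inv_inv]
      linarith
    · filter_upwards [hy0, hnn] with n h0 h1
      have h2 := Nat.floor_le (mul_nonneg h0.le h1)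
      have h3 : s n * k n ≤ log (y n) + x := by
        rw [inv_mul_eq_div, div_le_iff₀ h0, mul_comm]
        exact h2
      rw [inv_inv]
      linarith
  refine (tendsto_card_restricted_div hs hn hk).congr' ?_
  filter_upwards [hy0, hnn] with n h0 h1
  rw [← Nat.Partition.card_numParts_le]
  have hiff : ∀ P : n.Partition, P.numParts ≤ k n ↔
      ((P.numParts : ℝ) - y n * log (y n)) / y n ≤ x := fun P => by
    rw [Nat.le_floor_iff (mul_nonneg h0.le h1), div_le_iff₀ h0, mul_add, sub_le_iff_le_add,
      mul_comm x, add_comm]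
  simp only [hiff, y]
end

section
/- (Bringmann–Mahlburg–Rhoades moment asymptotics) For each fixed positive integer l, the even rank moments satisfy N_{2l}(n) / ((6n)^l · p(n)) → (2^{2l} − 2)·|B_{2l}| as n → ∞, where B_{2l} is the (2l)-th Bernoulli number. -/
open Filter

/-- The rank of a partition: largest part minus number of parts. -/
def Nat.Partition.rank {n : ℕ} (P : n.Partition) : ℤ :=
  (P.parts.sup : ℤ) - (Multiset.card P.parts : ℤ)

/-- `rankCount n m` is `N(n,m)`, the number of partitions of `n` with rank `m`. -/
noncomputable def rankCount (n : ℕ) (m : ℤ) : ℕ :=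
  Nat.card {P : n.Partition // P.rank = m}

/-- The `k`-th rank moment `N_k(n) = ∑_{m ∈ ℤ} m^k N(n,m)`; since every partition of `n`
has rank in `[-n, n]`, this finite sum equals the sum over `Finset.Icc (-n) n`. -/
noncomputable def rankMoment (k : ℕ) (n : ℕ) : ℤ :=
  ∑ m ∈ Finset.Icc (-(n : ℤ)) (n : ℤ), m ^ k * (rankCount n m : ℤ)

section

open MeasureTheory Set Real

theorem partitionCount_eq_card (n : ℕ) : partitionCount n = Fintype.card n.Partition :=
  Nat.card_eq_fintype_card

theorem partitionCount_pos (n : ℕ) : 0 < partitionCount n := by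
  rw [partitionCount_eq_card]
  exact Fintype.card_pos

theorem partitionCount_mono : Monotone partitionCount := by
  refine monotone_nat_of_le_succ fun n => ?_
  refine Nat.card_le_card_of_injective
    (fun P : n.Partition => (⟨1 ::ₘ P.parts, ?_, ?_⟩ : (n + 1).Partition)) ?_
  · intro i hi
    rcases Multiset.mem_cons.1 hi with rfl | hi
    · exact one_pos
    · exact P.parts_pos hi
  · rw [Multiset.sum_cons, P.parts_sum, add_comm]
  · intro P Q h
    ext1
    simpa using congrArg Nat.Partition.parts h

/-- Partitions of `k + d * m` containing the part `m` at least `d` times correspond to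
partitions of `k`. -/
theorem card_le_count_parts (k d m : ℕ) (hm : 0 < m) :
    Nat.card {P : (k + d * m).Partition // d ≤ P.parts.count m} = partitionCount k := by
  refine Nat.card_congr
    { toFun := fun P => ⟨P.1.parts - Multiset.replicate d m, fun {i} hi =>
        P.1.parts_pos (Multiset.mem_of_le (Multiset.sub_le_self _ _) hi), ?_⟩
      invFun := fun P => ⟨⟨P.parts + Multiset.replicate d m, ?_, ?_⟩, ?_⟩
      left_inv := ?_
      right_inv := ?_ }
  · have h := congrArg Multiset.sum
      (Multiset.sub_add_cancel (Multiset.le_count_iff_replicate_le.1 P.2))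
    rw [Multiset.sum_add, P.1.parts_sum, Multiset.sum_replicate, smul_eq_mul] at h
    omega
  · intro i hi
    rcases Multiset.mem_add.1 hi with hi | hi
    · exact P.parts_pos hi
    · rw [Multiset.eq_of_mem_replicate hi]
      exact hm
  · simp [P.parts_sum]
  · simp
  · intro P
    apply Subtype.ext
    ext1
    exact Multiset.sub_add_cancel (Multiset.le_count_iff_replicate_le.1 P.2)
  · intro P
    ext1
    exact Multiset.add_sub_cancel_right

/-- The partition function extended by zero to negative reals and by steps to positive ones. -/
noncomputable def partitionStep (t : ℝ) : ℝ := if 0 ≤ t then (partitionCount ⌊t⌋₊ : ℝ) else 0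

theorem partitionStep_natCast (n : ℕ) : partitionStep n = partitionCount n := by
  simp [partitionStep]

theorem partitionStep_nonneg (t : ℝ) : 0 ≤ partitionStep t := by
  unfold partitionStep
  split_ifs <;> positivity

theorem partitionStep_of_neg {t : ℝ} (ht : t < 0) : partitionStep t = 0 :=
  if_neg (not_le.2 ht)

theorem partitionStep_mono : Monotone partitionStep := by
  intro s t hst
  unfold partitionStep
  split_ifs with h1 h2
  · exact_mod_cast partitionCount_mono (Nat.floor_le_floor hst)
  · linarith
  · positivity
  · rfl

theorem partitionStep_sub_natCast {t : ℝ} (ht : 0 ≤ t) (k : ℕ) :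
    partitionStep (t - k) = if k ≤ ⌊t⌋₊ then (partitionCount (⌊t⌋₊ - k) : ℝ) else 0 := by
  have h : (0 ≤ t - k) ↔ k ≤ ⌊t⌋₊ := by rw [sub_nonneg, Nat.le_floor_iff ht]
  simp only [partitionStep, h, Nat.floor_sub_natCast]

theorem count_parts_mul_le {n : ℕ} (P : n.Partition) (m : ℕ) : P.parts.count m * m ≤ n := by
  obtain ⟨s, hs⟩ := Multiset.le_iff_exists_add.1
    (Multiset.le_count_iff_replicate_le.1 (le_refl (P.parts.count m)))
  have h := congrArg Multiset.sum hs
  rw [P.parts_sum, Multiset.sum_add, Multiset.sum_replicate, smul_eq_mul] at h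
  omega

theorem card_le_count_parts_eq_ite (n d m : ℕ) (hm : 0 < m) :
    Nat.card {P : n.Partition // d ≤ P.parts.count m}
      = if d * m ≤ n then partitionCount (n - d * m) else 0 := by
  split_ifs with h
  · obtain ⟨k, rfl⟩ := Nat.exists_eq_add_of_le' h
    rw [card_le_count_parts k d m hm, Nat.add_sub_cancel]
  · rw [Nat.card_eq_zero]
    refine Or.inl ⟨fun P => h ?_⟩
    exact (Nat.mul_le_mul_right m P.2).trans (count_parts_mul_le P.1 m)

theorem parts_sum_eq {n : ℕ} (P : n.Partition) :
    n = ∑ d ∈ Finset.range n, ∑ m ∈ Finset.range n,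
      (m + 1) * if d + 1 ≤ P.parts.count (m + 1) then 1 else 0 := by
  have hc : ∀ m, P.parts.count (m + 1) ≤ n := fun m =>
    (Nat.le_mul_of_pos_right _ m.succ_pos).trans (count_parts_mul_le P (m + 1))
  rw [Finset.sum_comm]
  have h1 : ∀ m, ∑ d ∈ Finset.range n, (m + 1) * (if d + 1 ≤ P.parts.count (m + 1) then 1 else 0)
      = P.parts.count (m + 1) * (m + 1) := fun m => by
    rw [← Finset.mul_sum, ← Finset.card_filter, mul_comm]
    congr 1
    have : (Finset.range n).filter (fun d => d + 1 ≤ P.parts.count (m + 1))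
        = Finset.range (P.parts.count (m + 1)) := by
      ext d
      have := hc m
      simp only [Finset.mem_filter, Finset.mem_range]
      omega
    rw [this, Finset.card_range]
  simp_rw [h1]
  have h3 := Finset.sum_multiset_count_of_subset P.parts (Finset.range (n + 1)) (fun i hi =>
    Finset.mem_range.2 (Nat.lt_succ_of_le (P.le_of_mem_parts (Multiset.mem_toFinset.1 hi))))
  rw [P.parts_sum, Finset.sum_range_succ'] at h3
  simpa using h3

theorem mul_partitionCount_eq_sum (n : ℕ) :
    n * partitionCount n = ∑ d ∈ Finset.range n, ∑ m ∈ Finset.range n,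
      (m + 1) * if (d + 1) * (m + 1) ≤ n then partitionCount (n - (d + 1) * (m + 1)) else 0 := by
  have h1 : n * partitionCount n = ∑ P : n.Partition, n := by
    rw [partitionCount_eq_card, Finset.sum_const, Finset.card_univ, smul_eq_mul, mul_comm]
  have h2 : ∑ P : n.Partition, n = ∑ P : n.Partition, ∑ d ∈ Finset.range n,
      ∑ m ∈ Finset.range n, (m + 1) * if d + 1 ≤ P.parts.count (m + 1) then 1 else 0 :=
    Finset.sum_congr rfl fun P _ => parts_sum_eq P
  rw [h1, h2, Finset.sum_comm]
  refine Finset.sum_congr rfl fun d _ => ?_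
  rw [Finset.sum_comm]
  refine Finset.sum_congr rfl fun m _ => ?_
  rw [← card_le_count_parts_eq_ite n (d + 1) (m + 1) m.succ_pos, ← Finset.mul_sum,
    ← Finset.card_filter, Nat.card_eq_fintype_card, Fintype.card_subtype]

/-- The recurrence `n p(n) = ∑_{d, m ≥ 1} m p(n - d m)`. -/
theorem floor_mul_partitionStep (t : ℝ) :
    ⌊t⌋₊ * partitionStep t = ∑' d : ℕ, ∑' m : ℕ,
      ((m : ℝ) + 1) * partitionStep (t - (d + 1) * (m + 1)) := by
  rcases lt_or_ge t 0 with ht | ht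
  · have : ∀ d m : ℕ, partitionStep (t - (d + 1) * (m + 1)) = 0 := fun d m =>
      partitionStep_of_neg (by nlinarith [(by positivity : (0 : ℝ) ≤ (d + 1) * (m + 1))])
    simp [this, partitionStep_of_neg ht]
  have key : ∀ d m : ℕ, partitionStep (t - (d + 1) * (m + 1)) =
      if (d + 1) * (m + 1) ≤ ⌊t⌋₊ then (partitionCount (⌊t⌋₊ - (d + 1) * (m + 1)) : ℝ) else 0 :=
    fun d m => by
      rw [← partitionStep_sub_natCast ht]
      push_cast
      rfl
  have hz : ∀ d m : ℕ, ⌊t⌋₊ ≤ d ∨ ⌊t⌋₊ ≤ m → partitionStep (t - (d + 1) * (m + 1)) = 0 := by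
    intro d m h
    rw [key, if_neg]
    rcases h with h | h <;> nlinarith [Nat.zero_le (d * m)]
  rw [tsum_eq_sum (s := Finset.range ⌊t⌋₊)]
  · have h0 : partitionStep t = partitionCount ⌊t⌋₊ := if_pos ht
    rw [h0]
    have := congrArg (Nat.cast : ℕ → ℝ) (mul_partitionCount_eq_sum ⌊t⌋₊)
    push_cast at this
    rw [this]
    refine Finset.sum_congr rfl fun d _ => ?_
    rw [tsum_eq_sum (s := Finset.range ⌊t⌋₊)]
    · refine Finset.sum_congr rfl fun m _ => ?_
      rw [key]
    · intro m hm
      rw [hz d m (Or.inr (by simpa using hm)), mul_zero]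
  · intro d hd
    simp [hz d _ (Or.inl (by simpa using hd))]

theorem partitionCount_sub_mul_sq_le {n k : ℕ} (hk : k ≤ n) :
    partitionCount (n - k) * k ^ 2 ≤ 2 * (n * partitionCount n) := by
  rcases Nat.eq_zero_or_pos k with rfl | hk0
  · simp
  have hn : 0 < n := hk0.trans_le hk
  have h1 : ∑ m ∈ Finset.range k, (m + 1) * partitionCount (n - k) ≤ n * partitionCount n := by
    rw [mul_partitionCount_eq_sum]
    refine le_trans ?_ (Finset.single_le_sum (f := fun d => ∑ m ∈ Finset.range n, (m + 1) *
      if (d + 1) * (m + 1) ≤ n then partitionCount (n - (d + 1) * (m + 1)) else 0)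
      (fun _ _ => Nat.zero_le _) (Finset.mem_range.2 hn))
    refine le_trans (Finset.sum_le_sum fun m hm => ?_)
      (Finset.sum_le_sum_of_subset (Finset.range_subset_range.2 hk))
    have hm' : m < k := Finset.mem_range.1 hm
    rw [if_pos (by omega)]
    exact Nat.mul_le_mul_left _ (partitionCount_mono (by omega))
  have h2 : (∑ m ∈ Finset.range k, (m + 1)) * 2 = k * (k + 1) := by
    rw [← Finset.sum_range_succ' (fun m => m) k |>.trans (add_zero _),
      Finset.sum_range_id_mul_two, Nat.add_sub_cancel, mul_comm]
  rw [← Finset.sum_mul] at h1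
  nlinarith [Nat.zero_le (k * partitionCount (n - k))]

theorem two_mul_partitionStep_le {n : ℕ} (hn : 0 < n) {t : ℝ} (ht : t ≤ n) :
    2 * partitionStep (t - 3 * √n) ≤ partitionStep t := by
  rcases lt_or_ge (t - 3 * √n) 0 with h | h
  · rw [partitionStep_of_neg h, mul_zero]
    exact partitionStep_nonneg t
  have h1 : 1 ≤ √(n : ℝ) := Real.one_le_sqrt.2 (by exact_mod_cast hn)
  have ht0 : 0 ≤ t := by linarith
  set k := ⌈2 * √(n : ℝ)⌉₊ with hk
  have hk1 : (k : ℝ) < 2 * √n + 1 := Nat.ceil_lt_add_one (by positivity)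
  have hk2 : 2 * √n ≤ (k : ℝ) := Nat.le_ceil _
  have hkt : k ≤ ⌊t⌋₊ := (Nat.le_floor_iff ht0).2 (by linarith)
  have h2 : partitionStep (t - 3 * √n) ≤ partitionCount (⌊t⌋₊ - k) := by
    refine (partitionStep_mono (by linarith : t - 3 * √n ≤ t - k)).trans ?_
    rw [partitionStep_sub_natCast ht0, if_pos hkt]
  have h3 : partitionStep t = partitionCount ⌊t⌋₊ := if_pos ht0
  have h4 : (partitionCount (⌊t⌋₊ - k) : ℝ) * k ^ 2 ≤ 2 * (⌊t⌋₊ * partitionCount ⌊t⌋₊) := by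
    exact_mod_cast partitionCount_sub_mul_sq_le hkt
  have h5 : (⌊t⌋₊ : ℝ) ≤ n := (Nat.floor_le ht0).trans ht
  have h6 : (4 * n : ℝ) ≤ k ^ 2 := by
    have := Real.sq_sqrt (Nat.cast_nonneg (α := ℝ) n)
    nlinarith
  have h7 : (0 : ℝ) < ⌊t⌋₊ := by
    have : (0 : ℝ) < k := by linarith
    exact this.trans_le (by exact_mod_cast hkt)
  rw [h3]
  refine (mul_le_mul_of_nonneg_left h2 zero_le_two).trans ?_
  have h8 : (partitionCount (⌊t⌋₊ - k) : ℝ) * (4 * ⌊t⌋₊) ≤ 2 * (⌊t⌋₊ * partitionCount ⌊t⌋₊) :=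
    (mul_le_mul_of_nonneg_left (by linarith) (Nat.cast_nonneg _)).trans h4
  nlinarith

/-- `p(n - x√n) / p(n)`, the partition function near `n` on the scale `√n`. -/
noncomputable def partitionRatio (n : ℕ) (x : ℝ) : ℝ :=
  partitionStep (n - x * √n) / partitionCount n

theorem partitionRatio_nonneg (n : ℕ) (x : ℝ) : 0 ≤ partitionRatio n x :=
  div_nonneg (partitionStep_nonneg _) (Nat.cast_nonneg _)

theorem partitionRatio_antitone (n : ℕ) : Antitone (partitionRatio n) := fun x y h =>
  div_le_div_of_nonneg_right (partitionStep_mono (by gcongr)) (Nat.cast_nonneg _)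

theorem partitionRatio_zero (n : ℕ) : partitionRatio n 0 = 1 := by
  rw [partitionRatio, zero_mul, sub_zero, partitionStep_natCast]
  exact div_self (by exact_mod_cast (partitionCount_pos n).ne')

theorem partitionRatio_three_mul_le {n : ℕ} (hn : 0 < n) (j : ℕ) :
    partitionRatio n (3 * j) ≤ (1 / 2) ^ j := by
  induction j with
  | zero => simp [partitionRatio_zero]
  | succ j ih =>
    have h := two_mul_partitionStep_le hn (t := n - 3 * j * √n)
      (sub_le_self _ (by positivity))
    have hp : (0 : ℝ) < partitionCount n := by exact_mod_cast partitionCount_pos n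
    rw [partitionRatio, div_le_iff₀ hp] at ih ⊢
    have h2 : (n : ℝ) - 3 * ((j + 1 : ℕ) : ℝ) * √n = n - 3 * j * √n - 3 * √n := by
      push_cast
      ring
    rw [h2, pow_succ]
    linarith

theorem partitionRatio_le_exp {n : ℕ} (hn : 0 < n) {x : ℝ} (hx : 0 ≤ x) :
    partitionRatio n x ≤ 2 * exp (-(log 2 / 3 * x)) := by
  have h1 : (⌊x / 3⌋₊ : ℝ) ≤ x / 3 := Nat.floor_le (by positivity)
  have h2 : x / 3 < ⌊x / 3⌋₊ + 1 := Nat.lt_floor_add_one _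
  refine (partitionRatio_antitone n (by linarith : 3 * (⌊x / 3⌋₊ : ℝ) ≤ x)).trans
    ((partitionRatio_three_mul_le hn _).trans ?_)
  have h3 : (1 / 2 : ℝ) ^ ⌊x / 3⌋₊ = exp (-(log 2 * ⌊x / 3⌋₊)) := by
    rw [mul_comm, ← mul_neg, exp_nat_mul, exp_neg, exp_log two_pos, one_div]
  have h4 : 2 * exp (-(log 2 / 3 * x)) = exp (log 2 + -(log 2 / 3 * x)) := by
    rw [exp_add, exp_log two_pos]
  rw [h3, h4, exp_le_exp]
  nlinarith [log_pos one_lt_two]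

/-- For antitone `G`, the sum `∑ m G(m)` approximates `∫ t G(t) dt`. -/
theorem abs_tsum_sub_integral_le {G : ℝ → ℝ} (hG : Antitone G) (h0 : ∀ x, 0 ≤ G x)
    (hi : IntegrableOn G (Ioi 0)) (hi1 : IntegrableOn (fun t => t * G t) (Ioi 0)) :
    Summable (fun m : ℕ => ((m : ℝ) + 1) * G (m + 1)) ∧
    |∑' m : ℕ, ((m : ℝ) + 1) * G (m + 1) - ∫ t in Ioi 0, t * G t| ≤ ∫ t in Ioi 0, G t ∧
    |∑' m : ℕ, ((m : ℝ) + 1) * G (m + 1) - ∫ t in Ioi 0, t * G t| ≤ ∫ t in Ioi 0, t * G t := by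
  have hint : ∀ a b : ℝ, IntervalIntegrable G volume a b := fun a b => hG.intervalIntegrable
  have hintw : ∀ (w : ℝ → ℝ), Continuous w → ∀ a b : ℝ,
      IntervalIntegrable (fun t => w t * G t) volume a b := fun w hw a b =>
    (hint a b).continuousOn_mul hw.continuousOn
  have hgen : ∀ (w : ℝ → ℝ), Continuous w → IntegrableOn (fun t => w t * G t) (Ioi 0) →
      (∀ t ∈ Ioi (0 : ℝ), 0 ≤ w t) → (∀ m : ℕ, ((m : ℝ) + 1) ≤ ∫ t in (m : ℝ)..(m + 1), w t) →
      ∀ M : ℕ, ∑ m ∈ Finset.range M, ((m : ℝ) + 1) * G (m + 1) ≤ ∫ t in Ioi 0, w t * G t := by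
    intro w hw hwi hw0 hwm M
    have h1 : ∑ m ∈ Finset.range M, ((m : ℝ) + 1) * G (m + 1)
        ≤ ∑ m ∈ Finset.range M, ∫ t in ((m : ℕ) : ℝ)..((m + 1 : ℕ) : ℝ), w t * G t := by
      refine Finset.sum_le_sum fun m _ => ?_
      push_cast
      calc ((m : ℝ) + 1) * G (m + 1) ≤ (∫ t in (m : ℝ)..(m + 1), w t) * G (m + 1) :=
            mul_le_mul_of_nonneg_right (hwm m) (h0 _)
        _ = ∫ t in (m : ℝ)..(m + 1), w t * G (m + 1) :=
            (intervalIntegral.integral_mul_const _ _).symm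
        _ ≤ ∫ t in (m : ℝ)..(m + 1), w t * G t := by
            refine intervalIntegral.integral_mono_on_of_le_Ioo (by linarith)
              ((hw.mul continuous_const).intervalIntegrable _ _) (hintw w hw _ _) ?_
            intro t ht
            have : (0 : ℝ) ≤ m := Nat.cast_nonneg m
            exact mul_le_mul_of_nonneg_left (hG ht.2.le) (hw0 t (mem_Ioi.2 (by linarith [ht.1])))
    refine h1.trans ?_
    rw [intervalIntegral.sum_integral_adjacent_intervals (fun k _ => hintw w hw _ _),
      Nat.cast_zero, intervalIntegral.integral_of_le (Nat.cast_nonneg M)]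
    refine setIntegral_mono_set hwi ?_ (Filter.Eventually.of_forall fun t ht => ht.1)
    filter_upwards [ae_restrict_mem measurableSet_Ioi] with t ht
    exact mul_nonneg (hw0 t ht) (h0 t)
  have hnn : ∀ m : ℕ, 0 ≤ ((m : ℝ) + 1) * G (m + 1) := fun m => mul_nonneg (by positivity) (h0 _)
  have hup1 := hgen (fun t => t + 1) (by fun_prop)
    (IntegrableOn.congr_fun (hi1.add hi) (fun t _ => by simp [add_mul]) measurableSet_Ioi)
    (fun t ht => by linarith [mem_Ioi.1 ht]) (fun m => by
      rw [intervalIntegral.integral_add (continuous_id'.intervalIntegrable _ _)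
        (continuous_const.intervalIntegrable _ _)]
      simp only [integral_id, intervalIntegral.integral_const, smul_eq_mul]
      nlinarith)
  have hup2 := hgen (fun t => 2 * t) (by fun_prop)
    (IntegrableOn.congr_fun (hi1.const_mul 2) (fun t _ => by simp [mul_assoc]) measurableSet_Ioi)
    (fun t ht => by linarith [mem_Ioi.1 ht]) (fun m => by
      rw [intervalIntegral.integral_const_mul, integral_id]
      nlinarith [Nat.cast_nonneg (α := ℝ) m])
  have hsum : Summable (fun m : ℕ => ((m : ℝ) + 1) * G (m + 1)) :=
    summable_of_sum_range_le hnn hup1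
  have hU1 := hsum.tsum_le_of_sum_range_le hup1
  have hU2 := hsum.tsum_le_of_sum_range_le hup2
  have e1 : ∫ t in Ioi (0 : ℝ), (t + 1) * G t = (∫ t in Ioi 0, t * G t) + ∫ t in Ioi 0, G t := by
    rw [← integral_add hi1 hi]
    simp only [add_mul, one_mul]
  have e2 : ∫ t in Ioi (0 : ℝ), (2 * t) * G t = 2 * ∫ t in Ioi 0, t * G t := by
    rw [← integral_const_mul]
    simp only [mul_assoc]
  have e3 : ∫ t in Ioi (0 : ℝ), (t - 1) * G t = (∫ t in Ioi 0, t * G t) - ∫ t in Ioi 0, G t := by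
    rw [← integral_sub hi1 hi]
    simp only [sub_mul, one_mul]
  have hi3 : IntegrableOn (fun t => (t - 1) * G t) (Ioi 0) :=
    IntegrableOn.congr_fun (hi1.sub hi) (fun t _ => by simp [sub_mul]) measurableSet_Ioi
  have hlow : ∀ M : ℕ, ∫ t in (0 : ℝ)..((M + 1 : ℕ) : ℝ), (t - 1) * G t
      ≤ ∑' m : ℕ, ((m : ℝ) + 1) * G (m + 1) := by
    intro M
    refine le_trans ?_ (hsum.sum_le_tsum (Finset.range M) fun m _ => hnn m)
    have hadj := intervalIntegral.sum_integral_adjacent_intervals (a := fun k : ℕ => (k : ℝ))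
      (n := M + 1) (fun k _ => hintw (fun t => t - 1) (by fun_prop) _ _)
    rw [Nat.cast_zero] at hadj
    rw [← hadj, Finset.sum_range_succ']
    have hz : ∫ t in ((0 : ℕ) : ℝ)..((0 + 1 : ℕ) : ℝ), (t - 1) * G t ≤ 0 := by
      have := intervalIntegral.integral_mono_on_of_le_Ioo (a := ((0 : ℕ) : ℝ))
        (b := ((0 + 1 : ℕ) : ℝ)) (by simp) (hintw (fun t => t - 1) (by fun_prop) _ _)
        (g := fun _ => 0) (by simp) (fun t ht => by
          have h2 : t < 1 := by simpa using ht.2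
          nlinarith [h0 t])
      simpa using this
    refine (add_le_of_nonpos_right hz).trans (Finset.sum_le_sum fun m _ => ?_)
    have := intervalIntegral.integral_mono_on_of_le_Ioo (a := ((m + 1 : ℕ) : ℝ))
        (b := ((m + 1 + 1 : ℕ) : ℝ)) (by simp) (hintw (fun t => t - 1) (by fun_prop) _ _)
        (g := fun _ => ((m : ℝ) + 1) * G (m + 1)) (by simp) (fun t ht => by
          obtain ⟨h2, h3⟩ := ht
          push_cast at h2 h3
          exact mul_le_mul (by linarith) (hG h2.le) (h0 t) (by positivity))
    refine this.trans (le_of_eq ?_)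
    simp
  have hL := le_of_tendsto (intervalIntegral_tendsto_integral_Ioi 0 hi3
    (tendsto_natCast_atTop_atTop.comp (tendsto_add_atTop_nat 1))) (Eventually.of_forall hlow)
  have hS0 : 0 ≤ ∑' m : ℕ, ((m : ℝ) + 1) * G (m + 1) := tsum_nonneg hnn
  have hI0 : 0 ≤ ∫ t in Ioi (0 : ℝ), t * G t :=
    setIntegral_nonneg measurableSet_Ioi fun t ht => mul_nonneg (le_of_lt ht) (h0 t)
  rw [e1] at hU1
  rw [e2] at hU2
  rw [e3] at hL
  refine ⟨hsum, ?_, ?_⟩ <;> rw [abs_le] <;> constructor <;> linarith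

theorem integrableOn_pow_mul_exp_neg (k : ℕ) {δ : ℝ} (hδ : 0 < δ) :
    IntegrableOn (fun t : ℝ => t ^ k * exp (-(δ * t))) (Ioi 0) := by
  refine (integrableOn_rpow_mul_exp_neg_mul_rpow (s := k) (p := 1) (b := δ)
    (by linarith [Nat.cast_nonneg (α := ℝ) k]) one_pos hδ).congr_fun (fun t _ => ?_)
    measurableSet_Ioi
  simp

theorem Antitone.integrableOn_pow_mul {f : ℝ → ℝ} (hf : Antitone f) (h0 : ∀ x, 0 ≤ f x)
    {C δ : ℝ} (hδ : 0 < δ) (hC : ∀ x, 0 ≤ x → f x ≤ C * exp (-(δ * x))) (k : ℕ) :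
    IntegrableOn (fun t => t ^ k * f t) (Ioi 0) := by
  refine Integrable.mono' ((integrableOn_pow_mul_exp_neg k hδ).const_mul C)
    ((measurable_id.pow_const k).mul hf.measurable).aestronglyMeasurable ?_
  filter_upwards [ae_restrict_mem measurableSet_Ioi] with t ht
  have ht' : 0 < t := ht
  rw [norm_of_nonneg (mul_nonneg (by positivity) (h0 t))]
  nlinarith [hC t ht'.le, pow_pos ht' k]

/-- A continuous function whose derivative is bounded by that of `B` away from a countable set
varies at most as much as `B`. -/
theorem abs_sub_le_of_hasDerivAt_off_countable {F F' B B' : ℝ → ℝ} {a b : ℝ} (hab : a ≤ b)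
    {s : Set ℝ} (hs : s.Countable) (hF : ContinuousOn F (Icc a b))
    (hF' : ∀ x ∈ Ioo a b \ s, HasDerivAt F (F' x) x) (hi : IntervalIntegrable F' volume a b)
    (hB : ∀ x, HasDerivAt B (B' x) x) (hBi : Continuous B')
    (hle : ∀ x ∈ Ioo a b, |F' x| ≤ B' x) : |F b - F a| ≤ B b - B a := by
  rw [← integral_eq_of_hasDerivAt_off_countable_of_le F F' hab hs hF hF' hi,
    ← intervalIntegral.integral_eq_sub_of_hasDerivAt (fun x _ => hB x)
      (hBi.intervalIntegrable a b)]
  refine (intervalIntegral.abs_integral_le_integral_abs hab).trans ?_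
  exact intervalIntegral.integral_mono_on_of_le_Ioo hab hi.abs (hBi.intervalIntegrable a b) hle

/-- Stability of the integral equation `f(x) = c² ∫ y f(x + y) dy`, whose decaying solution with
`f(0) = 1` is `exp (-c x)`. -/
theorem abs_sub_exp_le {f : ℝ → ℝ} (hf : Antitone f) (h0 : ∀ x, 0 ≤ f x) (hf0 : f 0 = 1)
    {C δ c ε : ℝ} (hδ : 0 < δ) (hc : 0 < c) (hC : ∀ x, 0 ≤ x → f x ≤ C * exp (-(δ * x)))
    (hε : ∀ x, 0 ≤ x → |f x - c ^ 2 * ∫ y in Ioi 0, y * f (x + y)| ≤ ε) {x : ℝ} (hx : 0 ≤ x) :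
    |f x - exp (-(c * x))| ≤ 3 * ε := by
  have hi : IntegrableOn f (Ioi 0) := by simpa using hf.integrableOn_pow_mul h0 hδ hC 0
  have hi1 : IntegrableOn (fun t => t * f t) (Ioi 0) := by
    simpa using hf.integrableOn_pow_mul h0 hδ hC 1
  have hii : ∀ a b : ℝ, IntervalIntegrable f volume a b := fun a b => hf.intervalIntegrable
  have hii1 : ∀ a b : ℝ, IntervalIntegrable (fun t => t * f t) volume a b := fun a b =>
    (hii a b).continuousOn_mul continuous_id.continuousOn
  set s : Set ℝ := {x | ¬ContinuousAt f x} with hs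
  have hsc : s.Countable := hf.countable_not_continuousAt
  set A := ∫ t in Ioi (0 : ℝ), f t
  set A1 := ∫ t in Ioi (0 : ℝ), t * f t
  set G : ℝ → ℝ := fun x => A - ∫ t in (0 : ℝ)..x, f t with hG
  set J : ℝ → ℝ := fun x => (A1 - ∫ t in (0 : ℝ)..x, t * f t) - x * G x with hJ
  have hsub : ∀ x : ℝ, 0 ≤ x → Ioi x ⊆ Ioi (0 : ℝ) := fun x hx => Ioi_subset_Ioi hx
  have hGeq : ∀ x : ℝ, 0 ≤ x → G x = ∫ t in Ioi x, f t := fun x hx => by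
    have := intervalIntegral.integral_interval_add_Ioi hi (hi.mono_set (hsub x hx))
    simp only [hG, A]
    linarith
  have hJeq : ∀ x : ℝ, 0 ≤ x → ∫ y in Ioi 0, y * f (x + y) = J x := fun x hx => by
    have h1 := intervalIntegral.integral_interval_add_Ioi hi1 (hi1.mono_set (hsub x hx))
    have h2 : ∫ y in Ioi 0, y * f (x + y) = ∫ t in Ioi x, (t - x) * f t := by
      have := (measurePreserving_add_left volume x).setIntegral_preimage_emb
        (measurableEmbedding_addLeft x) (fun t => (t - x) * f t) (Ioi x)
      simpa using this
    have h3 : ∫ t in Ioi x, (t - x) * f t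
        = (∫ t in Ioi x, t * f t) - x * ∫ t in Ioi x, f t := by
      rw [← integral_const_mul, ← integral_sub (hi1.mono_set (hsub x hx))
        ((hi.mono_set (hsub x hx)).const_mul x)]
      simp only [sub_mul]
    rw [h2, h3, ← hGeq x hx]
    simp only [hJ, A1]
    linarith
  have hGc : Continuous G := continuous_const.sub (intervalIntegral.continuous_primitive hii 0)
  have hJc : Continuous J := (continuous_const.sub
    (intervalIntegral.continuous_primitive hii1 0)).sub (continuous_id.mul hGc)
  have hGd : ∀ x, x ∉ s → HasDerivAt G (-f x) x := fun x hx =>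
    (intervalIntegral.integral_hasDerivAt_right (hii 0 x)
      hf.measurable.stronglyMeasurable.stronglyMeasurableAtFilter (not_not.1 hx)).const_sub A
  have hJd : ∀ x, x ∉ s → HasDerivAt J (-G x) x := fun x hx => by
    have h1 := (intervalIntegral.integral_hasDerivAt_right (hii1 0 x)
      (measurable_id.mul hf.measurable).stronglyMeasurable.stronglyMeasurableAtFilter
      (continuousAt_id.mul (not_not.1 hx))).const_sub A1
    refine (h1.sub ((hasDerivAt_id x).mul (hGd x hx))).congr_deriv ?_
    simp
  have hGb : ∀ x, 0 ≤ x → |G x| ≤ A := fun x hx => by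
    have h1 : 0 ≤ ∫ t in (0 : ℝ)..x, f t := intervalIntegral.integral_nonneg hx fun t _ => h0 t
    have h2 : 0 ≤ G x := by
      rw [hGeq x hx]
      exact setIntegral_nonneg measurableSet_Ioi fun t _ => h0 t
    rw [abs_of_nonneg h2]
    simp only [hG]
    linarith
  have hJb : ∀ x, 0 ≤ x → |J x| ≤ A1 := fun x hx => by
    rw [← hJeq x hx, abs_of_nonneg (setIntegral_nonneg measurableSet_Ioi fun t ht =>
      mul_nonneg (le_of_lt ht) (h0 _))]
    refine integral_mono_of_nonneg ?_ hi1 ?_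
    · filter_upwards [ae_restrict_mem measurableSet_Ioi] with t ht
      exact mul_nonneg (le_of_lt ht) (h0 _)
    · filter_upwards [ae_restrict_mem measurableSet_Ioi] with t ht
      exact mul_le_mul_of_nonneg_left (hf (by linarith)) (le_of_lt ht)
  have hε' : ∀ x, 0 ≤ x → |f x - c ^ 2 * J x| ≤ ε := fun x hx => by
    rw [← hJeq x hx]
    exact hε x hx
  have hexp : ∀ k x : ℝ, HasDerivAt (fun u => exp (k * u)) (k * exp (k * x)) x := fun k x => by
    have := ((hasDerivAt_id x).const_mul k).exp
    refine this.congr_deriv ?_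
    simp [mul_comm]
  have hexpc : ∀ k : ℝ, Continuous (fun u => exp (k * u)) := fun k => by fun_prop
  -- the first order equation `G = c J` holds up to `ε / c`
  have hD : ∀ x, 0 ≤ x → |G x - c * J x| ≤ ε / c := by
    intro x hx
    have hfin : ∀ X, x ≤ X → |exp (-c * X) * (G X - c * J X) - exp (-c * x) * (G x - c * J x)|
        ≤ -(ε / c) * exp (-c * X) - -(ε / c) * exp (-c * x) := fun X hX => by
      refine abs_sub_le_of_hasDerivAt_off_countable (F := fun u => exp (-c * u) * (G u - c * J u))
        (F' := fun u => exp (-c * u) * (c ^ 2 * J u - f u))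
        (B := fun u => -(ε / c) * exp (-c * u)) (B' := fun u => ε * exp (-c * u)) hX hsc
        ((hexpc _).mul (hGc.sub (hJc.const_mul c))).continuousOn ?_ ?_ ?_ ?_ ?_
      · intro u hu
        refine ((hexp (-c) u).mul ((hGd u hu.2).sub ((hJd u hu.2).const_mul c))).congr_deriv ?_
        simp only [Pi.sub_apply]
        ring
      · exact (((hJc.const_mul (c ^ 2)).intervalIntegrable _ _).sub
          (hii _ _)).continuousOn_mul (hexpc _).continuousOn
      · intro u
        refine ((hexp (-c) u).const_mul (-(ε / c))).congr_deriv ?_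
        field_simp
      · exact continuous_const.mul (hexpc _)
      · intro u hu
        rw [abs_mul, abs_of_pos (exp_pos _), mul_comm, abs_sub_comm]
        exact mul_le_mul_of_nonneg_right (hε' u (hx.trans hu.1.le)) (exp_pos _).le
    have hbd : ∀ X, x ≤ X → exp (-c * x) * |G x - c * J x|
        ≤ (ε / c) * exp (-c * x) + exp (-c * X) * (A + c * A1) := fun X hX => by
      have h1 := hfin X hX
      have h2 : |exp (-c * X) * (G X - c * J X)| ≤ exp (-c * X) * (A + c * A1) := by
        rw [abs_mul, abs_of_pos (exp_pos _)]
        refine mul_le_mul_of_nonneg_left ?_ (exp_pos _).le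
        refine (abs_sub _ _).trans (add_le_add (hGb X (hx.trans hX)) ?_)
        rw [abs_mul, abs_of_pos hc]
        exact mul_le_mul_of_nonneg_left (hJb X (hx.trans hX)) hc.le
      have h3 := abs_sub_abs_le_abs_sub (exp (-c * x) * (G x - c * J x))
        (exp (-c * X) * (G X - c * J X))
      rw [abs_sub_comm (exp (-c * x) * (G x - c * J x))] at h3
      have h4 : |exp (-c * x) * (G x - c * J x)| = exp (-c * x) * |G x - c * J x| := by
        rw [abs_mul, abs_of_pos (exp_pos _)]
      have h5 : 0 ≤ ε / c := div_nonneg ((abs_nonneg _).trans (hε' x hx)) hc.le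
      have h6 := mul_nonneg h5 (exp_pos (-c * X)).le
      linarith
    have hlim : Tendsto (fun X => (ε / c) * exp (-c * x) + exp (-c * X) * (A + c * A1)) atTop
        (nhds ((ε / c) * exp (-c * x) + 0 * (A + c * A1))) := by
      refine tendsto_const_nhds.add (Tendsto.mul_const _ ?_)
      exact tendsto_exp_atBot.comp (tendsto_id.const_mul_atTop_of_neg (neg_neg_of_pos hc))
    have h7 := ge_of_tendsto hlim (eventually_atTop.2 ⟨x, hbd⟩)
    rw [zero_mul, add_zero, mul_comm] at h7
    exact le_of_mul_le_mul_right h7 (exp_pos _)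
  have hJx : |exp (c * x) * J x - exp (c * 0) * J 0|
      ≤ ε / c ^ 2 * exp (c * x) - ε / c ^ 2 * exp (c * 0) := by
    refine abs_sub_le_of_hasDerivAt_off_countable (F := fun u => exp (c * u) * J u)
        (F' := fun u => exp (c * u) * (c * J u - G u))
        (B := fun u => ε / c ^ 2 * exp (c * u)) (B' := fun u => ε / c * exp (c * u)) hx hsc
        ((hexpc _).mul hJc).continuousOn ?_ ?_ ?_ ?_ ?_
    · intro u hu
      refine ((hexp c u).mul (hJd u hu.2)).congr_deriv ?_
      ring
    · exact ((hexpc _).mul ((hJc.const_mul c).sub hGc)).intervalIntegrable _ _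
    · intro u
      refine ((hexp c u).const_mul (ε / c ^ 2)).congr_deriv ?_
      field_simp
    · exact continuous_const.mul (hexpc _)
    · intro u hu
      rw [abs_mul, abs_of_pos (exp_pos _), mul_comm, abs_sub_comm]
      exact mul_le_mul_of_nonneg_right (hD u hu.1.le) (exp_pos _).le
  have hε0 : 0 ≤ ε := (abs_nonneg _).trans (hε' x hx)
  have hE := exp_pos (c * x)
  have h1 := abs_le.1 (hε' 0 le_rfl)
  have h2 := abs_le.1 (hε' x hx)
  rw [hf0] at h1
  rw [mul_zero, exp_zero, one_mul, mul_one] at hJx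
  have h3 : |c ^ 2 * (exp (c * x) * J x) - c ^ 2 * J 0| ≤ ε * exp (c * x) := by
    rw [← mul_sub, abs_mul, abs_of_pos (by positivity)]
    calc c ^ 2 * |exp (c * x) * J x - J 0| ≤ c ^ 2 * (ε / c ^ 2 * exp (c * x) - ε / c ^ 2) := by
          gcongr
      _ = ε * exp (c * x) - ε := by field_simp
      _ ≤ ε * exp (c * x) := by linarith
  have h3' := abs_le.1 h3
  have h4 : 1 ≤ exp (c * x) := one_le_exp (by positivity)
  have h5 : |exp (c * x) * f x - 1| ≤ exp (c * x) * (3 * ε) := by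
    rw [abs_le]
    constructor <;> nlinarith
  have h6 : f x - exp (-(c * x)) = exp (-(c * x)) * (exp (c * x) * f x - 1) := by
    rw [mul_sub, ← mul_assoc, ← exp_add]
    simp
  rw [h6, abs_mul, abs_of_pos (exp_pos _)]
  calc exp (-(c * x)) * |exp (c * x) * f x - 1| ≤ exp (-(c * x)) * (exp (c * x) * (3 * ε)) := by
        gcongr
    _ = 3 * ε := by
        rw [← mul_assoc, ← exp_add]
        simp

theorem partitionRatio_add_div (n : ℕ) (hn : 0 < n) (x k : ℝ) :
    partitionRatio n (x + k / √n) = partitionStep (n - x * √n - k) / partitionCount n := by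
  have : √(n : ℝ) ≠ 0 := (Real.sqrt_pos.2 (by exact_mod_cast hn)).ne'
  rw [partitionRatio]
  congr 2
  field_simp
  ring

/-- Comparison of a single divisor sum in the recurrence for `p(n)` with its integral. -/
theorem abs_divisorSum_sub_integral_le {n : ℕ} (hn : 0 < n) {x : ℝ} (hx : 0 ≤ x) (d : ℕ) :
    |1 / n * ∑' m : ℕ, ((m : ℝ) + 1) * partitionRatio n (x + (d + 1) * (m + 1) / √n)
        - 1 / ((d : ℝ) + 1) ^ 2 * ∫ y in Ioi 0, y * partitionRatio n (x + y)|
      ≤ min (1 / √n / ((d : ℝ) + 1) * ∫ y in Ioi 0, 2 * exp (-(log 2 / 3 * y)))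
          (1 / ((d : ℝ) + 1) ^ 2 * ∫ y in Ioi 0, y * (2 * exp (-(log 2 / 3 * y)))) := by
  have hδ : 0 < log 2 / 3 := by have := log_pos one_lt_two; positivity
  have hsq : 0 < √(n : ℝ) := Real.sqrt_pos.2 (by exact_mod_cast hn)
  have hsq2 : √(n : ℝ) ^ 2 = n := Real.sq_sqrt (Nat.cast_nonneg n)
  set g : ℝ → ℝ := fun y => partitionRatio n (x + y) with hg
  have hga : Antitone g := fun a b hab => partitionRatio_antitone n (by gcongr)
  have hg0 : ∀ y, 0 ≤ g y := fun y => partitionRatio_nonneg n _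
  have hgC : ∀ y, 0 ≤ y → g y ≤ 2 * exp (-(log 2 / 3 * y)) := fun y hy =>
    (partitionRatio_antitone n (by linarith : y ≤ x + y)).trans (partitionRatio_le_exp hn hy)
  set b : ℝ := ((d : ℝ) + 1) / √n with hb
  have hb0 : 0 < b := by positivity
  have hGa : Antitone fun t => g (b * t) := fun s t hst => hga (by gcongr)
  have hGC : ∀ t, 0 ≤ t → g (b * t) ≤ 2 * exp (-(log 2 / 3 * b * t)) := fun t ht => by
    rw [mul_assoc]
    exact hgC _ (by positivity)
  have hδb : 0 < log 2 / 3 * b := by positivity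
  have hgi : IntegrableOn g (Ioi 0) := by simpa using hga.integrableOn_pow_mul hg0 hδ hgC 0
  have hgi1 : IntegrableOn (fun y => y * g y) (Ioi 0) := by
    simpa using hga.integrableOn_pow_mul hg0 hδ hgC 1
  obtain ⟨-, h1, h2⟩ := abs_tsum_sub_integral_le hGa (fun t => hg0 _)
    (by simpa using hGa.integrableOn_pow_mul (fun t => hg0 _) hδb hGC 0)
    (by simpa using hGa.integrableOn_pow_mul (fun t => hg0 _) hδb hGC 1)
  have e1 : ∫ t in Ioi 0, g (b * t) = b⁻¹ * ∫ y in Ioi 0, g y := by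
    rw [integral_comp_mul_left_Ioi g 0 hb0, mul_zero, smul_eq_mul]
  have e2 : ∫ t in Ioi 0, t * g (b * t) = b⁻¹ ^ 2 * ∫ y in Ioi 0, y * g y := by
    have := integral_comp_mul_left_Ioi (fun y => y * g y) 0 hb0
    rw [mul_zero, smul_eq_mul] at this
    rw [pow_two, mul_assoc, ← this, ← integral_const_mul]
    refine setIntegral_congr_fun measurableSet_Ioi fun t _ => ?_
    rw [← mul_assoc, ← mul_assoc, inv_mul_cancel₀ hb0.ne', one_mul]
  have e3 : ∀ m : ℕ, g (b * (m + 1)) = partitionRatio n (x + (d + 1) * (m + 1) / √n) := fun m => by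
    simp only [hg, hb]
    congr 2
    ring
  simp only [e3] at h1 h2
  rw [e1, e2] at h1
  rw [e2] at h2
  have hn0 : (0 : ℝ) < n := by exact_mod_cast hn
  have hsq3 : (1 / n : ℝ) = 1 / √n ^ 2 := by rw [hsq2]
  have e4 : (1 / n : ℝ) * b⁻¹ ^ 2 = 1 / ((d : ℝ) + 1) ^ 2 := by
    rw [hb, hsq3]
    field_simp
  have e5 : (1 / n : ℝ) * b⁻¹ = 1 / √n / ((d : ℝ) + 1) := by
    rw [hb, hsq3]
    field_simp
  rw [← e4, ← e5, mul_assoc (1 / (n : ℝ)), ← mul_sub, abs_mul,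
    abs_of_pos (by positivity : (0 : ℝ) < 1 / n)]
  refine le_min ?_ ?_
  · rw [mul_assoc]
    refine mul_le_mul_of_nonneg_left (h1.trans ?_) (by positivity)
    refine mul_le_mul_of_nonneg_left ?_ (by positivity)
    refine setIntegral_mono_on hgi ?_ measurableSet_Ioi fun y hy => hgC y (le_of_lt hy)
    simpa [IntegrableOn] using (integrableOn_pow_mul_exp_neg 0 hδ).const_mul 2
  · rw [mul_assoc]
    refine mul_le_mul_of_nonneg_left (h2.trans ?_) (by positivity)
    refine mul_le_mul_of_nonneg_left ?_ (by positivity)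
    refine setIntegral_mono_on hgi1 ?_ measurableSet_Ioi fun y hy =>
      mul_le_mul_of_nonneg_left (hgC y (le_of_lt hy)) (le_of_lt hy)
    refine IntegrableOn.congr_fun ((integrableOn_pow_mul_exp_neg 1 hδ).const_mul 2)
      (fun y _ => ?_) measurableSet_Ioi
    simp only [pow_one]
    ring

theorem hasSum_one_div_succ_sq :
    HasSum (fun d : ℕ => 1 / ((d : ℝ) + 1) ^ 2) (π ^ 2 / 6) := by
  have := (hasSum_nat_add_iff' 1).2 hasSum_zeta_two
  simpa using this

theorem tendsto_tsum_min_zero (A B : ℝ) (hA : 0 ≤ A) (hB : 0 ≤ B) :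
    Tendsto (fun n : ℕ => ∑' d : ℕ, min (1 / √n / ((d : ℝ) + 1) * A) (1 / ((d : ℝ) + 1) ^ 2 * B))
      atTop (nhds 0) := by
  have h := tendsto_tsum_of_dominated_convergence (𝓕 := atTop)
    (f := fun (n d : ℕ) => min (1 / √(n : ℝ) / ((d : ℝ) + 1) * A) (1 / ((d : ℝ) + 1) ^ 2 * B))
    (g := fun _ => 0) (bound := fun d : ℕ => 1 / ((d : ℝ) + 1) ^ 2 * B)
    (hasSum_one_div_succ_sq.summable.mul_right B) ?_ ?_
  · simpa using h
  · intro d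
    have h1 : Tendsto (fun n : ℕ => 1 / √(n : ℝ) / ((d : ℝ) + 1) * A) atTop
        (nhds (0 / ((d : ℝ) + 1) * A)) := by
      refine ((Tendsto.div_const ?_ _).mul_const _)
      simp only [one_div]
      exact tendsto_inv_atTop_zero.comp (tendsto_sqrt_atTop.comp tendsto_natCast_atTop_atTop)
    rw [zero_div, zero_mul] at h1
    exact squeeze_zero (fun n => le_min (by positivity) (by positivity))
      (fun n => min_le_left _ _) h1
  · refine Eventually.of_forall fun n d => ?_
    rw [norm_of_nonneg (le_min (by positivity) (by positivity))]
    exact min_le_right _ _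

theorem abs_partitionRatio_sub_floor_le {n : ℕ} (hn : 0 < n) {x : ℝ} (hx : 0 ≤ x) :
    |partitionRatio n x - 1 / n * (⌊n - x * √n⌋₊ * partitionRatio n x)|
      ≤ (6 / log 2 + 2) * (1 / √n) := by
  have hlog := log_pos one_lt_two
  rcases lt_or_ge (n - x * √n) 0 with h | h
  · rw [partitionRatio, partitionStep_of_neg h]
    simp only [zero_div, mul_zero, sub_zero, abs_zero]
    positivity
  have hn0 : (0 : ℝ) < n := by exact_mod_cast hn
  have hsq1 : 1 ≤ √(n : ℝ) := Real.one_le_sqrt.2 (by exact_mod_cast hn)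
  have hsq2 : √(n : ℝ) * √n = n := Real.mul_self_sqrt hn0.le
  have h1 : (⌊n - x * √n⌋₊ : ℝ) ≤ n - x * √n := Nat.floor_le h
  have h2 : n - x * √n < ⌊n - x * √n⌋₊ + 1 := Nat.lt_floor_add_one _
  set N : ℝ := (⌊n - x * √n⌋₊ : ℝ)
  have hxs : 0 ≤ x * √n := by positivity
  have h3 : partitionRatio n x - 1 / n * (N * partitionRatio n x)
      = (n - N) / n * partitionRatio n x := by
    field_simp
  have h4 : (n - N) / n ≤ (x + 1) * (1 / √n) := by
    have : 1 / √(n : ℝ) * n = √n := by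
      nth_rewrite 2 [← hsq2]
      field_simp
    rw [div_le_iff₀ hn0, mul_assoc, this]
    linarith
  have h0 : 0 ≤ (n - N) / n := div_nonneg (by linarith) hn0.le
  rw [h3, abs_of_nonneg (mul_nonneg h0 (partitionRatio_nonneg n x))]
  have h5 : x * exp (-(log 2 / 3 * x)) ≤ 3 / log 2 := by
    rw [exp_neg, ← div_eq_mul_inv, div_le_div_iff₀ (exp_pos _) hlog]
    nlinarith [add_one_le_exp (log 2 / 3 * x)]
  have h6 : exp (-(log 2 / 3 * x)) ≤ 1 := exp_le_one_iff.2 (by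
    have : 0 ≤ log 2 / 3 * x := by positivity
    linarith)
  calc (n - N) / n * partitionRatio n x
      ≤ (x + 1) * (1 / √n) * (2 * exp (-(log 2 / 3 * x))) :=
        mul_le_mul h4 (partitionRatio_le_exp hn hx) (partitionRatio_nonneg n x) (by positivity)
    _ = (2 * (x * exp (-(log 2 / 3 * x))) + 2 * exp (-(log 2 / 3 * x))) * (1 / √n) := by ring
    _ ≤ (2 * (3 / log 2) + 2 * 1) * (1 / √n) := by gcongr
    _ = (6 / log 2 + 2) * (1 / √n) := by ring

theorem floor_mul_partitionRatio {n : ℕ} (hn : 0 < n) (x : ℝ) :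
    1 / n * (⌊n - x * √n⌋₊ * partitionRatio n x) = ∑' d : ℕ,
      1 / n * ∑' m : ℕ, ((m : ℝ) + 1) * partitionRatio n (x + (d + 1) * (m + 1) / √n) := by
  rw [tsum_mul_left]
  congr 1
  have := congrArg (· / (partitionCount n : ℝ)) (floor_mul_partitionStep (n - x * √n))
  simp only [← tsum_div_const, mul_div_assoc] at this
  rw [partitionRatio, this]
  simp only [partitionRatio_add_div n hn]

/-- `p(n - x√n) / p(n)` converges to `exp (-π x / √6)` uniformly in `x ≥ 0`. -/
theorem eventually_abs_partitionRatio_sub_exp_le {ε : ℝ} (hε : 0 < ε) :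
    ∀ᶠ n : ℕ in atTop, ∀ x : ℝ, 0 ≤ x →
      |partitionRatio n x - exp (-(π / √6 * x))| ≤ ε := by
  have hδ : 0 < log 2 / 3 := by have := log_pos one_lt_two; positivity
  set A := ∫ y in Ioi 0, 2 * exp (-(log 2 / 3 * y))
  set B := ∫ y in Ioi 0, y * (2 * exp (-(log 2 / 3 * y)))
  have hA : 0 ≤ A := setIntegral_nonneg measurableSet_Ioi fun y _ => by positivity
  have hB : 0 ≤ B := setIntegral_nonneg measurableSet_Ioi fun y hy =>
    mul_nonneg (le_of_lt hy) (by positivity)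
  have hlim : Tendsto (fun n : ℕ => (6 / log 2 + 2) * (1 / √(n : ℝ)) +
      ∑' d : ℕ, min (1 / √n / ((d : ℝ) + 1) * A) (1 / ((d : ℝ) + 1) ^ 2 * B))
      atTop (nhds ((6 / log 2 + 2) * 0 + 0)) := by
    refine (Tendsto.const_mul _ ?_).add (tendsto_tsum_min_zero A B hA hB)
    simp only [one_div]
    exact tendsto_inv_atTop_zero.comp (tendsto_sqrt_atTop.comp tendsto_natCast_atTop_atTop)
  rw [mul_zero, add_zero] at hlim
  filter_upwards [hlim.eventually (gt_mem_nhds (by positivity : (0 : ℝ) < ε / 3)),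
    eventually_gt_atTop 0] with n hnε hn x hx
  have hc2 : (π / √6) ^ 2 = π ^ 2 / 6 := by rw [div_pow, Real.sq_sqrt (by norm_num)]
  have hkey : ∀ x, 0 ≤ x → |partitionRatio n x
      - (π / √6) ^ 2 * ∫ y in Ioi 0, y * partitionRatio n (x + y)| ≤ ε / 3 := by
    intro x hx
    have h1 := abs_partitionRatio_sub_floor_le hn hx
    rw [floor_mul_partitionRatio hn x] at h1
    have h2 := fun d => abs_divisorSum_sub_integral_le hn hx d
    set I := ∫ y in Ioi 0, y * partitionRatio n (x + y)
    set T : ℕ → ℝ := fun d =>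
      1 / n * ∑' m : ℕ, ((m : ℝ) + 1) * partitionRatio n (x + (d + 1) * (m + 1) / √n)
    have hz := hasSum_one_div_succ_sq.mul_right I
    have hmin : Summable fun d : ℕ =>
        min (1 / √n / ((d : ℝ) + 1) * A) (1 / ((d : ℝ) + 1) ^ 2 * B) :=
      Summable.of_nonneg_of_le (fun d => le_min (by positivity) (by positivity))
        (fun d => min_le_right _ _) (hasSum_one_div_succ_sq.summable.mul_right B)
    have hdiff : Summable fun d : ℕ => T d - 1 / ((d : ℝ) + 1) ^ 2 * I :=
      Summable.of_norm_bounded hmin h2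
    have hT : Summable T := by simpa using hdiff.add hz.summable
    have h3 : |∑' d, T d - π ^ 2 / 6 * I|
        ≤ ∑' d : ℕ, min (1 / √n / ((d : ℝ) + 1) * A) (1 / ((d : ℝ) + 1) ^ 2 * B) := by
      rw [← hz.tsum_eq, ← hT.tsum_sub hz.summable]
      exact tsum_of_norm_bounded (f := fun d => T d - 1 / ((d : ℝ) + 1) ^ 2 * I) hmin.hasSum h2
    rw [hc2]
    have h4 := abs_sub_le (partitionRatio n x) (∑' d, T d) (π ^ 2 / 6 * I)
    linarith
  have := abs_sub_exp_le (partitionRatio_antitone n) (partitionRatio_nonneg n)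
    (partitionRatio_zero n) hδ (by positivity) (fun x hx => partitionRatio_le_exp hn hx) hkey hx
  linarith

/-- Dyson's map: remove the largest part and add a first column. -/
def dysonMap (m : ℤ) (s : Multiset ℕ) : Multiset ℕ :=
  (s.erase s.sup).map (· + 1) +
    Multiset.replicate (((s.sup : ℤ) - m - 1).toNat - Multiset.card (s.erase s.sup)) 1

/-- The inverse of Dyson's map: remove the first column and add a largest part. -/
def dysonInv (m : ℤ) (t : Multiset ℕ) : Multiset ℕ :=
  (((Multiset.card t : ℤ) + m + 1).toNat ::ₘ (t.filter (1 < ·)).map (· - 1)).filter (· ≠ 0)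

theorem Multiset.sup_mem_of_ne_zero {s : Multiset ℕ} (hs : s ≠ 0) : s.sup ∈ s := by
  induction s using Multiset.induction_on with
  | empty => exact absurd rfl hs
  | cons a t ih =>
    rw [Multiset.sup_cons]
    rcases eq_or_ne t 0 with rfl | ht
    · simp
    · rcases le_total a t.sup with h | h
      · rw [sup_of_le_right h]
        exact Multiset.mem_cons_of_mem (ih ht)
      · rw [sup_of_le_left h]
        exact Multiset.mem_cons_self _ _

theorem Multiset.sum_filter_one_lt_map_pred {t : Multiset ℕ} (ht : ∀ i ∈ t, 0 < i) :
    ((t.filter (1 < ·)).map (· - 1)).sum + Multiset.card t = t.sum := by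
  induction t using Multiset.induction_on with
  | empty => simp
  | cons a t ih =>
    have h1 := ih fun i hi => ht i (Multiset.mem_cons_of_mem hi)
    have h2 := ht a (Multiset.mem_cons_self a t)
    by_cases h : 1 < a
    · rw [Multiset.filter_cons_of_pos (p := fun i => 1 < i) _ h, Multiset.map_cons, Multiset.sum_cons,
        Multiset.card_cons, Multiset.sum_cons]
      omega
    · rw [Multiset.filter_cons_of_neg (p := fun i => 1 < i) _ h, Multiset.card_cons, Multiset.sum_cons]
      omega

section DysonMap

variable {m : ℤ} {s t : Multiset ℕ}

theorem card_erase_sup_le (hr : m ≤ (s.sup : ℤ) - Multiset.card s) (h : s = 0 → m ≤ -1) :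
    (Multiset.card (s.erase s.sup) : ℤ) ≤ (s.sup : ℤ) - m - 1 := by
  rcases eq_or_ne s 0 with rfl | hs
  · have := h rfl
    simp
    omega
  · have h1 := Multiset.card_erase_add_one (Multiset.sup_mem_of_ne_zero hs)
    omega

theorem card_dysonMap (hr : m ≤ (s.sup : ℤ) - Multiset.card s) (h : s = 0 → m ≤ -1) :
    (Multiset.card (dysonMap m s) : ℤ) = s.sup - m - 1 := by
  have := card_erase_sup_le hr h
  simp only [dysonMap, Multiset.card_add, Multiset.card_map, Multiset.card_replicate]
  omega

theorem sum_dysonMap (hr : m ≤ (s.sup : ℤ) - Multiset.card s) (h : s = 0 → m ≤ -1) :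
    ((dysonMap m s).sum : ℤ) = s.sum - m - 1 := by
  have h1 := card_erase_sup_le hr h
  have h2 : (s.erase s.sup).sum + s.sup = s.sum := by
    rcases eq_or_ne s 0 with rfl | hs
    · simp
    · have := congrArg Multiset.sum (Multiset.cons_erase (Multiset.sup_mem_of_ne_zero hs))
      rw [Multiset.sum_cons] at this
      omega
  simp only [dysonMap, Multiset.sum_add, Multiset.sum_map_add, Multiset.map_id',
    Multiset.map_const', Multiset.sum_replicate, smul_eq_mul, mul_one]
  omega

theorem sup_dysonMap_le : (dysonMap m s).sup ≤ s.sup + 1 := by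
  refine Multiset.sup_le.2 fun i hi => ?_
  rcases Multiset.mem_add.1 hi with hi | hi
  · obtain ⟨j, hj, rfl⟩ := Multiset.mem_map.1 hi
    exact Nat.succ_le_succ (Multiset.le_sup (Multiset.mem_of_mem_erase hj))
  · rw [Multiset.eq_of_mem_replicate hi]
    omega

theorem pos_of_mem_dysonMap {i : ℕ} (hi : i ∈ dysonMap m s) : 0 < i := by
  rcases Multiset.mem_add.1 hi with hi | hi
  · obtain ⟨j, -, rfl⟩ := Multiset.mem_map.1 hi
    exact j.succ_pos
  · rw [Multiset.eq_of_mem_replicate hi]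
    exact one_pos

theorem dysonInv_dysonMap (hs : ∀ i ∈ s, 0 < i) (hr : m ≤ (s.sup : ℤ) - Multiset.card s)
    (h : s = 0 → m ≤ -1) : dysonInv m (dysonMap m s) = s := by
  have h1 : ((Multiset.card (dysonMap m s) : ℤ) + m + 1).toNat = s.sup := by
    rw [card_dysonMap hr h]
    omega
  have h2 : ((dysonMap m s).filter (1 < ·)).map (· - 1) = s.erase s.sup := by
    rw [dysonMap, Multiset.filter_add, Multiset.filter_eq_self.2, Multiset.filter_eq_nil.2,
      add_zero, Multiset.map_map]
    · simp
    · intro i hi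
      rw [Multiset.eq_of_mem_replicate hi]
      omega
    · intro i hi
      obtain ⟨j, hj, rfl⟩ := Multiset.mem_map.1 hi
      have := hs j (Multiset.mem_of_mem_erase hj)
      omega
  rw [dysonInv, h1, h2]
  rcases eq_or_ne s 0 with rfl | hs0
  · simp
  · rw [Multiset.cons_erase (Multiset.sup_mem_of_ne_zero hs0)]
    exact Multiset.filter_eq_self.2 fun i hi => (hs i hi).ne'

theorem dysonInv_eq_ite (ht : (t.sup : ℤ) - Multiset.card t ≤ m + 2) :
    (dysonInv m t = if ((Multiset.card t : ℤ) + m + 1).toNat = 0 then 0 else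
      ((Multiset.card t : ℤ) + m + 1).toNat ::ₘ (t.filter (1 < ·)).map (· - 1)) ∧
    (∀ i ∈ (t.filter (1 < ·)).map (· - 1), 0 < i ∧
      i ≤ ((Multiset.card t : ℤ) + m + 1).toNat) := by
  have h : ∀ i ∈ (t.filter (1 < ·)).map (· - 1), 0 < i ∧
      i ≤ ((Multiset.card t : ℤ) + m + 1).toNat := by
    intro i hi
    obtain ⟨j, hj, rfl⟩ := Multiset.mem_map.1 hi
    obtain ⟨hj1, hj2⟩ := Multiset.mem_filter.1 hj
    have := Multiset.le_sup hj1
    omega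
  refine ⟨?_, h⟩
  rw [dysonInv]
  split_ifs with h0
  · refine Multiset.filter_eq_nil.2 fun i hi => ?_
    rcases Multiset.mem_cons.1 hi with rfl | hi
    · exact not_not.2 h0
    · have := h i hi
      omega
  · refine Multiset.filter_eq_self.2 fun i hi => ?_
    rcases Multiset.mem_cons.1 hi with rfl | hi
    · exact h0
    · exact (h i hi).1.ne'

theorem sup_dysonInv (ht : (t.sup : ℤ) - Multiset.card t ≤ m + 2) :
    (dysonInv m t).sup = ((Multiset.card t : ℤ) + m + 1).toNat := by
  obtain ⟨h1, h2⟩ := dysonInv_eq_ite ht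
  rw [h1]
  split_ifs with h0
  · simp [h0]
  · rw [Multiset.sup_cons]
    exact sup_of_le_left (Multiset.sup_le.2 fun i hi => (h2 i hi).2)

theorem erase_sup_dysonInv (ht : (t.sup : ℤ) - Multiset.card t ≤ m + 2) :
    (dysonInv m t).erase (dysonInv m t).sup = (t.filter (1 < ·)).map (· - 1) := by
  obtain ⟨h1, h2⟩ := dysonInv_eq_ite ht
  rw [sup_dysonInv ht, h1]
  split_ifs with h0
  · rw [Multiset.erase_zero, eq_comm, Multiset.eq_zero_iff_forall_notMem]
    intro i hi
    have := h2 i hi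
    omega
  · rw [Multiset.erase_cons_head]

theorem sum_dysonInv (hpos : ∀ i ∈ t, 0 < i) (ht : (t.sup : ℤ) - Multiset.card t ≤ m + 2)
    (h : 0 ≤ (Multiset.card t : ℤ) + m + 1) : ((dysonInv m t).sum : ℤ) = t.sum + m + 1 := by
  have h1 : (dysonInv m t).sum
      = ((Multiset.card t : ℤ) + m + 1).toNat + ((t.filter (1 < ·)).map (· - 1)).sum := by
    obtain ⟨h1, h2⟩ := dysonInv_eq_ite ht
    rw [h1]
    split_ifs with h0
    · rw [h0, Multiset.sum_zero, zero_add, eq_comm, Multiset.sum_eq_zero_iff]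
      intro i hi
      have := h2 i hi
      omega
    · rw [Multiset.sum_cons]
  have h3 := Multiset.sum_filter_one_lt_map_pred hpos
  omega

theorem le_rank_dysonInv (ht : (t.sup : ℤ) - Multiset.card t ≤ m + 2)
    (h : 0 ≤ (Multiset.card t : ℤ) + m + 1) :
    m ≤ ((dysonInv m t).sup : ℤ) - Multiset.card (dysonInv m t) := by
  rw [sup_dysonInv ht, (dysonInv_eq_ite ht).1]
  split_ifs with h0
  · rw [Multiset.card_zero]
    omega
  · have := Multiset.card_le_card (Multiset.filter_le (1 < ·) t)
    rw [Multiset.card_cons, Multiset.card_map]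
    omega

theorem dysonMap_dysonInv (hpos : ∀ i ∈ t, 0 < i) (ht : (t.sup : ℤ) - Multiset.card t ≤ m + 2)
    (h : 0 ≤ (Multiset.card t : ℤ) + m + 1) : dysonMap m (dysonInv m t) = t := by
  have h3 : (((((Multiset.card t : ℤ) + m + 1).toNat : ℕ) : ℤ) - m - 1).toNat
      = Multiset.card t := by omega
  have h4 : ((t.filter (1 < ·)).map (· - 1)).map (· + 1) = t.filter (1 < ·) := by
    rw [Multiset.map_map]
    conv_rhs => rw [← Multiset.map_id (t.filter (1 < ·))]
    refine Multiset.map_congr rfl fun i hi => ?_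
    have := (Multiset.mem_filter.1 hi).2
    simp only [Function.comp, id]
    omega
  have h5 : t.filter (fun i => ¬ 1 < i)
      = Multiset.replicate (Multiset.card (t.filter (fun i => ¬ 1 < i))) 1 :=
    Multiset.eq_replicate_card.2 fun i hi => by
      have h6 := Multiset.mem_filter.1 hi
      have := hpos i h6.1
      omega
  have h7 := Multiset.filter_add_not (1 < ·) t
  have h8 := congrArg Multiset.card h7
  rw [Multiset.card_add] at h8
  rw [dysonMap, erase_sup_dysonInv ht, sup_dysonInv ht, h3, h4, Multiset.card_map]
  conv_rhs => rw [← h7, h5]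
  congr 2
  omega

end DysonMap

/-- Dyson's bijection between partitions of rank at least `m` and partitions of rank at most
`m + 2`. -/
theorem card_le_rank_eq_card_rank_le {n N : ℕ} {m : ℤ} (h : (N : ℤ) + m + 1 = n)
    (hm : 0 ≤ m ∨ m ≤ -3) :
    Nat.card {P : n.Partition // m ≤ P.rank} = Nat.card {Q : N.Partition // Q.rank ≤ m + 2} := by
  have hP : ∀ P : n.Partition, P.parts = 0 → m ≤ -1 := fun P hP => by
    have := P.parts_sum
    rw [hP, Multiset.sum_zero] at this
    omega
  have hQ : ∀ Q : N.Partition, Q.rank ≤ m + 2 → 0 ≤ (Multiset.card Q.parts : ℤ) + m + 1 :=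
    fun Q hr => by
      rcases hm with hm | hm
      · omega
      rw [Nat.Partition.rank] at hr
      rcases eq_or_ne Q.parts 0 with h0 | h0
      · rw [h0, Multiset.card_zero, Multiset.sup_zero, Nat.bot_eq_zero] at hr
        omega
      · have := Q.parts_pos (Multiset.sup_mem_of_ne_zero h0)
        omega
  refine Nat.card_congr
    { toFun := fun P => ⟨⟨dysonMap m P.1.parts, pos_of_mem_dysonMap, ?_⟩, ?_⟩
      invFun := fun Q => ⟨⟨dysonInv m Q.1.parts, fun hi =>
        Nat.pos_of_ne_zero (Multiset.mem_filter.1 hi).2, ?_⟩, ?_⟩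
      left_inv := ?_
      right_inv := ?_ }
  · have := sum_dysonMap P.2 (hP P.1)
    rw [P.1.parts_sum] at this
    omega
  · have h1 := card_dysonMap P.2 (hP P.1)
    have h2 := sup_dysonMap_le (m := m) (s := P.1.parts)
    simp only [Nat.Partition.rank]
    omega
  · have := sum_dysonInv (fun i hi => Q.1.parts_pos hi) Q.2 (hQ Q.1 Q.2)
    rw [Q.1.parts_sum] at this
    omega
  · exact le_rank_dysonInv Q.2 (hQ Q.1 Q.2)
  · intro P
    apply Subtype.ext
    ext1
    exact dysonInv_dysonMap (fun i hi => P.1.parts_pos hi) P.2 (hP P.1)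
  · intro Q
    apply Subtype.ext
    ext1
    exact dysonMap_dysonInv (fun i hi => Q.1.parts_pos hi) Q.2 (hQ Q.1 Q.2)

/-- The number of partitions of `n` of rank at least `M`. -/
noncomputable def rankTail (n M : ℕ) : ℕ := Nat.card {P : n.Partition // (M : ℤ) ≤ P.rank}

/-- The number of partitions of `n` of rank at most `-M`. -/
noncomputable def rankLowerTail (n M : ℕ) : ℕ := Nat.card {P : n.Partition // P.rank ≤ -(M : ℤ)}

theorem card_rank_le_add_card_lt_rank (n : ℕ) (r : ℤ) :
    Nat.card {P : n.Partition // P.rank ≤ r} + Nat.card {P : n.Partition // r + 1 ≤ P.rank}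
      = partitionCount n := by
  have h : ∀ P : n.Partition, r + 1 ≤ P.rank ↔ ¬ P.rank ≤ r := fun P => by omega
  simp only [h]
  rw [← Nat.card_sum, partitionCount]
  exact Nat.card_congr (Equiv.sumCompl _)

theorem Nat.Partition.sup_le {n : ℕ} (P : n.Partition) : P.parts.sup ≤ n :=
  Multiset.sup_le.2 fun _ hi => P.le_of_mem_parts hi

theorem Nat.Partition.card_parts_le {n : ℕ} (P : n.Partition) : Multiset.card P.parts ≤ n := by
  have := Multiset.card_nsmul_le_sum (s := P.parts) (a := 1) fun i hi => P.parts_pos hi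
  rwa [smul_eq_mul, mul_one, P.parts_sum] at this

theorem Nat.Partition.abs_rank_lt {n : ℕ} (P : n.Partition) (h : P.rank ≠ 0) : |P.rank| < n := by
  have h0 : P.parts ≠ 0 := fun h0 => h (by simp [Nat.Partition.rank, h0])
  have h1 := P.sup_le
  have h2 := P.card_parts_le
  have h3 := P.parts_pos (Multiset.sup_mem_of_ne_zero h0)
  have h4 := Multiset.card_pos.2 h0
  rw [Nat.Partition.rank, abs_lt]
  omega

theorem rankTail_eq_zero {n M : ℕ} (hM : 1 ≤ M) (h : n ≤ M) : rankTail n M = 0 := by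
  rw [rankTail, Nat.card_eq_zero]
  refine Or.inl ⟨fun P => ?_⟩
  have h1 := P.2
  have h2 := abs_lt.1 (P.1.abs_rank_lt (by omega))
  omega

theorem rankLowerTail_eq_zero {n M : ℕ} (hM : 1 ≤ M) (h : n ≤ M) : rankLowerTail n M = 0 := by
  rw [rankLowerTail, Nat.card_eq_zero]
  refine Or.inl ⟨fun P => ?_⟩
  have h1 := P.2
  have h2 := abs_lt.1 (P.1.abs_rank_lt (by omega))
  omega

theorem rankTail_add_rankTail (N M : ℕ) :
    rankTail (N + (M + 1)) M + rankTail N (M + 3) = partitionCount N := by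
  rw [rankTail, card_le_rank_eq_card_rank_le (N := N) (by push_cast; ring) (by omega),
    ← card_rank_le_add_card_lt_rank N (M + 2), rankTail]
  push_cast
  rw [add_assoc (M : ℤ) 2 1]
  norm_num

theorem rankLowerTail_add_rankLowerTail (N : ℕ) {M : ℕ} (hM : 1 ≤ M) :
    rankLowerTail (N + (M + 1)) M + rankLowerTail N (M + 3) = partitionCount N := by
  have h := card_le_rank_eq_card_rank_le (n := N) (N := N + (M + 1)) (m := -M - 2)
    (by push_cast; ring) (by omega)
  rw [show -(M : ℤ) - 2 + 2 = -M by ring] at h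
  rw [rankLowerTail, ← h, ← card_rank_le_add_card_lt_rank N (-(M + 3)), rankLowerTail, add_comm]
  push_cast
  rw [show -((M : ℤ) + 3) + 1 = -M - 2 by ring]

/-- The shifts in the expansion of the number of partitions of large rank. -/
noncomputable def rankShift (M k : ℕ) : ℝ := (k + 1) * M + (k + 1) * (3 * k + 2) / 2

theorem rankShift_succ (M k : ℕ) : rankShift M (k + 1) = M + 1 + rankShift (M + 3) k := by
  simp only [rankShift]
  push_cast
  ring

theorem le_rankShift (M k : ℕ) : (M : ℝ) + 1 ≤ rankShift M k := by
  have h1 : (0 : ℝ) ≤ k := k.cast_nonneg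
  have h2 : (0 : ℝ) ≤ M := M.cast_nonneg
  simp only [rankShift]
  nlinarith [mul_nonneg h1 h2]

theorem hasSum_partitionStep_sub_rankShift {f : ℕ → ℕ → ℕ}
    (h0 : ∀ n M, 1 ≤ M → n ≤ M → f n M = 0)
    (hrec : ∀ N M, 1 ≤ M → f (N + (M + 1)) M + f N (M + 3) = partitionCount N)
    (n : ℕ) {M : ℕ} (hM : 1 ≤ M) :
    HasSum (fun k => (-1 : ℝ) ^ k * partitionStep (n - rankShift M k)) (f n M) := by
  induction n using Nat.strong_induction_on generalizing M with
  | _ n ih =>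
    rcases le_or_gt n M with h | h
    · rw [h0 n M hM h, Nat.cast_zero]
      convert hasSum_zero with k
      have := le_rankShift M k
      have : (n : ℝ) ≤ M := by exact_mod_cast h
      rw [partitionStep_of_neg (by linarith), mul_zero]
    · obtain ⟨N, rfl⟩ := Nat.exists_eq_add_of_le' h
      have h1 := ih N (by omega) (M := M + 3) (by omega)
      have h2 : (f (N + (M + 1)) M : ℝ) + f N (M + 3) = partitionCount N := by
        exact_mod_cast hrec N M hM
      rw [← hasSum_nat_add_iff' 1]
      convert h1.neg using 1
      · ext k
        rw [rankShift_succ, pow_succ]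
        push_cast
        rw [show (N : ℝ) + (M + 1) - (M + 1 + rankShift (M + 3) k) = N - rankShift (M + 3) k by
          ring]
        ring
      · rw [Finset.sum_range_one, pow_zero, one_mul, rankShift]
        push_cast
        rw [show (N : ℝ) + (M + 1) - ((0 + 1) * M + (0 + 1) * (3 * 0 + 2) / 2) = N by ring,
          partitionStep_natCast]
        linarith

theorem hasSum_rankTail (n : ℕ) {M : ℕ} (hM : 1 ≤ M) :
    HasSum (fun k => (-1 : ℝ) ^ k * partitionStep (n - rankShift M k)) (rankTail n M) :=
  hasSum_partitionStep_sub_rankShift (fun _ _ => rankTail_eq_zero)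
    (fun N M _ => rankTail_add_rankTail N M) n hM

theorem rankLowerTail_eq_rankTail (n : ℕ) {M : ℕ} (hM : 1 ≤ M) :
    rankLowerTail n M = rankTail n M := by
  have h := hasSum_partitionStep_sub_rankShift (fun _ _ => rankLowerTail_eq_zero)
    (fun N M hM => rankLowerTail_add_rankLowerTail N hM) n hM
  exact_mod_cast h.unique (hasSum_rankTail n hM)

theorem rankTail_le_partitionStep (n : ℕ) {M : ℕ} (hM : 1 ≤ M) :
    (rankTail n M : ℝ) ≤ partitionStep (n - M) := by
  rcases le_or_gt n M with h | h
  · rw [rankTail_eq_zero hM h, Nat.cast_zero]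
    exact partitionStep_nonneg _
  · obtain ⟨N, rfl⟩ := Nat.exists_eq_add_of_le' h
    have h1 : (rankTail (N + (M + 1)) M : ℝ) ≤ partitionCount N := by
      exact_mod_cast (rankTail_add_rankTail N M).symm ▸ Nat.le_add_right _ _
    refine h1.trans ?_
    rw [← partitionStep_natCast N]
    refine partitionStep_mono ?_
    push_cast
    linarith

/-- The proportion of partitions of `n` whose rank exceeds `y √n`. -/
noncomputable def rankTailRatio (n : ℕ) (y : ℝ) : ℝ :=
  rankTail n (⌊y * √n⌋₊ + 1) / partitionCount n

theorem rankTailRatio_nonneg (n : ℕ) (y : ℝ) : 0 ≤ rankTailRatio n y := by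
  unfold rankTailRatio
  positivity

theorem tendsto_partitionRatio {x : ℕ → ℝ} {a : ℝ} (hx : ∀ᶠ n in atTop, 0 ≤ x n)
    (h : Tendsto x atTop (nhds a)) :
    Tendsto (fun n => partitionRatio n (x n)) atTop (nhds (exp (-(π / √6 * a)))) := by
  have h1 : Tendsto (fun n => exp (-(π / √6 * x n))) atTop (nhds (exp (-(π / √6 * a)))) :=
    (continuous_exp.tendsto _).comp (h.const_mul _).neg
  have h2 : Tendsto (fun n => partitionRatio n (x n) - exp (-(π / √6 * x n))) atTop (nhds 0) := by
    rw [Metric.tendsto_nhds]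
    intro ε hε
    filter_upwards [hx, eventually_abs_partitionRatio_sub_exp_le (half_pos hε)] with n hn h
    rw [dist_zero_right, norm_eq_abs]
    exact (h _ hn).trans_lt (half_lt_self hε)
  simpa using h2.add h1

theorem le_rankShift_div_sqrt {n : ℕ} (hn : 0 < n) (y : ℝ) (k : ℕ) :
    (k + 1) * y ≤ rankShift (⌊y * √n⌋₊ + 1) k / √n := by
  have hs : 0 < √(n : ℝ) := sqrt_pos.2 (by exact_mod_cast hn)
  rw [le_div_iff₀ hs, rankShift]
  have h1 := (Nat.lt_floor_add_one (y * √n)).le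
  have h2 : (0 : ℝ) ≤ k := k.cast_nonneg
  have h3 := mul_le_mul_of_nonneg_left h1 (by linarith : (0 : ℝ) ≤ k + 1)
  push_cast
  nlinarith

theorem tendsto_rankShift_div_sqrt {y : ℝ} (hy : 0 ≤ y) (k : ℕ) :
    Tendsto (fun n : ℕ => rankShift (⌊y * √n⌋₊ + 1) k / √n) atTop (nhds ((k + 1) * y)) := by
  have hs : Tendsto (fun n : ℕ => √(n : ℝ)) atTop atTop :=
    tendsto_sqrt_atTop.comp tendsto_natCast_atTop_atTop
  have h1 := (tendsto_nat_floor_mul_div_atTop hy).comp hs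
  have h2 := hs.const_div_atTop (((k : ℝ) + 1) + (k + 1) * (3 * k + 2) / 2)
  convert (h1.const_mul ((k : ℝ) + 1)).add h2 using 2 with n
  · simp only [Function.comp, rankShift]
    push_cast
    ring
  · rw [add_zero]

theorem hasSum_rankTailRatio {n : ℕ} (hn : 0 < n) (y : ℝ) :
    HasSum (fun k => (-1) ^ k * partitionRatio n (rankShift (⌊y * √n⌋₊ + 1) k / √n))
      (rankTailRatio n y) := by
  have hs : √(n : ℝ) ≠ 0 := (sqrt_pos.2 (by exact_mod_cast hn)).ne'
  convert (hasSum_rankTail n (Nat.le_add_left 1 ⌊y * √n⌋₊)).div_const (partitionCount n : ℝ)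
    using 2 with k
  · rfl
  · rw [partitionRatio, div_mul_cancel₀ _ hs, mul_div_assoc]
  · rfl

theorem partitionRatio_rankShift_le {n : ℕ} (hn : 0 < n) {y : ℝ} (hy : 0 ≤ y) (k : ℕ) :
    partitionRatio n (rankShift (⌊y * √n⌋₊ + 1) k / √n)
      ≤ 2 * exp (-(log 2 / 3 * ((k + 1) * y))) :=
  (partitionRatio_antitone n (le_rankShift_div_sqrt hn y k)).trans
    (partitionRatio_le_exp hn (by positivity))

theorem rankTailRatio_le {n : ℕ} (hn : 0 < n) {y : ℝ} (hy : 0 ≤ y) :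
    rankTailRatio n y ≤ 2 * exp (-(log 2 / 3 * y)) := by
  refine le_trans ?_ (partitionRatio_le_exp hn hy)
  refine div_le_div_of_nonneg_right ?_ (Nat.cast_nonneg _)
  refine (rankTail_le_partitionStep n (Nat.le_add_left 1 _)).trans (partitionStep_mono ?_)
  have h1 := (Nat.lt_floor_add_one (y * √n)).le
  push_cast
  linarith

theorem summable_exp_neg_succ_mul {a : ℝ} (ha : 0 < a) :
    Summable fun k : ℕ => exp (-(a * (k + 1))) := by
  have h := ((summable_nat_add_iff 1).2 (Real.summable_exp_nat_mul_iff.2 (neg_lt_zero.2 ha)))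
  refine h.congr fun k => ?_
  push_cast
  ring_nf

theorem tendsto_rankTailRatio {y : ℝ} (hy : 0 < y) :
    Tendsto (fun n => rankTailRatio n y) atTop
      (nhds (∑' k : ℕ, (-1) ^ k * exp (-(π / √6 * ((k + 1) * y))))) := by
  have hb : Summable fun k : ℕ => 2 * exp (-(log 2 / 3 * ((k + 1) * y))) := by
    refine ((summable_exp_neg_succ_mul (a := log 2 / 3 * y)
      (by have := log_pos one_lt_two; positivity)).mul_left 2).congr fun k => ?_
    ring_nf
  have h := tendsto_tsum_of_dominated_convergence (𝓕 := atTop) hb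
    (f := fun n k => (-1) ^ k * partitionRatio n (rankShift (⌊y * √n⌋₊ + 1) k / √n))
    (g := fun k : ℕ => (-1) ^ k * exp (-(π / √6 * ((k + 1) * y)))) ?_ ?_
  · refine h.congr' ?_
    filter_upwards [eventually_gt_atTop 0] with n hn
    exact (hasSum_rankTailRatio hn y).tsum_eq
  · refine fun k => (tendsto_partitionRatio ?_ (tendsto_rankShift_div_sqrt hy.le k)).const_mul _
    filter_upwards [eventually_gt_atTop 0] with n hn
    exact le_trans (by positivity) (le_rankShift_div_sqrt hn y k)
  · filter_upwards [eventually_gt_atTop 0] with n hn k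
    rw [norm_mul, norm_pow, norm_neg, norm_one, one_pow, one_mul, norm_eq_abs,
      abs_of_nonneg (partitionRatio_nonneg _ _)]
    exact partitionRatio_rankShift_le hn hy.le k

theorem rankMoment_eq_sum (k n : ℕ) : rankMoment k n = ∑ P : n.Partition, P.rank ^ k := by
  have hmem : ∀ P ∈ (Finset.univ : Finset n.Partition), P.rank ∈ Finset.Icc (-(n : ℤ)) n := by
    intro P _
    rw [Finset.mem_Icc, ← abs_le]
    rcases eq_or_ne P.rank 0 with h | h
    · simp [h]
    · exact (P.abs_rank_lt h).le
  rw [rankMoment, ← Finset.sum_fiberwise_of_maps_to hmem]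
  refine Finset.sum_congr rfl fun m _ => ?_
  rw [Finset.sum_congr rfl fun P hP => by rw [(Finset.mem_filter.1 hP).2], Finset.sum_const,
    nsmul_eq_mul, mul_comm, rankCount, Nat.card_eq_fintype_card, Fintype.card_subtype]

theorem integrableOn_indicator_Iio_pow (k : ℕ) (r : ℝ) :
    IntegrableOn ((Iio r).indicator fun y => ((k : ℝ) + 1) * y ^ k) (Ioi 0) := by
  rw [IntegrableOn, integrable_indicator_iff measurableSet_Iio, IntegrableOn,
    Measure.restrict_restrict measurableSet_Iio, inter_comm, Ioi_inter_Iio]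
  exact ((by fun_prop : Continuous fun y : ℝ => ((k : ℝ) + 1) * y ^ k).integrableOn_Icc
    (a := 0) (b := r)).mono_set Ioo_subset_Icc_self

theorem integral_indicator_Iio_pow (k : ℕ) {r : ℝ} (hr : 0 ≤ r) :
    ∫ y in Ioi 0, (Iio r).indicator (fun y => ((k : ℝ) + 1) * y ^ k) y = r ^ (k + 1) := by
  rw [setIntegral_indicator measurableSet_Iio, Ioi_inter_Iio, ← integral_Ioc_eq_integral_Ioo,
    ← intervalIntegral.integral_of_le hr, intervalIntegral.integral_const_mul, integral_pow,
    zero_pow k.succ_ne_zero, sub_zero]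
  field_simp

theorem card_filter_lt_abs_rank {n : ℕ} (hn : 0 < n) {y : ℝ} (hy : 0 ≤ y) :
    ((Finset.univ.filter fun P : n.Partition => y < |(P.rank : ℝ)| / √n).card : ℝ)
      = 2 * rankTail n (⌊y * √n⌋₊ + 1) := by
  have hs : 0 < √(n : ℝ) := sqrt_pos.2 (by exact_mod_cast hn)
  set M := ⌊y * √n⌋₊ + 1 with hM
  have h1 : ∀ P : n.Partition, y < |(P.rank : ℝ)| / √n ↔ (M : ℤ) ≤ P.rank ∨ P.rank ≤ -(M : ℤ) := by
    intro P
    rw [lt_div_iff₀ hs, ← Int.cast_abs, Int.abs_eq_natAbs, Int.cast_natCast,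
      ← Nat.floor_lt (by positivity)]
    omega
  have h2 : Disjoint (Finset.univ.filter fun P : n.Partition => (M : ℤ) ≤ P.rank)
      (Finset.univ.filter fun P : n.Partition => P.rank ≤ -(M : ℤ)) :=
    Finset.disjoint_filter.2 fun P _ h => by omega
  simp only [h1]
  rw [Finset.filter_or, Finset.card_union_of_disjoint h2, ← Fintype.card_subtype,
    ← Fintype.card_subtype, ← Nat.card_eq_fintype_card, ← Nat.card_eq_fintype_card]
  change ((rankTail n M + rankLowerTail n M : ℕ) : ℝ) = _
  rw [rankLowerTail_eq_rankTail n (Nat.le_add_left 1 _)]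
  push_cast
  ring

theorem rankMoment_div_eq_integral {n l : ℕ} (hn : 0 < n) (hl : 0 < l) :
    (rankMoment (2 * l) n : ℝ) / (n ^ l * partitionCount n)
      = ∫ y in Ioi 0, (4 * l) * (y ^ (2 * l - 1) * rankTailRatio n y) := by
  have hs : 0 < √(n : ℝ) := sqrt_pos.2 (by exact_mod_cast hn)
  have hp : (partitionCount n : ℝ) ≠ 0 := by exact_mod_cast (partitionCount_pos n).ne'
  have h1 : (rankMoment (2 * l) n : ℝ) / n ^ l
      = ∑ P : n.Partition, (|(P.rank : ℝ)| / √n) ^ (2 * l - 1 + 1) := by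
    rw [rankMoment_eq_sum, Int.cast_sum, Finset.sum_div]
    refine Finset.sum_congr rfl fun P _ => ?_
    rw [Nat.sub_add_cancel (by omega), div_pow, Int.cast_pow, pow_mul, pow_mul |_|, pow_mul √_,
      sq_abs, sq_sqrt (Nat.cast_nonneg n)]
  have h2 : ∑ P : n.Partition, (|(P.rank : ℝ)| / √n) ^ (2 * l - 1 + 1)
      = ∫ y in Ioi 0, ∑ P : n.Partition, (Iio (|(P.rank : ℝ)| / √n)).indicator
          (fun y => (((2 * l - 1 : ℕ) : ℝ) + 1) * y ^ (2 * l - 1)) y := by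
    rw [integral_finsetSum _ fun P _ => integrableOn_indicator_Iio_pow _ _]
    exact Finset.sum_congr rfl fun P _ => (integral_indicator_Iio_pow _ (by positivity)).symm
  rw [← div_div, h1, h2, ← integral_div]
  refine setIntegral_congr_fun measurableSet_Ioi fun y hy => ?_
  simp only [indicator_apply, mem_Iio]
  rw [← Finset.sum_filter, Finset.sum_const, nsmul_eq_mul,
    card_filter_lt_abs_rank hn (le_of_lt hy), rankTailRatio,
    Nat.cast_sub (by omega : 1 ≤ 2 * l)]
  push_cast
  ring

theorem measurable_rankTailRatio (n : ℕ) : Measurable (rankTailRatio n) := by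
  have h : Measurable fun M : ℕ => (rankTail n (M + 1) : ℝ) / partitionCount n :=
    measurable_of_countable _
  exact h.comp (Nat.measurable_floor.comp (measurable_id.mul_const _))

theorem tendsto_rankMoment_div {l : ℕ} (hl : 0 < l) :
    Tendsto (fun n : ℕ => (rankMoment (2 * l) n : ℝ) / (n ^ l * partitionCount n)) atTop
      (nhds (∫ y in Ioi 0, (4 * l) * (y ^ (2 * l - 1) *
        ∑' k : ℕ, (-1) ^ k * exp (-(π / √6 * ((k + 1) * y)))))) := by
  have h : Tendsto (fun n : ℕ => ∫ y in Ioi 0, (4 * l) * (y ^ (2 * l - 1) * rankTailRatio n y))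
      atTop (nhds (∫ y in Ioi 0, (4 * l) * (y ^ (2 * l - 1) *
        ∑' k : ℕ, (-1) ^ k * exp (-(π / √6 * ((k + 1) * y)))))) := by
    refine tendsto_integral_filter_of_dominated_convergence
      (fun y => (4 * l) * 2 * (y ^ (2 * l - 1) * exp (-(log 2 / 3 * y)))) ?_ ?_ ?_ ?_
    · exact Eventually.of_forall fun n =>
        ((measurable_id.pow_const _).mul (measurable_rankTailRatio n)).const_mul _
          |>.aestronglyMeasurable
    · filter_upwards [eventually_gt_atTop 0] with n hn
      filter_upwards [ae_restrict_mem measurableSet_Ioi] with y hy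
      have hy0 : 0 ≤ y := le_of_lt hy
      have h1 := mul_le_mul_of_nonneg_left (rankTailRatio_le hn hy0)
        (by positivity : 0 ≤ 4 * (l : ℝ) * y ^ (2 * l - 1))
      rw [norm_eq_abs, abs_of_nonneg (by have := rankTailRatio_nonneg n y; positivity)]
      linarith
    · exact (integrableOn_pow_mul_exp_neg _
        (by have := log_pos one_lt_two; positivity)).const_mul _
    · filter_upwards [ae_restrict_mem measurableSet_Ioi] with y hy
      exact ((tendsto_rankTailRatio hy).const_mul _).const_mul _
  refine h.congr' ?_
  filter_upwards [eventually_gt_atTop 0] with n hn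
  exact (rankMoment_div_eq_integral hn hl).symm

theorem integral_pow_mul_exp_neg_mul_Ioi (m : ℕ) {a : ℝ} (ha : 0 < a) :
    ∫ y in Ioi 0, y ^ m * exp (-(a * y)) = m.factorial / a ^ (m + 1) := by
  have h := Real.integral_rpow_mul_exp_neg_mul_Ioi (a := m + 1) (by positivity) ha
  rw [Real.Gamma_nat_eq_factorial, add_sub_cancel_right] at h
  simp only [rpow_natCast] at h
  rw [h, ← Nat.cast_add_one, rpow_natCast, one_div, inv_pow, div_eq_inv_mul]

theorem hasSum_alternating_zeta_nat {s : ℕ} {Z : ℝ} (hs : s ≠ 0)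
    (h : HasSum (fun n : ℕ => 1 / (n : ℝ) ^ s) Z) :
    HasSum (fun k : ℕ => (-1 : ℝ) ^ k / ((k : ℝ) + 1) ^ s) ((1 - 2 / 2 ^ s) * Z) := by
  have h1 : HasSum (fun n : ℕ => if Even n then 1 / (n : ℝ) ^ s else 0) (1 / 2 ^ s * Z) := by
    rw [← (mul_right_injective₀ (two_ne_zero' ℕ)).hasSum_iff]
    · refine (h.mul_left (1 / 2 ^ s)).congr_fun fun n => ?_
      simp [mul_pow, mul_comm]
    · intro n hn
      refine if_neg fun he => hn ?_
      obtain ⟨r, rfl⟩ := he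
      exact ⟨r, two_mul r⟩
  have h2 := h.sub (h1.mul_left 2)
  rw [← hasSum_nat_add_iff' 1] at h2
  have h3 : (1 - 2 / 2 ^ s) * Z = Z - 2 * (1 / 2 ^ s * Z) - ∑ i ∈ Finset.range 1,
      (1 / (i : ℝ) ^ s - 2 * if Even i then 1 / (i : ℝ) ^ s else 0) := by
    simp [hs]
    ring
  rw [h3]
  refine h2.congr_fun fun k => ?_
  rcases Nat.even_or_odd k with hk | hk
  · simp [hk.neg_one_pow, Nat.even_add_one, hk]
  · rw [hk.neg_one_pow, if_pos (by rw [Nat.even_add_one]; exact Nat.not_even_iff_odd.2 hk)]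
    push_cast
    ring

theorem integral_pow_mul_tsum_alternating_exp {m : ℕ} {c Z : ℝ} (hc : 0 < c)
    (h : HasSum (fun n : ℕ => 1 / (n : ℝ) ^ (m + 1)) Z) :
    ∫ y in Ioi 0, y ^ m * ∑' k : ℕ, (-1) ^ k * exp (-(c * ((k + 1) * y)))
      = m.factorial / c ^ (m + 1) * ((1 - 2 / 2 ^ (m + 1)) * Z) := by
  have hck : ∀ k : ℕ, 0 < c * (k + 1) := fun k => by positivity
  have hval : ∀ k : ℕ, ∫ y in Ioi 0, y ^ m * exp (-(c * (k + 1) * y))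
      = m.factorial / c ^ (m + 1) * (1 / (k + 1) ^ (m + 1)) := fun k => by
    rw [integral_pow_mul_exp_neg_mul_Ioi m (hck k), mul_pow]
    field_simp
  have hint : ∀ k : ℕ, Integrable (fun y => (-1) ^ k * (y ^ m * exp (-(c * (k + 1) * y))))
      (volume.restrict (Ioi 0)) :=
    fun k => (integrableOn_pow_mul_exp_neg m (hck k)).const_mul _
  have hnorm : ∀ k : ℕ, ∫ y in Ioi 0, ‖(-1) ^ k * (y ^ m * exp (-(c * (k + 1) * y)))‖
      = m.factorial / c ^ (m + 1) * (1 / (k + 1) ^ (m + 1)) := fun k => by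
    rw [← hval]
    refine setIntegral_congr_fun measurableSet_Ioi fun y hy => ?_
    have hy0 : 0 ≤ y := le_of_lt hy
    simp only [norm_mul, norm_pow, norm_neg, norm_one, one_pow, one_mul, norm_eq_abs, abs_exp,
      abs_of_nonneg hy0]
  have hsum : Summable fun k : ℕ =>
      ∫ y in Ioi 0, ‖(-1) ^ k * (y ^ m * exp (-(c * (k + 1) * y)))‖ := by
    simp only [hnorm]
    refine (((summable_nat_add_iff 1).2 h.summable).mul_left (m.factorial / c ^ (m + 1) : ℝ)).congr fun k => ?_
    push_cast
    rfl
  have h1 := hasSum_integral_of_summable_integral_norm hint hsum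
  have h2 := (hasSum_alternating_zeta_nat m.succ_ne_zero h).mul_left (m.factorial / c ^ (m + 1))
  have h3 := h1.unique (h2.congr_fun fun k => by
    rw [integral_const_mul, hval, mul_left_comm, mul_one_div])
  rw [← h3]
  refine setIntegral_congr_fun measurableSet_Ioi fun y _ => ?_
  rw [← tsum_mul_left]
  refine tsum_congr fun k => ?_
  rw [mul_left_comm, mul_assoc c]

theorem hasSum_zeta_even_abs_bernoulli {l : ℕ} (hl : l ≠ 0) :
    HasSum (fun n : ℕ => 1 / (n : ℝ) ^ (2 * l))
      (2 ^ (2 * l - 1) * π ^ (2 * l) * |(bernoulli (2 * l) : ℝ)| / (2 * l).factorial) := by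
  have h := hasSum_zeta_nat hl
  convert h using 1
  rw [← abs_of_nonneg (h.nonneg fun n => by positivity)]
  simp [abs_div, abs_mul, abs_pow, abs_of_pos pi_pos]

theorem four_mul_integral_eq_abs_bernoulli {l : ℕ} (hl : 0 < l) :
    ∫ y in Ioi 0, (4 * l) * (y ^ (2 * l - 1) *
        ∑' k : ℕ, (-1) ^ k * exp (-(π / √6 * ((k + 1) * y))))
      = 6 ^ l * ((2 ^ (2 * l) - 2) * |(bernoulli (2 * l) : ℝ)|) := by
  have hm : 2 * l - 1 + 1 = 2 * l := by omega
  have hc : (π / √6) ^ (2 * l) = π ^ (2 * l) / 6 ^ l := by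
    rw [div_pow, pow_mul √6, sq_sqrt (by norm_num)]
  have hf : ((2 * l).factorial : ℝ) = 2 * l * (2 * l - 1).factorial := by
    rw [← Nat.mul_factorial_pred (by omega : 2 * l ≠ 0)]
    push_cast
    ring
  have h2 : (2 : ℝ) ^ (2 * l) = 2 * 2 ^ (2 * l - 1) := by rw [← pow_succ', hm]
  have hl0 : (l : ℝ) ≠ 0 := by exact_mod_cast hl.ne'
  have hf0 : ((2 * l - 1).factorial : ℝ) ≠ 0 := by exact_mod_cast Nat.factorial_ne_zero _
  rw [integral_const_mul, integral_pow_mul_tsum_alternating_exp (by positivity)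
    (by rw [hm]; exact hasSum_zeta_even_abs_bernoulli hl.ne'), hm, hc, hf, h2]
  field_simp
  ring

end

theorem even_rank_moment_asymptotics (l : ℕ) (hl : 0 < l) :
    Tendsto
      (fun n : ℕ =>
        (rankMoment (2 * l) n : ℝ) / ((6 * n : ℝ) ^ l * (partitionCount n : ℝ)))
      atTop (nhds ((2 ^ (2 * l) - 2) * |(bernoulli (2 * l) : ℝ)|)) := by
  have h := (tendsto_rankMoment_div hl).div_const (6 ^ l)
  rw [four_mul_integral_eq_abs_bernoulli hl, mul_div_cancel_left₀ _ (by positivity)] at h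
  refine h.congr fun n => ?_
  rw [mul_pow, div_div]
  congr 1
  ring
end

section
/- Let X be a real-valued random variable with the logistic distribution function F_r(x) = 1/(1 + e^{−πx}). Then for every positive integer l, E(X^{2l}) = (2^{2l} − 2)·|B_{2l}|, where B_{2l} is the (2l)-th Bernoulli number, and E(X^{2l−1}) = 0. -/
open MeasureTheory Real

section LogisticLaw

variable {ν : Measure ℝ} [IsProbabilityMeasure ν]

theorem one_sub_logistic_neg (x : ℝ) :
    1 - 1 / (1 + exp (-π * -x)) = 1 / (1 + exp (-π * x)) := by
  rw [neg_mul_neg, neg_mul, exp_neg]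
  have := exp_pos (π * x)
  field_simp
  ring

theorem cdf_eq_of_Iic_eq_logistic
    (h : ∀ x, ν (Set.Iic x) = ENNReal.ofReal (1 / (1 + exp (-π * x)))) :
    (ProbabilityTheory.cdf ν : ℝ → ℝ) = fun x ↦ 1 / (1 + exp (-π * x)) := by
  ext x
  rw [ProbabilityTheory.cdf_eq_real, Measure.real, h, ENNReal.toReal_ofReal (by positivity)]

theorem leftLim_logistic (x : ℝ) :
    Function.leftLim (fun x : ℝ ↦ 1 / (1 + exp (-π * x))) x = 1 / (1 + exp (-π * x)) := by
  have hc : Continuous fun x : ℝ ↦ 1 / (1 + exp (-π * x)) :=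
    continuous_const.div (by fun_prop) fun x ↦ by positivity
  exact leftLim_eq_of_tendsto (hc.continuousAt.tendsto.mono_left nhdsWithin_le_nhds)

theorem measure_Iio_eq_logistic
    (h : ∀ x, ν (Set.Iic x) = ENNReal.ofReal (1 / (1 + exp (-π * x)))) (x : ℝ) :
    ν (Set.Iio x) = ENNReal.ofReal (1 / (1 + exp (-π * x))) := by
  conv_lhs => rw [← ProbabilityTheory.measure_cdf ν]
  rw [StieltjesFunction.measure_Iio _ (ProbabilityTheory.tendsto_cdf_atBot ν),
    cdf_eq_of_Iic_eq_logistic h, leftLim_logistic, sub_zero]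

theorem map_neg_eq_of_logistic
    (h : ∀ x, ν (Set.Iic x) = ENNReal.ofReal (1 / (1 + exp (-π * x)))) :
    ν.map (fun x ↦ -x) = ν := by
  have : IsProbabilityMeasure (ν.map fun x ↦ -x) :=
    Measure.isProbabilityMeasure_map (by fun_prop)
  refine Measure.ext_of_Iic _ _ fun x ↦ ?_
  rw [Measure.map_apply measurable_neg measurableSet_Iic, h]
  have hs : (fun x : ℝ ↦ -x) ⁻¹' Set.Iic x = Set.Ici (-x) := by
    ext y
    simp
  rw [hs]
  conv_lhs => rw [← ProbabilityTheory.measure_cdf ν]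
  rw [StieltjesFunction.measure_Ici _ (ProbabilityTheory.tendsto_cdf_atTop ν),
    cdf_eq_of_Iic_eq_logistic h, leftLim_logistic, one_sub_logistic_neg]

theorem measure_lt_abs_of_logistic
    (h : ∀ x, ν (Set.Iic x) = ENNReal.ofReal (1 / (1 + exp (-π * x)))) {t : ℝ} (ht : 0 < t) :
    ν {x | t < |x|} = ENNReal.ofReal (2 / (1 + exp (π * t))) := by
  have hs : {x : ℝ | t < |x|} = Set.Ioi t ∪ Set.Iio (-t) := by
    ext y
    simp [lt_abs, lt_neg]
  have hIoi : ν (Set.Ioi t) = ν (Set.Iio (-t)) := by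
    conv_lhs => rw [← map_neg_eq_of_logistic h]
    rw [Measure.map_apply measurable_neg measurableSet_Ioi]
    congr 1
    ext y
    simp
  have hd : Disjoint (Set.Ioi t) (Set.Iio (-t)) := by
    rw [Set.disjoint_left]
    intro y hy hy'
    simp only [Set.mem_Ioi, Set.mem_Iio] at hy hy'
    linarith
  rw [hs, measure_union hd measurableSet_Iio, hIoi, measure_Iio_eq_logistic h,
    ← ENNReal.ofReal_add (by positivity) (by positivity), neg_mul_neg]
  congr 1
  ring

theorem integral_abs_pow_of_logistic
    (h : ∀ x, ν (Set.Iic x) = ENNReal.ofReal (1 / (1 + exp (-π * x)))) {m : ℕ} (hm : 0 < m) :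
    ∫ x, |x| ^ m ∂ν = 2 * m * ∫ t in Set.Ioi (0 : ℝ), t ^ (m - 1) * (1 / (1 + exp (π * t))) := by
  have hm' : (0 : ℝ) < m := by exact_mod_cast hm
  have key := lintegral_rpow_eq_lintegral_meas_lt_mul ν (f := fun x : ℝ ↦ |x|)
    (.of_forall fun x ↦ abs_nonneg x) (by fun_prop) hm'
  have hR : ∫⁻ t in Set.Ioi (0 : ℝ), ν {x | t < |x|} * ENNReal.ofReal (t ^ ((m : ℝ) - 1)) =
      ∫⁻ t in Set.Ioi (0 : ℝ),
        ENNReal.ofReal (2 * (t ^ (m - 1) * (1 / (1 + exp (π * t))))) := by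
    refine setLIntegral_congr_fun measurableSet_Ioi fun t ht ↦ ?_
    have ht : 0 < t := ht
    have hpow : t ^ ((m : ℝ) - 1) = t ^ (m - 1) := by
      rw [← rpow_natCast, Nat.cast_sub hm, Nat.cast_one]
    rw [measure_lt_abs_of_logistic h ht, ← ENNReal.ofReal_mul (by positivity), hpow]
    congr 1
    ring
  simp_rw [rpow_natCast] at key
  rw [hR] at key
  rw [integral_eq_lintegral_of_nonneg_ae (.of_forall fun x ↦ by positivity) (by fun_prop), key,
    ENNReal.toReal_mul, ENNReal.toReal_ofReal hm'.le, ← integral_eq_lintegral_of_nonneg_ae,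
    integral_const_mul]
  · ring
  · refine (ae_restrict_iff' measurableSet_Ioi).2 (.of_forall fun t ht ↦ ?_)
    have ht : 0 < t := ht
    simp only [Pi.zero_apply]
    positivity
  · exact (by fun_prop : Measurable fun t : ℝ ↦
      2 * (t ^ (m - 1) * (1 / (1 + exp (π * t))))).aestronglyMeasurable

end LogisticLaw

theorem hasSum_neg_one_pow_mul_exp {t : ℝ} (ht : 0 < t) :
    HasSum (fun n : ℕ ↦ (-1 : ℝ) ^ n * exp (-π * (n + 1) * t)) (1 / (1 + exp (π * t))) := by
  have hx : exp (-(π * t)) < 1 := by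
    rw [← exp_zero]
    exact exp_lt_exp.2 (neg_lt_zero.2 (by positivity))
  have hg := (hasSum_geometric_of_abs_lt_one (r := -exp (-(π * t)))
    (by rwa [abs_neg, abs_of_pos (exp_pos _)])).mul_right (exp (-(π * t)))
  convert! hg using 1
  · ext n
    rw [neg_pow (exp _), ← exp_nat_mul, mul_assoc ((-1) ^ n), ← exp_add]
    ring_nf
  · rw [exp_neg]
    have := exp_pos (π * t)
    field_simp
    rw [sub_neg_eq_add]
    field_simp
    ring

theorem hasSum_alternating_zeta_nat_s11 {l : ℕ} (hl : 0 < l) :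
    HasSum (fun n : ℕ ↦ (-1 : ℝ) ^ n / ((n : ℝ) + 1) ^ (2 * l))
      ((-1) ^ (l + 1) * π ^ (2 * l) * (2 ^ (2 * l) - 2) / 2 / (2 * l).factorial *
        bernoulli (2 * l)) := by
  have h := hasSum_one_div_nat_pow_mul_cos hl.ne' (x := 2⁻¹) ⟨by norm_num, by norm_num⟩
  have hcos (n : ℕ) : cos (2 * π * n * 2⁻¹) = (-1) ^ n := by
    rw [← cos_nat_mul_pi]
    ring_nf
  have hb := bernoulliFun_eval_half (2 * l)
  rw [bernoulliFun] at hb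
  rw [hb, ← hasSum_nat_add_iff' 1] at h
  convert! h.neg using 1
  · ext n
    rw [hcos]
    push_cast
    ring
  · have h2 : (2 : ℝ) ^ (2 * l) ≠ 0 := by positivity
    have : 2 * l ≠ 0 := by omega
    simp only [Finset.sum_range_one, Nat.cast_zero, zero_pow this, mul_pow]
    field_simp
    ring

theorem integral_pow_mul_one_div_one_add_exp {l : ℕ} (hl : 0 < l) :
    ∫ t in Set.Ioi (0 : ℝ), t ^ (2 * l - 1) * (1 / (1 + exp (π * t))) =
      (-1) ^ (l + 1) * (2 ^ (2 * l) - 2) * bernoulli (2 * l) / (2 * (2 * l : ℕ)) := by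
  have hre : ((2 * l : ℕ) : ℂ).re = (2 * l : ℕ) := Complex.natCast_re _
  have hgam : Complex.Gamma ((2 * l : ℕ) : ℂ) = ((2 * l - 1).factorial : ℂ) := by
    rw [← Complex.Gamma_nat_eq_factorial, Nat.cast_sub (by omega)]
    simp
  have hM := hasSum_mellin_pi_mul (a := fun n : ℕ ↦ (-1 : ℂ) ^ n) (q := fun n ↦ (n : ℝ) + 1)
    (F := fun t ↦ ((1 / (1 + exp (π * t)) : ℝ) : ℂ)) (s := ((2 * l : ℕ) : ℂ))
    (fun n ↦ .inr (by positivity)) (by rw [hre]; positivity)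
    (fun t ht ↦ by
      have := Complex.hasSum_ofReal.2 (hasSum_neg_one_pow_mul_exp ht)
      simpa using this)
    (by
      simp_rw [hre, rpow_natCast, norm_pow, norm_neg, norm_one, one_pow]
      have := (summable_nat_add_iff 1).2 (summable_one_div_nat_pow.2 (by omega : 1 < 2 * l))
      simpa using this)
  have hmel : mellin (fun t ↦ ((1 / (1 + exp (π * t)) : ℝ) : ℂ)) ((2 * l : ℕ) : ℂ) =
      ((∫ t in Set.Ioi (0 : ℝ), t ^ (2 * l - 1) * (1 / (1 + exp (π * t))) : ℝ) : ℂ) := by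
    rw [mellin, ← integral_complex_ofReal]
    refine setIntegral_congr_fun measurableSet_Ioi fun t _ ↦ ?_
    have : ((2 * l : ℕ) : ℂ) - 1 = ((2 * l - 1 : ℕ) : ℂ) := by
      rw [Nat.cast_sub (by omega), Nat.cast_one]
    simp only [this, Complex.cpow_natCast, smul_eq_mul]
    push_cast
    rfl
  rw [hmel] at hM
  have hS := (hasSum_alternating_zeta_nat_s11 hl).mul_left ((π ^ (2 * l))⁻¹ * (2 * l - 1).factorial)
  have hM' : HasSum (fun n : ℕ ↦ (π ^ (2 * l))⁻¹ * (2 * l - 1).factorial *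
      ((-1 : ℝ) ^ n / ((n : ℝ) + 1) ^ (2 * l)))
      (∫ t in Set.Ioi (0 : ℝ), t ^ (2 * l - 1) * (1 / (1 + exp (π * t)))) := by
    rw [← Complex.hasSum_ofReal]
    convert! hM using 1
    ext n
    rw [hgam, Complex.cpow_neg, Complex.cpow_natCast, Complex.cpow_natCast]
    push_cast
    ring
  rw [hM'.unique hS, ← Nat.mul_factorial_pred (by omega : 2 * l ≠ 0)]
  have h1 : ((2 * l - 1).factorial : ℝ) ≠ 0 := by positivity
  have h2 : ((2 * l : ℕ) : ℝ) ≠ 0 := by positivity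
  rw [Nat.cast_mul (2 * l)]
  field_simp

theorem logistic_integer_moments
    {Ω : Type*} [MeasurableSpace Ω] (μ : Measure Ω) [IsProbabilityMeasure μ]
    (X : Ω → ℝ) (hX : Measurable X)
    (hcdf : ∀ x : ℝ, μ {ω | X ω ≤ x} = ENNReal.ofReal (1 / (1 + Real.exp (-π * x))))
    (l : ℕ) (hl : 0 < l) :
    (∫ ω, X ω ^ (2 * l) ∂μ = (2 ^ (2 * l) - 2) * |(bernoulli (2 * l) : ℝ)|) ∧
      ∫ ω, X ω ^ (2 * l - 1) ∂μ = 0 := by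
  have : IsProbabilityMeasure (μ.map X) := Measure.isProbabilityMeasure_map hX.aemeasurable
  have hν (x : ℝ) : μ.map X (Set.Iic x) = ENNReal.ofReal (1 / (1 + exp (-π * x))) := by
    rw [Measure.map_apply hX measurableSet_Iic, ← hcdf]
    rfl
  have hmap (m : ℕ) : ∫ ω, X ω ^ m ∂μ = ∫ x, x ^ m ∂(μ.map X) :=
    (integral_map hX.aemeasurable (continuous_pow m).aestronglyMeasurable).symm
  rw [hmap, hmap]
  constructor
  · have hE : ∫ x, x ^ (2 * l) ∂(μ.map X) =
        (-1) ^ (l + 1) * ((2 ^ (2 * l) - 2) * bernoulli (2 * l)) := by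
      have h2 : ((2 * l : ℕ) : ℝ) ≠ 0 := by positivity
      rw [← funext fun x : ℝ ↦ (even_two_mul l).pow_abs x, integral_abs_pow_of_logistic hν (by omega), integral_pow_mul_one_div_one_add_exp hl]
      field_simp
    have hnn : 0 ≤ ∫ x, x ^ (2 * l) ∂(μ.map X) :=
      integral_nonneg fun x ↦ (even_two_mul l).pow_nonneg x
    have h2 : (0 : ℝ) ≤ 2 ^ (2 * l) - 2 :=
      sub_nonneg.2 (le_self_pow₀ (by norm_num) (by omega))
    rw [← abs_of_nonneg hnn, hE, abs_mul, abs_mul, abs_of_nonneg h2]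
    simp
  · have hodd : Odd (2 * l - 1) := ⟨l - 1, by omega⟩
    have h : ∫ x, x ^ (2 * l - 1) ∂(μ.map X) = -∫ x, x ^ (2 * l - 1) ∂(μ.map X) := by
      conv_lhs => rw [← map_neg_eq_of_logistic hν]
      rw [integral_map (by fun_prop) (by fun_prop), ← integral_neg]
      simp_rw [hodd.neg_pow]
    linarith
end

section
/- If W₁ and W₂ are independent real-valued random variables each with the Gumbel distribution (density e^{−e^{−x}−x} on ℝ), then for every nonzero real t, E(e^{it(W₁−W₂)/π}) = t/sinh(t). -/
open MeasureTheory Real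

/-- The moment generating function of the Gumbel distribution is `Γ(1 - z)`. -/
theorem integral_exp_mul_gumbel_density {z : ℂ} (hz : z.re < 1) :
    ∫ x : ℝ, Real.exp (-Real.exp (-x) - x) • Complex.exp (z * x) = Complex.Gamma (1 - z) := by
  have himage : (fun x : ℝ => Real.exp (-x)) '' Set.univ = Set.Ioi 0 := by
    rw [Set.image_univ, ← Real.range_exp]
    exact neg_surjective.range_comp Real.exp
  have hderiv : ∀ x ∈ (Set.univ : Set ℝ),
      HasDerivWithinAt (fun x : ℝ => Real.exp (-x)) (-Real.exp (-x)) Set.univ x := by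
    intro x _
    simpa using (hasDerivAt_neg x).exp
  have hinj : Set.InjOn (fun x : ℝ => Real.exp (-x)) Set.univ := by
    intro x _ y _ hxy
    simpa using hxy
  rw [Complex.Gamma_eq_integral (by simpa using hz), Complex.GammaIntegral, ← himage,
    integral_image_eq_integral_abs_deriv_smul MeasurableSet.univ hderiv hinj,
    Measure.restrict_univ]
  refine integral_congr_ae (.of_forall fun x => ?_)
  have hpow : ((Real.exp (-x) : ℝ) : ℂ) ^ (1 - z - 1) = Complex.exp (z * x) := by
    rw [Complex.cpow_def_of_ne_zero (by simp), ← Complex.ofReal_log (Real.exp_pos _).le,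
      Real.log_exp]
    push_cast
    ring_nf
  simp only [hpow, abs_neg, abs_of_pos (Real.exp_pos _), Complex.real_smul]
  rw [sub_eq_add_neg, Real.exp_add]
  push_cast
  ring

/-- The moment generating function of a Gumbel random variable is `Γ(1 - z)`. -/
theorem integral_exp_mul_of_map_eq_gumbel {Ω : Type*} [MeasurableSpace Ω] {μ : Measure Ω}
    {W : Ω → ℝ} (hW : Measurable W)
    (hG : Measure.map W μ
      = volume.withDensity (fun x => ENNReal.ofReal (Real.exp (-Real.exp (-x) - x))))
    {z : ℂ} (hz : z.re < 1) :
    ∫ ω, Complex.exp (z * W ω) ∂μ = Complex.Gamma (1 - z) := by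
  have hmap := integral_map (μ := μ) hW.aemeasurable (f := fun x : ℝ => Complex.exp (z * x))
    (by fun_prop)
  rw [← hmap, hG, integral_withDensity_eq_integral_toReal_smul (by fun_prop)
    (.of_forall fun _ => ENNReal.ofReal_lt_top), ← integral_exp_mul_gumbel_density hz]
  simp only [ENNReal.toReal_ofReal (Real.exp_pos _).le]

theorem Complex.Gamma_one_sub_mul_Gamma_one_add {z : ℂ} (hz : z ≠ 0) :
    Complex.Gamma (1 - z) * Complex.Gamma (1 + z) = π * z / Complex.sin (π * z) := by
  rw [add_comm 1 z, Complex.Gamma_add_one z hz]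
  linear_combination z * Complex.Gamma_mul_Gamma_one_sub z

theorem gumbel_difference_scaled_charFun
    {Ω : Type*} [MeasurableSpace Ω] (μ : Measure Ω) [IsProbabilityMeasure μ]
    (W₁ W₂ : Ω → ℝ) (hW₁ : Measurable W₁) (hW₂ : Measurable W₂)
    (hindep : ProbabilityTheory.IndepFun W₁ W₂ μ)
    (hG₁ : Measure.map W₁ μ
      = volume.withDensity (fun x => ENNReal.ofReal (Real.exp (-Real.exp (-x) - x))))
    (hG₂ : Measure.map W₂ μ
      = volume.withDensity (fun x => ENNReal.ofReal (Real.exp (-Real.exp (-x) - x))))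
    (t : ℝ) (ht : t ≠ 0) :
    ∫ ω, Complex.exp (Complex.I * t * ((W₁ ω - W₂ ω) / π)) ∂μ
      = ((t / Real.sinh t : ℝ) : ℂ) := by
  have hπ : (π : ℂ) ≠ 0 := by exact_mod_cast Real.pi_ne_zero
  have ht' : (t : ℂ) ≠ 0 := by exact_mod_cast ht
  set z : ℂ := t / π * Complex.I with hz
  have hz0 : z ≠ 0 := mul_ne_zero (div_ne_zero ht' hπ) Complex.I_ne_zero
  have hre : z.re = 0 := by
    rw [hz, ← Complex.ofReal_div, Complex.re_ofReal_mul, Complex.I_re, mul_zero]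
  have hπz : π * z = t * Complex.I := by
    rw [hz]
    field_simp
  have hsplit : ∀ ω, Complex.exp (Complex.I * t * ((W₁ ω - W₂ ω) / π))
      = Complex.exp (z * W₁ ω) * Complex.exp (-z * W₂ ω) := by
    intro ω
    rw [← Complex.exp_add, hz]
    ring_nf
  have hprod := (hindep.comp (φ := fun x : ℝ => Complex.exp (z * x))
    (ψ := fun x : ℝ => Complex.exp (-z * x)) (by fun_prop)
    (by fun_prop)).integral_fun_mul_eq_mul_integral
    (by fun_prop) (by fun_prop)
  simp only [Function.comp_def] at hprod
  simp only [hsplit]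
  rw [hprod, integral_exp_mul_of_map_eq_gumbel hW₁ hG₁ (by simp [hre]),
    integral_exp_mul_of_map_eq_gumbel hW₂ hG₂ (by simp [hre]), sub_neg_eq_add,
    Complex.Gamma_one_sub_mul_Gamma_one_add hz0, hπz, Complex.sin_mul_I,
    mul_div_mul_right _ _ Complex.I_ne_zero]
  push_cast
  rfl
end
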